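/- Let N ≥ 1, n ≥ 2 and 1 ≤ k ≤ n−1 be integers, R > 0 and 1 < s < ∞. Then for any u ∈ W^{1,s}_{δ,T}(B_R; Λ^k ℝ^n ⊗ ℝ^N), there exists a constant c > 0 depending only on k, n, N, s such that (⨍_{B_R} |u|^{s*})^{1/s*} ≤ c R (⨍_{B_R} |du|^s)^{1/s}, where s* = ns/(n−s) is the Sobolev exponent. -/

import Mathlib

open MeasureTheory Metric Filter
open scoped ENNReal NNReal

noncomputable section

/-- Euclidean space `ℝ^n`. -/
abbrev En (n : ℕ) : Type := EuclideanSpace ℝ (Fin n)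

/-- Index set for the coefficients of a `k`-form on `ℝ^n`: increasing multi-indices,
identified with `k`-element subsets of `Fin n`. -/
abbrev FormIdx (n k : ℕ) : Type := {s : Finset (Fin n) // s.card = k}

/-- An `ℝ^N`-valued `k`-covector on `ℝ^n`, described by its coefficients. -/
abbrev Form (n N k : ℕ) : Type := FormIdx n k × Fin N → ℝ

variable {n N k : ℕ}

/-- Euclidean inner product of two (vector-valued) forms. -/
def finner (v w : Form n N k) : ℝ := ∑ q, v q * w q

/-- Euclidean norm of a (vector-valued) form. -/
def fnorm (v : Form n N k) : ℝ := Real.sqrt (∑ q, v q ^ 2)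

/-- Euclidean norm of a full array of partial derivatives (a gradient). -/
def gnorm (H : Fin n → Form n N k) : ℝ := Real.sqrt (∑ i, ∑ q, H i q ^ 2)

/-- The pointwise exterior derivative of a `k`-form, assembled from the array
`G i = ∂_i u` of its partial derivatives. -/
def extD (G : Fin n → Form n N k) : Form n N (k + 1) := fun q =>
  ∑ i : Fin n,
    if h : i ∈ q.1.1 then
      (-1 : ℝ) ^ (q.1.1.filter (fun j => j < i)).card *
        G i (⟨q.1.1.erase i, by simp [Finset.card_erase_of_mem h, q.1.2]⟩, q.2)
    else 0

/-- The pointwise codifferential of a `(k+1)`-form, assembled from the array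
`G i = ∂_i u` of its partial derivatives. -/
def codiff (G : Fin n → Form n N (k + 1)) : Form n N k := fun q =>
  -∑ i : Fin n,
      if h : i ∈ q.1.1 then 0
      else
        (-1 : ℝ) ^ (q.1.1.filter (fun j => j < i)).card *
          G i (⟨insert i q.1.1, by simp [Finset.card_insert_of_notMem h, q.1.2]⟩, q.2)

/-- The nonlinearity `z ↦ t |z|^{p-2} z`. -/
def nl (p t : ℝ) (z : Form n N k) : Form n N k := fun q => t * fnorm z ^ (p - 2) * z q

/-- The auxiliary map `V(z) = |z|^{(p-2)/2} z`. -/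
def Vform (p : ℝ) (z : Form n N k) : Form n N k := fun q => fnorm z ^ ((p - 2) / 2) * z q

/-- The `i`-th standard basis vector of `ℝ^n`. -/
def basisVec (i : Fin n) : En n := EuclideanSpace.single i 1

/-- Scalar test functions: smooth and compactly supported inside `Ω`. -/
def IsTestFun (Ω : Set (En n)) (φ : En n → ℝ) : Prop :=
  ContDiff ℝ (⊤ : ℕ∞) φ ∧ HasCompactSupport φ ∧ tsupport φ ⊆ Ω

/-- Test `k`-forms: componentwise smooth and compactly supported inside `Ω`. -/
def IsTestForm (Ω : Set (En n)) (φ : En n → Form n N k) : Prop :=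
  (∀ q, ContDiff ℝ (⊤ : ℕ∞) fun x => φ x q) ∧ HasCompactSupport φ ∧ tsupport φ ⊆ Ω

/-- The (classical) array of partial derivatives of a form-valued map. -/
def smoothGrad (φ : En n → Form n N k) (x : En n) : Fin n → Form n N k := fun i q =>
  fderiv ℝ (fun y => φ y q) x (basisVec i)

/-- `g` is the weak (distributional) `i`-th partial derivative of `u` on `Ω`. -/
def HasWeakPartial (Ω : Set (En n)) (u g : En n → ℝ) (i : Fin n) : Prop :=
  ∀ φ : En n → ℝ, IsTestFun Ω φ →
    ∫ x in Ω, u x * fderiv ℝ φ x (basisVec i) = -∫ x in Ω, g x * φ x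

/-- `G` is the weak gradient (array of weak partial derivatives) of the form `u` on `Ω`. -/
def HasWeakGrad (Ω : Set (En n)) (u : En n → Form n N k)
    (G : En n → Fin n → Form n N k) : Prop :=
  ∀ i q, HasWeakPartial Ω (fun x => u x q) (fun x => G x i q) i

/-- Membership in `W^{1,p}(Ω)` for a form `u` with weak gradient `G`. -/
def MemW1p (Ω : Set (En n)) (p : ℝ) (u : En n → Form n N k)
    (G : En n → Fin n → Form n N k) : Prop :=
  HasWeakGrad Ω u G ∧
    (∀ q, AEStronglyMeasurable (fun x => u x q) (volume.restrict Ω)) ∧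
    (∀ i q, AEStronglyMeasurable (fun x => G x i q) (volume.restrict Ω)) ∧
    IntegrableOn (fun x => fnorm (u x) ^ p) Ω volume ∧
    IntegrableOn (fun x => gnorm (G x) ^ p) Ω volume

/-- Membership in `W^{1,p}_loc(Ω)` for a form `u` with weak gradient `G`. -/
def MemW1pLoc (Ω : Set (En n)) (p : ℝ) (u : En n → Form n N k)
    (G : En n → Fin n → Form n N k) : Prop :=
  HasWeakGrad Ω u G ∧
    (∀ q, AEStronglyMeasurable (fun x => u x q) (volume.restrict Ω)) ∧
    (∀ i q, AEStronglyMeasurable (fun x => G x i q) (volume.restrict Ω)) ∧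
    ∀ K, K ⊆ Ω → IsCompact K →
      IntegrableOn (fun x => fnorm (u x) ^ p) K volume ∧
      IntegrableOn (fun x => gnorm (G x) ^ p) K volume

/-- `δ f = 0` on `Ω` in the sense of distributions: `∫ ⟨f, dψ⟩ = 0` for every smooth
compactly supported form `ψ` of degree one less. (Vacuous for `0`-forms.) -/
def WeaklyCoclosed (Ω : Set (En n)) (f : En n → Form n N k) : Prop :=
  ∀ (j : ℕ) (h : j + 1 = k) (ψ : En n → Form n N j), IsTestForm Ω ψ →
    ∫ x in Ω, finner (f x) (cast (congrArg (Form n N) h) (extD (smoothGrad ψ x))) = 0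

/-- Weak formulation of the vanishing of the tangential part `ν ∧ u = 0` on `∂B`:
the integration-by-parts formula `∫_B ⟨du, ψ⟩ = ∫_B ⟨u, δψ⟩` holds without boundary
contribution for every smooth `(k+1)`-form `ψ`. -/
def TangentialZero (B : Set (En n)) (u : En n → Form n N k)
    (G : En n → Fin n → Form n N k) : Prop :=
  ∀ ψ : En n → Form n N (k + 1), (∀ q, ContDiff ℝ (⊤ : ℕ∞) fun x => ψ x q) →
    ∫ x in B, finner (extD (G x)) (ψ x) = ∫ x in B, finner (u x) (codiff (smoothGrad ψ x))

/-- The space `W^{1,p}_{δ,T}(B)`: `W^{1,p}` forms which are weakly coclosed in `B` and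
have vanishing tangential part on `∂B`. -/
def MemWdeltaT (B : Set (En n)) (p : ℝ) (u : En n → Form n N k)
    (G : En n → Fin n → Form n N k) : Prop :=
  MemW1p B p u G ∧ WeaklyCoclosed B u ∧ TangentialZero B u G

/-- `u` (with weak gradient `G`) is a local weak solution of
`δ(a(x) |du|^{p-2} du) = f` on `Ω`. -/
def IsLocalWeakSolution (Ω : Set (En n)) (p : ℝ) (a : En n → ℝ)
    (u : En n → Form n N k) (G : En n → Fin n → Form n N k)
    (f : En n → Form n N k) : Prop :=
  ∀ φ : En n → Form n N k, IsTestForm Ω φ →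
    ∫ x in Ω, finner (nl p (a x) (extD (G x))) (extD (smoothGrad φ x)) =
      ∫ x in Ω, finner (f x) (φ x)

/-- The Lorentz (quasi-)norm `‖g‖_{L^{(p,θ)}(μ)}`. -/
def lorentzNorm {α : Type*} [MeasurableSpace α] (μ : Measure α) (p : ℝ) (θ : ℝ≥0∞)
    (g : α → ℝ) : ℝ≥0∞ :=
  if θ = ⊤ then
    (⨆ t : ℝ, if 0 < t then ENNReal.ofReal (t ^ p) * μ {x | t < |g x|} else 0) ^ (1 / p)
  else
    (∫⁻ t in Set.Ioi (0 : ℝ),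
        (ENNReal.ofReal (t ^ p) * μ {x | t < |g x|}) ^ (θ.toReal / p) / ENNReal.ofReal t) ^
      (1 / θ.toReal)

/-- Membership in the Lorentz space `L^{(p,θ)}(s)`. -/
def MemLorentzOn {α : Type*} [MeasurableSpace α] (μ : Measure α) (p : ℝ) (θ : ℝ≥0∞)
    (g : α → ℝ) (s : Set α) : Prop :=
  AEStronglyMeasurable g (μ.restrict s) ∧ lorentzNorm (μ.restrict s) p θ g ≠ ⊤

/-- Local membership in the Lorentz space `L^{(p,θ)}` on the open set `Ω`. -/
def MemLorentzLoc (p : ℝ) (θ : ℝ≥0∞) (g : En n → ℝ) (Ω : Set (En n)) : Prop :=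
  ∀ K, K ⊆ Ω → IsCompact K → MemLorentzOn volume p θ g K

/-- The `L^s` norm of a scalar function on a set, valued in `ℝ≥0∞`. -/
def lpNormOn (s : ℝ) (g : En n → ℝ) (A : Set (En n)) : ℝ≥0∞ :=
  (∫⁻ x in A, ENNReal.ofReal (|g x| ^ s)) ^ (1 / s)

/-- A Dini modulus of continuity. -/
def IsDiniModulus (ω : ℝ → ℝ) : Prop :=
  (∀ t, 0 ≤ ω t) ∧ MonotoneOn ω (Set.Ici 0) ∧
    IntegrableOn (fun t => ω t / t) (Set.Ioc 0 1) volume ∧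
    Tendsto ω (nhdsWithin 0 (Set.Ioi 0)) (nhds 0)

/-- `ω` is a modulus of continuity for `a` on `Ω`. -/
def IsModulusFor (ω : ℝ → ℝ) (a : En n → ℝ) (Ω : Set (En n)) : Prop :=
  ∀ x ∈ Ω, ∀ y ∈ Ω, |a x - a y| ≤ ω ‖x - y‖

/-- Dini continuity on `Ω`. -/
def DiniContinuousOn (a : En n → ℝ) (Ω : Set (En n)) : Prop :=
  ∃ ω, IsDiniModulus ω ∧ IsModulusFor ω a Ω

/-- `a` is `α`-Hölder with constant `C` on `s`. -/
def HolderOn (α C : ℝ) (a : En n → ℝ) (s : Set (En n)) : Prop :=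
  ∀ x ∈ s, ∀ y ∈ s, |a x - a y| ≤ C * ‖x - y‖ ^ α

/-- `g` agrees a.e. on `Ω` with a function continuous on `Ω`. -/
def HasContinuousRepOn {V : Type*} [TopologicalSpace V] (Ω : Set (En n)) (g : En n → V) :
    Prop :=
  ∃ v : En n → V, ContinuousOn v Ω ∧ ∀ᵐ x ∂volume.restrict Ω, g x = v x

/-- `g` has locally vanishing mean oscillation in `Ω`. -/
def LocallyVMOOn {V : Type*} [NormedAddCommGroup V] [NormedSpace ℝ V] (Ω : Set (En n))
    (g : En n → V) : Prop :=
  ∀ K, K ⊆ Ω → IsCompact K → ∀ ε > 0, ∃ r₀ > 0, ∀ x ∈ K, ∀ r, 0 < r → r ≤ r₀ →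
    (⨍ y in ball x r, ‖g y - ⨍ z in ball x r, g z‖) ≤ ε

/-- `g` has locally bounded mean oscillation in `Ω`. -/
def LocallyBMOOn {V : Type*} [NormedAddCommGroup V] [NormedSpace ℝ V] (Ω : Set (En n))
    (g : En n → V) : Prop :=
  ∀ K, K ⊆ Ω → IsCompact K → ∃ C : ℝ, ∃ r₀ > 0, ∀ x ∈ K, ∀ r, 0 < r → r ≤ r₀ →
    (⨍ y in ball x r, ‖g y - ⨍ z in ball x r, g z‖) ≤ C

/-- The `p`-th power of the Campanato seminorm `[u]^p_{𝓛^{p,λ}(s)}`, valued in `ℝ≥0∞`. -/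
def campanatoSemi {V : Type*} [NormedAddCommGroup V] [NormedSpace ℝ V] (p lam : ℝ)
    (s : Set (En n)) (u : En n → V) : ℝ≥0∞ :=
  ⨆ (x₀ : En n) (_ : x₀ ∈ closure s) (ρ : ℝ) (_ : 0 < ρ),
    ENNReal.ofReal
      (ρ ^ (-lam) * ∫ y in ball x₀ ρ ∩ s, ‖u y - ⨍ z in ball x₀ ρ ∩ s, u z‖ ^ p)

/-- The Campanato norm `‖u‖_{𝓛^{p,λ}(s)} = ‖u‖_{L^p(s)} + [u]_{𝓛^{p,λ}(s)}`. -/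
def campanatoNorm {V : Type*} [NormedAddCommGroup V] [NormedSpace ℝ V] (p lam : ℝ)
    (s : Set (En n)) (u : En n → V) : ℝ≥0∞ :=
  (∫⁻ y in s, ENNReal.ofReal (‖u y‖ ^ p)) ^ (1 / p) + campanatoSemi p lam s u ^ (1 / p)

/-- Membership in the Campanato space `𝓛^{p,λ}(s)`. -/
def MemCampanatoOn {V : Type*} [NormedAddCommGroup V] [NormedSpace ℝ V] (p lam : ℝ)
    (s : Set (En n)) (u : En n → V) : Prop :=
  AEStronglyMeasurable u (volume.restrict s) ∧
    IntegrableOn (fun y => ‖u y‖ ^ p) s volume ∧ campanatoSemi p lam s u ≠ ⊤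

/-- Local membership in the Campanato space `𝓛^{p,λ}` on `Ω`. -/
def MemCampanatoLoc {V : Type*} [NormedAddCommGroup V] [NormedSpace ℝ V] (p lam : ℝ)
    (Ω : Set (En n)) (u : En n → V) : Prop :=
  ∀ K, K ⊆ Ω → IsCompact K → MemCampanatoOn p lam K u

/-- `v` is of class `C^{1,θ}` locally on `Ω`. -/
def C1HolderLocOn {V : Type*} [NormedAddCommGroup V] [NormedSpace ℝ V] (θ : ℝ)
    (Ω : Set (En n)) (v : En n → V) : Prop :=
  ∃ Dv : En n → En n →L[ℝ] V, (∀ x ∈ Ω, HasFDerivAt v (Dv x) x) ∧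
    ∀ K, K ⊆ Ω → IsCompact K →
      ∃ C : ℝ, 0 ≤ C ∧ ∀ x ∈ K, ∀ y ∈ K, ‖Dv x - Dv y‖ ≤ C * ‖x - y‖ ^ θ

/-- Local membership in `L^q` for a form-valued map. -/
def MemLqLoc (q : ℝ) (f : En n → Form n N k) (Ω : Set (En n)) : Prop :=
  (∀ r, AEStronglyMeasurable (fun x => f x r) (volume.restrict Ω)) ∧
    ∀ K, K ⊆ Ω → IsCompact K → IntegrableOn (fun x => fnorm (f x) ^ q) K volume

/-- `x` is a Lebesgue point of the form-valued map `g`. -/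
def IsLebesguePoint (g : En n → Form n N k) (x : En n) : Prop :=
  Tendsto (fun r => ⨍ y in ball x r, fnorm (g y - g x)) (nhdsWithin 0 (Set.Ioi 0)) (nhds 0)


/-! ### Algebra of exterior and interior multiplication -/

/-- The sign attached to an index and a multi-index. -/
def fsgn (i : Fin n) (S : Finset (Fin n)) : ℝ := (-1 : ℝ) ^ (S.filter (fun j => j < i)).card

/-- Exterior multiplication by the `i`-th basis covector. -/
def Wop (i : Fin n) (v : Form n N k) : Form n N (k + 1) := fun q =>
  if h : i ∈ q.1.1 then
    fsgn i q.1.1 * v (⟨q.1.1.erase i, by simp [Finset.card_erase_of_mem h, q.1.2]⟩, q.2)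
  else 0

/-- Interior multiplication by the `i`-th basis vector. -/
def Iop (i : Fin n) (v : Form n N (k + 1)) : Form n N k := fun q =>
  if h : i ∈ q.1.1 then 0
  else fsgn i q.1.1 *
    v (⟨insert i q.1.1, by simp [Finset.card_insert_of_notMem h, q.1.2]⟩, q.2)

lemma extD_eq (G : Fin n → Form n N k) : extD G = ∑ i, Wop i (G i) := by
  funext q
  simp only [extD, Finset.sum_apply, Wop, fsgn]

lemma codiff_eq (G : Fin n → Form n N (k + 1)) : codiff G = -∑ i, Iop i (G i) := by
  funext q
  simp only [codiff, Pi.neg_apply, Finset.sum_apply, Iop, fsgn]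

lemma fsgn_insert (i j : Fin n) (S : Finset (Fin n)) (hj : j ∉ S) :
    fsgn i (insert j S) = (if j < i then -1 else 1) * fsgn i S := by
  unfold fsgn
  rw [Finset.filter_insert]
  split_ifs with h
  · rw [Finset.card_insert_of_notMem (by simp [hj]), pow_succ]; ring
  · simp

lemma fsgn_erase (i j : Fin n) (S : Finset (Fin n)) (hj : j ∈ S) :
    fsgn i (S.erase j) = (if j < i then -1 else 1) * fsgn i S := by
  have h := fsgn_insert i j (S.erase j) (Finset.notMem_erase j S)
  rw [Finset.insert_erase hj] at h
  rw [h]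
  split_ifs <;> ring

lemma fsgn_mul_self (i : Fin n) (S : Finset (Fin n)) : fsgn i S * fsgn i S = 1 := by
  unfold fsgn
  rw [← mul_pow]; simp

lemma abs_fsgn (i : Fin n) (S : Finset (Fin n)) : |fsgn i S| = 1 := by
  unfold fsgn
  simp [abs_pow]

lemma Wop_add (i : Fin n) (v w : Form n N k) : Wop i (v + w) = Wop i v + Wop i w := by
  funext q; simp only [Wop, Pi.add_apply]; split_ifs <;> ring

lemma Wop_smul (i : Fin n) (c : ℝ) (v : Form n N k) : Wop i (c • v) = c • Wop i v := by
  funext q; simp only [Wop, Pi.smul_apply, smul_eq_mul]; split_ifs <;> ring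

lemma Iop_add (i : Fin n) (v w : Form n N (k + 1)) : Iop i (v + w) = Iop i v + Iop i w := by
  funext q; simp only [Iop, Pi.add_apply]; split_ifs <;> ring

lemma Iop_smul (i : Fin n) (c : ℝ) (v : Form n N (k + 1)) : Iop i (c • v) = c • Iop i v := by
  funext q; simp only [Iop, Pi.smul_apply, smul_eq_mul]; split_ifs <;> ring

/-- Exterior multiplication as a linear map. -/
def Wl (i : Fin n) : Form n N k →ₗ[ℝ] Form n N (k + 1) where
  toFun := Wop i
  map_add' := Wop_add i
  map_smul' := Wop_smul i

/-- Interior multiplication as a linear map. -/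
def Il (i : Fin n) : Form n N (k + 1) →ₗ[ℝ] Form n N k where
  toFun := Iop i
  map_add' := Iop_add i
  map_smul' := Iop_smul i

lemma extD_eq' (G : Fin n → Form n N k) : extD G = ∑ i, Wl i (G i) := extD_eq G

lemma codiff_eq' (G : Fin n → Form n N (k + 1)) : codiff G = -∑ i, Il i (G i) := codiff_eq G

lemma Wl_anti (i j : Fin n) (v : Form n N k) : Wl i (Wl j v) = - Wl j (Wl i v) := by
  funext q
  obtain ⟨⟨S, hS⟩, r⟩ := q
  simp only [Wl, LinearMap.coe_mk, AddHom.coe_mk, Wop, Pi.neg_apply, Finset.mem_erase]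
  by_cases hij : i = j
  · subst hij; simp
  by_cases hi : i ∈ S
  · by_cases hj : j ∈ S
    · have hji : j ≠ i := fun h => hij h.symm
      simp only [hi, hj, hij, hji, ne_eq, not_false_eq_true, and_self, dite_true,
        fsgn_erase _ _ _ hi, fsgn_erase _ _ _ hj, Finset.erase_right_comm (a := j) (b := i)]
      rcases lt_or_gt_of_ne hij with h | h
      · simp only [h, h.not_gt, if_true, if_false]; ring
      · simp only [h, h.not_gt, if_true, if_false]; ring
    · simp [hi, hj]
  · simp [hi]

lemma Il_Wl (l m : Fin n) (v : Form n N (k + 1)) :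
    Il l (Wl m v) = (if l = m then v else 0) - Wl m (Il l v) := by
  funext q
  obtain ⟨⟨S, hS⟩, r⟩ := q
  simp only [Wl, Il, LinearMap.coe_mk, AddHom.coe_mk, Wop, Iop, Pi.sub_apply, Finset.mem_erase,
    Finset.mem_insert]
  by_cases hlm : l = m
  · subst hlm
    by_cases hl : l ∈ S
    · have h1 := fsgn_mul_self l S
      simp only [hl, ne_eq, not_true_eq_false, false_and, dite_true, dite_false, if_true,
        fsgn_erase _ _ _ hl, lt_irrefl, if_false, one_mul, Finset.insert_erase hl]
      rw [← mul_assoc, h1]; ring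
    · have h1 := fsgn_mul_self l S
      simp only [hl, dite_true, dite_false, if_true, true_or,
        fsgn_insert _ _ _ hl, lt_irrefl, if_false, one_mul, Finset.erase_insert hl]
      rw [← mul_assoc, h1]; ring
  · have hml : m ≠ l := fun h => hlm h.symm
    by_cases hl : l ∈ S
    · simp [hl, hlm]
    · by_cases hm : m ∈ S
      · simp only [hl, hm, hlm, hml, or_true, and_false, dite_true, dite_false, if_false,
          fsgn_erase _ _ _ hm, fsgn_insert _ _ _ hl, Pi.zero_apply,
          Finset.erase_insert_of_ne hlm]
        rcases lt_or_gt_of_ne hlm with h | h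
        · simp only [h, h.not_gt, if_true, if_false]; ring
        · simp only [h, h.not_gt, if_true, if_false]; ring
      · simp [hl, hm, hlm, hml]

lemma sum_Il_Wl (v : Form n N k) : ∑ l, Il l (Wl l v) = ((n : ℝ) - k) • v := by
  funext q
  obtain ⟨⟨S, hS⟩, r⟩ := q
  have key : ∀ l : Fin n, (Il l (Wl l v)) (⟨S, hS⟩, r) =
      if l ∈ S then 0 else v (⟨S, hS⟩, r) := by
    intro l
    simp only [Wl, Il, LinearMap.coe_mk, AddHom.coe_mk, Wop, Iop,
      Finset.mem_insert]
    by_cases hl : l ∈ S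
    · simp [hl]
    · have h1 := fsgn_mul_self l S
      simp only [hl, dite_true, dite_false, true_or, if_false,
        fsgn_insert _ _ _ hl, lt_irrefl, one_mul, Finset.erase_insert hl]
      rw [← mul_assoc, h1]; ring
  simp only [Finset.sum_apply, key, Pi.smul_apply, smul_eq_mul]
  rw [Finset.sum_ite]
  simp only [Finset.sum_const_zero, zero_add, Finset.sum_const, nsmul_eq_mul]
  congr 1
  have : (Finset.univ.filter (fun x => x ∉ S)) = Sᶜ := by ext; simp
  rw [this, Finset.card_compl, hS, Fintype.card_fin, Nat.cast_sub]
  rw [← hS]; simpa using Finset.card_le_univ S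

/-- The composition `e_m ∧ (ι_l v)`, available in all degrees. -/
def Ml (m l : Fin n) (v : Form n N k) : Form n N k := (if l = m then v else 0) - Il l (Wl m v)

lemma Il_Wl' (l m : Fin n) (v : Form n N k) :
    Il l (Wl m v) = (if l = m then v else 0) - Ml m l v := by
  simp [Ml]

lemma Wl_Ml_anti (p m l : Fin n) (v : Form n N k) :
    Wl p (Ml m l v) = - Wl m (Ml p l v) := by
  have h1 : Wl p (Il l (Wl m v)) = (if l = p then Wl m v else 0) - Il l (Wl p (Wl m v)) := by
    rw [Il_Wl]; abel
  have h2 : Wl m (Il l (Wl p v)) = (if l = m then Wl p v else 0) - Il l (Wl m (Wl p v)) := by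
    rw [Il_Wl]; abel
  simp only [Ml, map_sub, h1, h2, Wl_anti p m v, map_neg]
  split_ifs <;> simp <;> abel


/-! ### The Hardy–Littlewood–Sobolev inequality -/

lemma lintegral_scale (n : ℕ) (g₁ gr : En n → ℝ≥0∞) (r a : ℝ) (hr : 0 < r)
    (h : ∀ z, gr (r • z) = ENNReal.ofReal (r ^ a) * g₁ z) (hm : Measurable gr)
    (hm1 : Measurable g₁) :
    ∫⁻ z, gr z = ENNReal.ofReal (r ^ (a + n)) * ∫⁻ z, g₁ z := by
  have h1 : ∫⁻ z, gr (r • z) = ENNReal.ofReal (r ^ a) * ∫⁻ z, g₁ z := by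
    simp_rw [h]
    rw [lintegral_const_mul _ hm1]
  have h2 : ∫⁻ z, gr (r • z) = ∫⁻ z, gr z ∂(Measure.map (fun z : En n => r • z) volume) := by
    rw [lintegral_map hm (by fun_prop)]
  rw [Measure.map_addHaar_smul _ hr.ne', lintegral_smul_measure] at h2
  rw [h2] at h1
  have hn : Module.finrank ℝ (En n) = n := by simp
  rw [hn] at h1
  have hpos : 0 < r ^ n := pow_pos hr n
  rw [abs_of_pos (inv_pos.mpr hpos)] at h1
  have h3 : ENNReal.ofReal (r ^ n) * (ENNReal.ofReal (r ^ n)⁻¹ * ∫⁻ z, gr z) = ∫⁻ z, gr z := by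
    rw [← mul_assoc, ← ENNReal.ofReal_mul hpos.le, mul_inv_cancel₀ hpos.ne']
    simp
  rw [← h3]
  rw [smul_eq_mul] at h1
  rw [h1, ← mul_assoc, ← ENNReal.ofReal_mul hpos.le, Real.rpow_add hr, Real.rpow_natCast, mul_comm (r ^ n)]

lemma kernel_small (n : ℕ) (hn : 2 ≤ n) : ∃ c0 : ℝ, 0 < c0 ∧ ∀ r : ℝ, 0 < r →
    ∫⁻ z : En n, (ball (0 : En n) r).indicator
      (fun z => ENNReal.ofReal (‖z‖ ^ (1 - (n : ℝ)))) z ≤ ENNReal.ofReal (c0 * r) := by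
  have hn' : Module.finrank ℝ (En n) = n := by simp
  have hmeas : Measurable (fun z : En n => ENNReal.ofReal (‖z‖ ^ (1 - (n : ℝ)))) := by fun_prop
  set c : ℝ≥0∞ := ∫⁻ z : En n, (ball (0 : En n) 1).indicator
      (fun z => ENNReal.ofReal (‖z‖ ^ (1 - (n : ℝ)))) z with hc
  have hfin : c < ⊤ := by
    rw [hc, lintegral_indicator measurableSet_ball]
    have hi : IntegrableOn (fun z : En n => ‖z‖ ^ (1 - (n : ℝ))) (ball 0 1) volume := by
      refine integrableOn_ball_of_norm_le_rpow (C := 1) (α := (n : ℝ) - 1)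
        (by rw [hn']; omega) (by rw [hn']; linarith) (Eventually.of_forall fun x => ?_) ?_
      · rw [Real.norm_of_nonneg (by positivity)]
        simp
      · exact (by fun_prop : Measurable fun z : En n => ‖z‖ ^ (1 - (n : ℝ))).aestronglyMeasurable
    have := hi.2
    rw [hasFiniteIntegral_iff_ofReal (Eventually.of_forall fun x => by positivity)] at this
    exact this
  refine ⟨c.toReal + 1, by positivity, fun r hr => ?_⟩
  rw [lintegral_scale n ((ball (0 : En n) 1).indicator
      (fun z => ENNReal.ofReal (‖z‖ ^ (1 - (n : ℝ))))) _ r (1 - n) hr ?_ 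
      (hmeas.indicator measurableSet_ball) (hmeas.indicator measurableSet_ball)]
  · rw [← hc]
    have : (1 - (n : ℝ)) + n = 1 := by ring
    rw [this, Real.rpow_one, mul_comm (c.toReal + 1), ENNReal.ofReal_mul hr.le]
    gcongr
    rw [← ENNReal.ofReal_toReal hfin.ne]
    apply ENNReal.ofReal_le_ofReal
    rw [ENNReal.toReal_ofReal ENNReal.toReal_nonneg]
    linarith
  · intro z
    by_cases hz : z ∈ ball (0 : En n) 1
    · have hz' : r • z ∈ ball (0 : En n) r := by
        simp only [mem_ball_zero_iff] at hz ⊢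
        rw [norm_smul, Real.norm_of_nonneg hr.le]
        nlinarith
      rw [Set.indicator_of_mem hz, Set.indicator_of_mem hz', norm_smul,
        Real.norm_of_nonneg hr.le, Real.mul_rpow hr.le (norm_nonneg _),
        ENNReal.ofReal_mul (by positivity)]
    · have hz' : r • z ∉ ball (0 : En n) r := by
        simp only [mem_ball_zero_iff, not_lt] at hz ⊢
        rw [norm_smul, Real.norm_of_nonneg hr.le]
        nlinarith
      rw [Set.indicator_of_notMem hz, Set.indicator_of_notMem hz', mul_zero]

lemma kernel_large (n : ℕ) (hn : 2 ≤ n) (p' : ℝ) (hp' : (n : ℝ) < (n - 1) * p') :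
    ∃ c1 : ℝ, 0 < c1 ∧ ∀ r : ℝ, 0 < r →
    ∫⁻ z : En n, (ball (0 : En n) r)ᶜ.indicator
      (fun z => ENNReal.ofReal (‖z‖ ^ (1 - (n : ℝ))) ^ p') z ≤
        ENNReal.ofReal (c1 * r ^ ((1 - n) * p' + n)) := by
  have hn' : Module.finrank ℝ (En n) = n := by simp
  have hnr : (2 : ℝ) ≤ n := by exact_mod_cast hn
  have hmeas : Measurable (fun z : En n => ENNReal.ofReal (‖z‖ ^ (1 - (n : ℝ))) ^ p') := by fun_prop
  set c : ℝ≥0∞ := ∫⁻ z : En n, (ball (0 : En n) 1)ᶜ.indicator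
      (fun z => ENNReal.ofReal (‖z‖ ^ (1 - (n : ℝ))) ^ p') z with hc
  have hp0 : 0 < p' := by
    by_contra h
    push Not at h
    nlinarith
  have hfin : c < ⊤ := by
    have : Nontrivial (En n) := by
      apply Module.nontrivial_of_finrank_pos (R := ℝ)
      rw [hn']; omega
    have hi : Integrable (fun z : En n => (Set.Ici (1:ℝ)).indicator 
        (fun y => y ^ ((1 - (n : ℝ)) * p')) ‖z‖) volume := by
      rw [integrable_fun_norm_addHaar volume (f := (Set.Ici (1:ℝ)).indicator 
        (fun y => y ^ ((1 - (n : ℝ)) * p'))), hn']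
      have : IntegrableOn (fun y : ℝ => y ^ ((n : ℝ) - 1 + (1 - (n : ℝ)) * p')) (Set.Ioi 1) :=
        integrableOn_Ioi_rpow_of_lt (by nlinarith) one_pos
      have h2 : IntegrableOn (fun y : ℝ => y ^ ((n : ℝ) - 1 + (1 - (n : ℝ)) * p')) (Set.Ici 1) :=
        (integrableOn_Ici_iff_integrableOn_Ioi (by finiteness)).mpr this
      have h3 := (integrable_indicator_iff measurableSet_Ici).mpr h2
      refine (h3.integrableOn (s := Set.Ioi 0)).congr_fun ?_ measurableSet_Ioi
      intro y hy
      have hy : 0 < y := hy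
      simp only [Set.indicator, smul_eq_mul]
      split_ifs
      · rw [Real.rpow_add hy]
        congr 1
        rw [← Real.rpow_natCast, Nat.cast_sub (by omega)]
        simp
      · simp
    have := hi.2
    rw [hasFiniteIntegral_iff_ofReal] at this
    · convert this using 1
      rw [hc]
      congr 1
      funext z
      simp only [Set.indicator, Set.mem_compl_iff, mem_ball_zero_iff, not_lt, Set.mem_Ici]
      split_ifs
      · rw [ENNReal.ofReal_rpow_of_nonneg (by positivity) hp0.le, Real.rpow_mul (norm_nonneg _)]
      · simp
    · refine Eventually.of_forall fun x => ?_
      apply Set.indicator_nonneg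
      intro y hy
      have : (0:ℝ) ≤ y := le_trans zero_le_one hy
      positivity
  refine ⟨c.toReal + 1, by positivity, fun r hr => ?_⟩
  rw [lintegral_scale n ((ball (0 : En n) 1)ᶜ.indicator
      (fun z => ENNReal.ofReal (‖z‖ ^ (1 - (n : ℝ))) ^ p')) _ r ((1 - n) * p') hr ?_ 
      (hmeas.indicator measurableSet_ball.compl) (hmeas.indicator measurableSet_ball.compl)]
  · rw [← hc]
    rw [mul_comm (c.toReal + 1), ENNReal.ofReal_mul (by positivity)]
    gcongr
    rw [← ENNReal.ofReal_toReal hfin.ne]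
    apply ENNReal.ofReal_le_ofReal
    rw [ENNReal.toReal_ofReal ENNReal.toReal_nonneg]
    linarith
  · intro z
    by_cases hz : z ∈ (ball (0 : En n) 1)ᶜ
    · have hz' : r • z ∈ (ball (0 : En n) r)ᶜ := by
        simp only [Set.mem_compl_iff, mem_ball_zero_iff, not_lt] at hz ⊢
        rw [norm_smul, Real.norm_of_nonneg hr.le]
        nlinarith
      rw [Set.indicator_of_mem hz, Set.indicator_of_mem hz', norm_smul,
        Real.norm_of_nonneg hr.le, Real.mul_rpow hr.le (norm_nonneg _),
        ENNReal.ofReal_mul (by positivity), ENNReal.mul_rpow_of_nonneg _ _ hp0.le,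
        ENNReal.ofReal_rpow_of_nonneg (by positivity) hp0.le, ← Real.rpow_mul hr.le]
    · have hz' : r • z ∉ (ball (0 : En n) r)ᶜ := by
        simp only [Set.mem_compl_iff, mem_ball_zero_iff, not_lt, not_le] at hz ⊢
        rw [norm_smul, Real.norm_of_nonneg hr.le]
        nlinarith
      rw [Set.indicator_of_notMem hz, Set.indicator_of_notMem hz', mul_zero]


/-- The Riesz kernel `|z|^{1-n}`. -/
def rieszK (n : ℕ) (z : En n) : ℝ≥0∞ := ENNReal.ofReal (‖z‖ ^ (1 - (n : ℝ)))

lemma rieszK_meas (n : ℕ) : Measurable (rieszK n) := by unfold rieszK; fun_prop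

lemma riesz_large (n : ℕ) (hn : 2 ≤ n) (p : ℝ) (hp1 : 1 < p) (hpn : p < n) :
    ∃ c1 : ℝ, 0 < c1 ∧ ∀ r : ℝ, 0 < r → ∀ f : En n → ℝ≥0∞, Measurable f →
      ∫⁻ x, f x ^ p ≤ 1 → ∀ y,
      ∫⁻ x, f x * (ball (0 : En n) r)ᶜ.indicator (rieszK n) (x - y) ≤
        ENNReal.ofReal (c1 * r ^ (-(((n : ℝ) - p) / p))) := by
  set p' := p / (p - 1) with hp'
  have hp10 : 0 < p - 1 := by linarith
  have hpq : p.HolderConjugate p' := Real.HolderConjugate.conjExponent hp1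
  have hp'0 : 0 < p' := by positivity
  have hp0 : 0 < p := by linarith
  obtain ⟨c1, hc1, H⟩ := kernel_large n hn p' (by
    rw [hp', mul_div_assoc', lt_div_iff₀ hp10]; nlinarith)
  refine ⟨c1 ^ (1 / p'), by positivity, fun r hr f hf hf1 y => ?_⟩
  have hm : Measurable ((ball (0 : En n) r)ᶜ.indicator (rieszK n)) :=
    (rieszK_meas n).indicator measurableSet_ball.compl
  have h1 := ENNReal.lintegral_mul_le_Lp_mul_Lq volume hpq (f := f)
    (g := fun x => (ball (0 : En n) r)ᶜ.indicator (rieszK n) (x - y)) hf.aemeasurable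
    (hm.comp (by fun_prop)).aemeasurable
  refine h1.trans ?_
  have h2 : ∫⁻ a, (ball (0 : En n) r)ᶜ.indicator (rieszK n) (a - y) ^ p' ≤
      ENNReal.ofReal (c1 * r ^ ((1 - n) * p' + n)) := by
    rw [lintegral_sub_right_eq_self (fun a => (ball (0 : En n) r)ᶜ.indicator (rieszK n) a ^ p') y]
    refine le_trans (le_of_eq ?_) (H r hr)
    congr 1
    funext z
    simp only [Set.indicator, rieszK]
    split_ifs
    · rfl
    · simp [hp'0]
  calc (∫⁻ a, f a ^ p) ^ (1 / p) * (∫⁻ a, (ball (0 : En n) r)ᶜ.indicator (rieszK n) (a - y) ^ p') ^ (1 / p')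
      ≤ 1 ^ (1 / p) * (ENNReal.ofReal (c1 * r ^ ((1 - n) * p' + n))) ^ (1 / p') := by gcongr
    _ = _ := by
      rw [ENNReal.one_rpow, one_mul, ENNReal.ofReal_rpow_of_nonneg (by positivity) (by positivity),
        Real.mul_rpow hc1.le (by positivity), ← Real.rpow_mul hr.le]
      congr 3
      rw [hp']; field_simp; ring

lemma riesz_small (n : ℕ) (hn : 2 ≤ n) :
    ∃ c0 : ℝ, 0 < c0 ∧ ∀ r : ℝ, 0 < r →
      (∀ y, ∫⁻ x, (ball (0 : En n) r).indicator (rieszK n) (x - y) ≤ ENNReal.ofReal (c0 * r)) ∧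
      ∀ g : En n → ℝ≥0∞, Measurable g →
      ∫⁻ y, ∫⁻ x, g x * (ball (0 : En n) r).indicator (rieszK n) (x - y) ≤
        ENNReal.ofReal (c0 * r) * ∫⁻ x, g x := by
  obtain ⟨c0, hc0, H⟩ := kernel_small n hn
  refine ⟨c0, hc0, fun r hr => ⟨fun y => ?_, fun g hg => ?_⟩⟩
  · rw [lintegral_sub_right_eq_self ((ball (0 : En n) r).indicator (rieszK n)) y]
    exact H r hr
  · have hm : Measurable ((ball (0 : En n) r).indicator (rieszK n)) :=
      (rieszK_meas n).indicator measurableSet_ball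
    rw [lintegral_lintegral_swap]
    · calc ∫⁻ x, ∫⁻ y, g x * (ball (0 : En n) r).indicator (rieszK n) (x - y)
          = ∫⁻ x, g x * ∫⁻ z, (ball (0 : En n) r).indicator (rieszK n) z := by
            congr 1; funext x
            have hmx : Measurable fun y => (ball (0 : En n) r).indicator (rieszK n) (x - y) :=
              hm.comp (by fun_prop)
            rw [lintegral_const_mul _ hmx,
              lintegral_sub_left_eq_self ((ball (0 : En n) r).indicator (rieszK n)) x]
        _ = (∫⁻ x, g x) * ∫⁻ z, (ball (0 : En n) r).indicator (rieszK n) z := by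
            rw [lintegral_mul_const _ hg]
        _ ≤ _ := by
            rw [mul_comm]
            gcongr
            exact H r hr
    · exact ((hg.comp measurable_snd).mul (hm.comp (measurable_snd.sub measurable_fst))).aemeasurable

lemma riesz_distr (n : ℕ) (f : En n → ℝ) (hf : Measurable f) 
    (c0 r lam tau : ℝ) (hc0 : 0 < c0) (hr : 0 < r) (hlam : 0 < lam) (htau : 0 < tau)
    (hS : (∀ y, ∫⁻ x, (ball (0 : En n) r).indicator (rieszK n) (x - y) ≤ ENNReal.ofReal (c0 * r)) ∧
      ∀ g : En n → ℝ≥0∞, Measurable g →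
      ∫⁻ y, ∫⁻ x, g x * (ball (0 : En n) r).indicator (rieszK n) (x - y) ≤
        ENNReal.ofReal (c0 * r) * ∫⁻ x, g x)
    (hL : ∀ y, ∫⁻ x, ENNReal.ofReal (f x) * (ball (0 : En n) r)ᶜ.indicator (rieszK n) (x - y) ≤
        ENNReal.ofReal lam) 
    (ht : tau * (c0 * r) ≤ lam / 2) :
    volume {y | ENNReal.ofReal (2 * lam) < ∫⁻ x, ENNReal.ofReal (f x) * rieszK n (x - y)} ≤
      ENNReal.ofReal (2 * (c0 * r) / lam) * ∫⁻ x, {x | tau < f x}.indicator 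
        (fun x => ENNReal.ofReal (f x)) x := by
  have hm : Measurable ((ball (0 : En n) r).indicator (rieszK n)) :=
      (rieszK_meas n).indicator measurableSet_ball
  set g : En n → ℝ≥0∞ := {x | tau < f x}.indicator (fun x => ENNReal.ofReal (f x)) with hg
  have hgm : Measurable g := (by fun_prop : Measurable fun x => ENNReal.ofReal (f x)).indicator 
    (measurableSet_lt measurable_const hf)
  have hfg : ∀ x, ENNReal.ofReal (f x) ≤ g x + ENNReal.ofReal tau := by
    intro x
    by_cases hx : tau < f x
    · rw [hg, Set.indicator_of_mem (by exact hx)]; exact le_self_add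
    · rw [hg, Set.indicator_of_notMem (by exact hx), zero_add]
      exact ENNReal.ofReal_le_ofReal (not_lt.mp hx)
  have hsub : {y | ENNReal.ofReal (2 * lam) < ∫⁻ x, ENNReal.ofReal (f x) * rieszK n (x - y)} ⊆
      {y | ENNReal.ofReal (lam / 2) ≤ ∫⁻ x, g x * (ball (0 : En n) r).indicator (rieszK n) (x - y)} := by
    intro y hy
    simp only [Set.mem_ofPred_eq] at hy ⊢
    by_contra hcon
    push Not at hcon
    have e1 : ∫⁻ x, ENNReal.ofReal (f x) * rieszK n (x - y) ≤
        ∫⁻ x, ((g x * (ball (0 : En n) r).indicator (rieszK n) (x - y) + 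
          ENNReal.ofReal tau * (ball (0 : En n) r).indicator (rieszK n) (x - y)) +
          ENNReal.ofReal (f x) * (ball (0 : En n) r)ᶜ.indicator (rieszK n) (x - y)) := by
      apply lintegral_mono
      intro x
      dsimp only
      by_cases hx : x - y ∈ ball (0 : En n) r
      · rw [Set.indicator_of_mem hx, ← add_mul]
        refine le_trans ?_ le_self_add
        gcongr
        exact hfg x
      · rw [Set.indicator_of_mem (s := (ball (0 : En n) r)ᶜ) (by exact hx)]
        exact le_add_self
    have m1 : Measurable fun x => g x * (ball (0 : En n) r).indicator (rieszK n) (x - y) :=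
      hgm.mul (hm.comp (by fun_prop))
    have m2 : Measurable fun x => ENNReal.ofReal tau * (ball (0 : En n) r).indicator (rieszK n) (x - y) :=
      measurable_const.mul (hm.comp (by fun_prop))
    have m0 : Measurable fun x => (ball (0 : En n) r).indicator (rieszK n) (x - y) :=
      hm.comp (by fun_prop)
    have m12 : Measurable fun x => g x * (ball (0 : En n) r).indicator (rieszK n) (x - y) +
      ENNReal.ofReal tau * (ball (0 : En n) r).indicator (rieszK n) (x - y) := m1.add m2
    rw [lintegral_add_left m12, lintegral_add_left m1, lintegral_const_mul _ m0] at e1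
    have e2 : ENNReal.ofReal tau * ∫⁻ x, (ball (0 : En n) r).indicator (rieszK n) (x - y) ≤
        ENNReal.ofReal (lam / 2) := by
      calc _ ≤ ENNReal.ofReal tau * ENNReal.ofReal (c0 * r) := by gcongr; exact hS.1 y
        _ = ENNReal.ofReal (tau * (c0 * r)) := by rw [ENNReal.ofReal_mul htau.le]
        _ ≤ _ := ENNReal.ofReal_le_ofReal ht
    have e3 : ∫⁻ x, ENNReal.ofReal (f x) * rieszK n (x - y) ≤ 
        ENNReal.ofReal (lam/2) + ENNReal.ofReal (lam / 2) + ENNReal.ofReal lam := by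
      refine e1.trans ?_
      gcongr
      exact hL y
    rw [← ENNReal.ofReal_add (by positivity) (by positivity), 
      ← ENNReal.ofReal_add (by positivity) (by positivity)] at e3
    have : lam / 2 + lam / 2 + lam = 2 * lam := by ring
    rw [this] at e3
    exact absurd hy (not_lt.mpr e3)
  refine (measure_mono hsub).trans ?_
  have hl2 : 0 < lam / 2 := by positivity
  have hmeas : Measurable fun y => ∫⁻ x, g x * (ball (0 : En n) r).indicator (rieszK n) (x - y) := by
    apply Measurable.lintegral_prod_right'
      (f := fun z : En n × En n => g z.2 * (ball (0 : En n) r).indicator (rieszK n) (z.2 - z.1))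
    exact (hgm.comp measurable_snd).mul (hm.comp (measurable_snd.sub measurable_fst))
  have hcheb := mul_meas_ge_le_lintegral (μ := volume) hmeas (ENNReal.ofReal (lam / 2))
  have h5 := hcheb.trans (hS.2 g hgm)
  set V := volume {y | ENNReal.ofReal (lam / 2) ≤ ∫⁻ x, g x * (ball (0 : En n) r).indicator (rieszK n) (x - y)}
  have h6 : ENNReal.ofReal (2 / lam) * (ENNReal.ofReal (lam / 2) * V) = V := by
    rw [← mul_assoc, ← ENNReal.ofReal_mul (by positivity)]
    have : 2 / lam * (lam / 2) = 1 := by field_simp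
    rw [this]; simp
  rw [← h6]
  calc _ ≤ ENNReal.ofReal (2 / lam) * (ENNReal.ofReal (c0 * r) * ∫⁻ x, g x) := by gcongr
    _ = _ := by
      rw [← mul_assoc, ← ENNReal.ofReal_mul (by positivity)]
      congr 2
      ring


lemma lintegral_rpow_Ioc (e T : ℝ) (he : -1 < e) (hT : 0 ≤ T) :
    ∫⁻ t in Set.Ioc 0 T, ENNReal.ofReal (t ^ e) = ENNReal.ofReal (T ^ (e + 1) / (e + 1)) := by
  have hi : IntervalIntegrable (fun t : ℝ => t ^ e) volume 0 T :=
    intervalIntegral.intervalIntegrable_rpow' he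
  rw [intervalIntegrable_iff_integrableOn_Ioc_of_le hT] at hi
  rw [← ofReal_integral_eq_lintegral_ofReal hi]
  · rw [← intervalIntegral.integral_of_le hT, integral_rpow (Or.inl he)]
    rw [Real.zero_rpow (by linarith)]
    simp
  · refine (ae_restrict_iff' measurableSet_Ioc).mpr (Eventually.of_forall fun t ht => ?_)
    have : 0 < t := ht.1
    simp only [Pi.zero_apply]
    positivity

lemma marcin_aux (n : ℕ) (f : En n → ℝ) (hf : Measurable f) (hf0 : ∀ x, 0 ≤ f x)
    (I : En n → ℝ≥0∞) (hI : Measurable I) (p β κ q : ℝ) (hp : 1 < p) (hβ : 0 < β) (hκ : 0 < κ)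
    (hq : q = β * p)
    (hd : ∀ t : ℝ, 0 < t → volume {y | ENNReal.ofReal t < I y} ≤
      ENNReal.ofReal (κ⁻¹ * t ^ (-β)) * ∫⁻ x, {x | κ * t ^ β < f x}.indicator
        (fun x => ENNReal.ofReal (f x)) x) (M : ℕ) :
    ∫⁻ y, ENNReal.ofReal ((min (I y) M).toReal ^ q) ≤
      ENNReal.ofReal (q * κ⁻¹ / (q - β) * κ ^ (1 - p)) * ∫⁻ x, ENNReal.ofReal (f x ^ p) := by
  have hq0 : 0 < q := by rw [hq]; positivity
  have hqβ : 0 < q - β := by rw [hq]; nlinarith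
  have hJm : Measurable fun y => (min (I y) (M : ℝ≥0∞)).toReal := (hI.min measurable_const).ennreal_toReal
  rw [lintegral_rpow_eq_lintegral_meas_lt_mul volume (Eventually.of_forall fun y => ENNReal.toReal_nonneg)
    hJm.aemeasurable hq0]
  have hstep : ∫⁻ t in Set.Ioi (0:ℝ), volume {a | t < (min (I a) (M : ℝ≥0∞)).toReal} *
      ENNReal.ofReal (t ^ (q - 1)) ≤
      ∫⁻ t in Set.Ioi (0:ℝ), ∫⁻ x, ENNReal.ofReal (κ⁻¹ * t ^ (q - 1 - β)) *
        {x | κ * t ^ β < f x}.indicator (fun x => ENNReal.ofReal (f x)) x := by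
    apply setLIntegral_mono' measurableSet_Ioi
    intro t ht
    have ht : 0 < t := ht
    have h1 : volume {a | t < (min (I a) (M : ℝ≥0∞)).toReal} ≤ volume {y | ENNReal.ofReal t < I y} := by
      apply measure_mono
      intro a ha
      simp only [Set.mem_ofPred_eq] at ha ⊢
      exact lt_of_lt_of_le ((ENNReal.ofReal_lt_iff_lt_toReal ht.le
        (ne_top_of_le_ne_top (ENNReal.natCast_ne_top M) (min_le_right _ _))).mpr ha) (min_le_left _ _)
    rw [lintegral_const_mul _ ((by fun_prop : Measurable fun x => ENNReal.ofReal (f x)).indicator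
      (measurableSet_lt measurable_const hf))]
    calc _ ≤ ENNReal.ofReal (κ⁻¹ * t ^ (-β)) * (∫⁻ x, {x | κ * t ^ β < f x}.indicator
        (fun x => ENNReal.ofReal (f x)) x) * ENNReal.ofReal (t ^ (q - 1)) := by
          gcongr; exact h1.trans (hd t ht)
      _ = _ := by
        rw [mul_right_comm, ← ENNReal.ofReal_mul (by positivity), mul_assoc, ← Real.rpow_add ht]
        congr 4; ring
  have hswap : ∫⁻ t in Set.Ioi (0:ℝ), ∫⁻ x, ENNReal.ofReal (κ⁻¹ * t ^ (q - 1 - β)) *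
        {x | κ * t ^ β < f x}.indicator (fun x => ENNReal.ofReal (f x)) x =
      ∫⁻ x, ∫⁻ t in Set.Ioi (0:ℝ), ENNReal.ofReal (κ⁻¹ * t ^ (q - 1 - β)) *
        {x | κ * t ^ β < f x}.indicator (fun x => ENNReal.ofReal (f x)) x := by
    apply lintegral_lintegral_swap
    apply Measurable.aemeasurable
    have hE : Function.uncurry (fun (t : ℝ) (x : En n) => ENNReal.ofReal (κ⁻¹ * t ^ (q - 1 - β)) *
        {x | κ * t ^ β < f x}.indicator (fun x => ENNReal.ofReal (f x)) x) =
        fun z : ℝ × En n => ENNReal.ofReal (κ⁻¹ * z.1 ^ (q - 1 - β)) *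
        {z : ℝ × En n | κ * z.1 ^ β < f z.2}.indicator (fun z => ENNReal.ofReal (f z.2)) z := by
      funext z
      simp only [Function.uncurry, Set.indicator, Set.mem_ofPred_eq]
    rw [hE]
    have m1 : Measurable fun z : ℝ × En n => f z.2 := hf.comp measurable_snd
    have m2 : MeasurableSet {z : ℝ × En n | κ * z.1 ^ β < f z.2} :=
      measurableSet_lt (by fun_prop) m1
    exact Measurable.mul (by fun_prop) ((m1.ennreal_ofReal).indicator m2)
  have hin : ∀ x, ∫⁻ t in Set.Ioi (0:ℝ), ENNReal.ofReal (κ⁻¹ * t ^ (q - 1 - β)) *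
        {x | κ * t ^ β < f x}.indicator (fun x => ENNReal.ofReal (f x)) x ≤
      ENNReal.ofReal (κ⁻¹ / (q - β) * κ ^ (1 - p)) * ENNReal.ofReal (f x ^ p) := by
    intro x
    set T := (f x / κ) ^ (1 / β) with hT
    have hfκ : 0 ≤ f x / κ := div_nonneg (hf0 x) hκ.le
    have hT0 : 0 ≤ T := by positivity
    calc _ ≤ ∫⁻ t in Set.Ioi (0:ℝ), (Set.Ioc 0 T).indicator (fun t =>
          ENNReal.ofReal (κ⁻¹ * f x) * ENNReal.ofReal (t ^ (q - 1 - β))) t := by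
          apply setLIntegral_mono' measurableSet_Ioi
          intro t ht
          have ht : 0 < t := ht
          by_cases hx : κ * t ^ β < f x
          · have htT : t ≤ T := by
              have e0 : t ^ β ≤ f x / κ := by rw [le_div_iff₀ hκ]; linarith
              have e1 : t = (t ^ β) ^ (1 / β) := by
                rw [← Real.rpow_mul ht.le, mul_one_div_cancel hβ.ne', Real.rpow_one]
              rw [hT, e1]
              exact Real.rpow_le_rpow (by positivity) e0 (by positivity)
            rw [Set.indicator_of_mem (by exact hx), Set.indicator_of_mem (by exact ⟨ht, htT⟩),
              ← ENNReal.ofReal_mul (by positivity), ← ENNReal.ofReal_mul (by have := hf0 x; positivity)]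
            apply le_of_eq; congr 1; ring
          · rw [Set.indicator_of_notMem (by exact hx)]; simp
      _ ≤ ∫⁻ t, (Set.Ioc 0 T).indicator (fun t =>
          ENNReal.ofReal (κ⁻¹ * f x) * ENNReal.ofReal (t ^ (q - 1 - β))) t := setLIntegral_le_lintegral _ _
      _ = ENNReal.ofReal (κ⁻¹ * f x) * ENNReal.ofReal (T ^ (q - 1 - β + 1) / (q - 1 - β + 1)) := by
          rw [lintegral_indicator measurableSet_Ioc, lintegral_const_mul _ (by fun_prop),
            lintegral_rpow_Ioc _ _ (by linarith) hT0]
      _ = _ := by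
          rw [← ENNReal.ofReal_mul (by have := hf0 x; positivity), ← ENNReal.ofReal_mul (by positivity)]
          congr 1
          have e1 : q - 1 - β + 1 = q - β := by ring
          have e2 : T ^ (q - β) = f x ^ (p - 1) * κ ^ (1 - p) := by
            rw [hT, ← Real.rpow_mul hfκ]
            have : 1 / β * (q - β) = p - 1 := by rw [hq]; field_simp
            rw [this, Real.div_rpow (hf0 x) hκ.le]
            have : 1 - p = -(p - 1) := by ring
            rw [this, Real.rpow_neg hκ.le]; rfl
          rw [e1, e2]
          rcases (hf0 x).eq_or_lt with h0 | h0
          · simp [← h0, Real.zero_rpow (by linarith : p ≠ 0)]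
          · have e3 : f x ^ p = f x * f x ^ (p - 1) := by
              rw [← Real.rpow_one_add' h0.le (by linarith)]; congr 1; ring
            rw [e3]; ring
  have hfin := hstep.trans (hswap.le.trans (lintegral_mono hin))
  rw [lintegral_const_mul _ (by fun_prop)] at hfin
  calc _ ≤ ENNReal.ofReal q * (ENNReal.ofReal (κ⁻¹ / (q - β) * κ ^ (1 - p)) * ∫⁻ x, ENNReal.ofReal (f x ^ p)) := by
        gcongr
    _ = _ := by
        rw [← mul_assoc, ← ENNReal.ofReal_mul hq0.le]
        congr 2; ring

/-- The Riesz potential of order one. -/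
def rieszI (n : ℕ) (f : En n → ℝ) (y : En n) : ℝ≥0∞ :=
  ∫⁻ x, ENNReal.ofReal (f x) * rieszK n (x - y)

lemma rieszI_meas (n : ℕ) (f : En n → ℝ) (hf : Measurable f) : Measurable (rieszI n f) := by
  apply Measurable.lintegral_prod_right'
      (f := fun z : En n × En n => ENNReal.ofReal (f z.2) * rieszK n (z.2 - z.1))
  have := rieszK_meas n
  fun_prop

lemma hls_unit (n : ℕ) (hn : 2 ≤ n) (p : ℝ) (hp1 : 1 < p) (hpn : p < n) :
    ∃ C : ℝ, 0 < C ∧ ∀ f : En n → ℝ, Measurable f → (∀ x, 0 ≤ f x) →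
      ∫⁻ x, ENNReal.ofReal (f x ^ p) ≤ 1 →
      ∫⁻ y, rieszI n f y ^ ((n : ℝ) * p / (n - p)) ≤ ENNReal.ofReal C := by
  obtain ⟨c1, hc1, HL⟩ := riesz_large n hn p hp1 hpn
  obtain ⟨c0, hc0, HS⟩ := riesz_small n hn
  have hnp : 0 < (n : ℝ) - p := by linarith
  have hp0 : 0 < p := by linarith
  have hn0 : 0 < (n : ℝ) := by linarith
  set β := (n : ℝ) / (n - p) with hβd
  have hβ : 0 < β := by positivity
  set A := (2 * c1) ^ (p / (n - p)) with hA
  have hA0 : 0 < A := by positivity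
  set κ := (4 * c0 * A)⁻¹ with hκd
  have hκ : 0 < κ := by positivity
  set q := (n : ℝ) * p / (n - p) with hqd
  have hq : q = β * p := by rw [hqd, hβd]; ring
  have hq0 : 0 < q := by positivity
  have hqβ : 0 < q - β := by rw [hq]; nlinarith
  refine ⟨q * κ⁻¹ / (q - β) * κ ^ (1 - p), by positivity, fun f hf hf0 hf1 => ?_⟩
  have hI := rieszI_meas n f hf
  have hf1' : ∫⁻ x, ENNReal.ofReal (f x) ^ p ≤ 1 := by
    refine le_trans (le_of_eq ?_) hf1
    congr 1; funext x
    rw [ENNReal.ofReal_rpow_of_nonneg (hf0 x) hp0.le]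
  have key := marcin_aux n f hf hf0 (rieszI n f) hI p β κ q hp1 hβ hκ hq ?_
  · have hle : ∀ M : ℕ, ∫⁻ y, ENNReal.ofReal ((min (rieszI n f y) M).toReal ^ q) ≤
        ENNReal.ofReal (q * κ⁻¹ / (q - β) * κ ^ (1 - p)) := by
      intro M
      refine (key M).trans ?_
      calc _ ≤ ENNReal.ofReal (q * κ⁻¹ / (q - β) * κ ^ (1 - p)) * 1 := by gcongr
        _ = _ := mul_one _
    have hfe : ∀ (M : ℕ) y, ENNReal.ofReal ((min (rieszI n f y) M).toReal ^ q) =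
        (min (rieszI n f y) M) ^ q := by
      intro M y
      rw [← ENNReal.ofReal_rpow_of_nonneg ENNReal.toReal_nonneg hq0.le, ENNReal.ofReal_toReal
        (ne_top_of_le_ne_top (ENNReal.natCast_ne_top M) (min_le_right _ _))]
    simp_rw [hfe] at hle
    have hsup : ∀ y, rieszI n f y ^ q = ⨆ M : ℕ, (min (rieszI n f y) (M : ℝ≥0∞)) ^ q := by
      intro y
      have h1 : rieszI n f y = ⨆ M : ℕ, min (rieszI n f y) (M : ℝ≥0∞) := by
        rw [← inf_iSup_eq, ENNReal.iSup_natCast]; simp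
      conv_lhs => rw [h1]
      exact (ENNReal.orderIsoRpow q hq0).map_iSup _
    simp_rw [hsup]
    rw [lintegral_iSup]
    · exact iSup_le hle
    · intro M
      exact (hI.min measurable_const).pow_const _
    · intro M M' h y
      dsimp only
      gcongr
  · intro t ht
    set r := A * t ^ (-(p / (n - p))) with hr
    have hr0 : 0 < r := by positivity
    have hrr : c1 * r ^ (-(((n : ℝ) - p) / p)) = t / 2 := by
      rw [hr, Real.mul_rpow hA0.le (by positivity), ← Real.rpow_mul ht.le, hA,
        ← Real.rpow_mul (by positivity)]
      have e1 : p / (n - p) * -(((n : ℝ) - p) / p) = -1 := by field_simp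
      have e2 : -(p / (n - p)) * -(((n : ℝ) - p) / p) = 1 := by field_simp
      rw [e1, e2, Real.rpow_one, Real.rpow_neg_one]
      field_simp
    have hβ2 : t ^ (-β) = t ^ (-(p / (n - p))) / t := by
      rw [← Real.rpow_sub_one ht.ne']
      congr 1; rw [hβd]; field_simp; ring
    have hβ3 : t ^ β = (t ^ (-β))⁻¹ := by rw [Real.rpow_neg ht.le, inv_inv]
    set P := t ^ (-(p / (n - p))) with hP
    have hP0 : 0 < P := by positivity
    have hd := riesz_distr n f hf c0 r (t / 2) (κ * t ^ β) hc0 hr0 (by positivity) (by positivity)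
      (HS r hr0) (fun y => by
        rw [← hrr]
        exact HL r hr0 (fun x => ENNReal.ofReal (f x)) (by fun_prop) hf1' y) (by
        apply le_of_eq
        rw [hβ3, hβ2, hκd, hr]; field_simp; norm_num)
    have e1 : 2 * (t / 2) = t := by ring
    rw [e1] at hd
    refine hd.trans (le_of_eq ?_)
    congr 2
    rw [hβ2, hκd, hr]; field_simp; norm_num

lemma hls (n : ℕ) (hn : 2 ≤ n) (p : ℝ) (hp1 : 1 < p) (hpn : p < n) :
    ∃ C : ℝ, 0 < C ∧ ∀ f : En n → ℝ, Measurable f → (∀ x, 0 ≤ f x) →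
      (∫⁻ y, rieszI n f y ^ ((n : ℝ) * p / (n - p))) ^ (((n : ℝ) - p) / (n * p)) ≤
        ENNReal.ofReal C * (∫⁻ x, ENNReal.ofReal (f x ^ p)) ^ (1 / p) := by
  obtain ⟨C, hC, H⟩ := hls_unit n hn p hp1 hpn
  have hnp : 0 < (n : ℝ) - p := by linarith
  have hp0 : 0 < p := by linarith
  have hn0 : 0 < (n : ℝ) := by linarith
  set q := (n : ℝ) * p / (n - p) with hqd
  have hq0 : 0 < q := by positivity
  have hqi : ((n : ℝ) - p) / (n * p) = 1 / q := by rw [hqd]; field_simp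
  rw [hqi]
  refine ⟨C ^ (1 / q), by positivity, fun f hf hf0 => ?_⟩
  set S := ∫⁻ x, ENNReal.ofReal (f x ^ p) with hS
  rcases eq_or_ne S 0 with h0 | h0
  · have hz : ∀ᵐ x, f x = 0 := by
      rw [hS, lintegral_eq_zero_iff (by fun_prop)] at h0
      filter_upwards [h0] with x hx
      have : f x ^ p ≤ 0 := by simpa using hx
      have h2 : f x ^ p = 0 := le_antisymm this (by have := hf0 x; positivity)
      exact ((Real.rpow_eq_zero_iff_of_nonneg (hf0 x)).mp h2).1
    have hIz : ∀ y, rieszI n f y = 0 := by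
      intro y
      unfold rieszI
      rw [lintegral_eq_zero_iff (by have := rieszK_meas n; fun_prop)]
      filter_upwards [hz] with x hx
      simp [hx]
    simp [hIz, hq0]
  rcases eq_or_ne S ⊤ with h1 | h1
  · rw [h1, ENNReal.top_rpow_of_pos (by positivity), ENNReal.mul_top (by simp; positivity)]
    exact le_top
  set s := S.toReal with hs
  have hs0 : 0 < s := ENNReal.toReal_pos h0 h1
  have hSs : S = ENNReal.ofReal s := (ENNReal.ofReal_toReal h1).symm
  set m := s ^ (1 / p) with hm
  have hm0 : 0 < m := by positivity
  have hscale : ∀ y, rieszI n f y = ENNReal.ofReal m * rieszI n (fun x => m⁻¹ * f x) y := by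
    intro y
    unfold rieszI
    rw [← lintegral_const_mul _ (by have := rieszK_meas n; fun_prop)]
    congr 1; funext x
    rw [← mul_assoc, ← ENNReal.ofReal_mul hm0.le, mul_inv_cancel_left₀ hm0.ne']
  have h2 := H (fun x => m⁻¹ * f x) (by fun_prop) (fun x => by have := hf0 x; positivity) (by
    have : ∀ x, ENNReal.ofReal ((m⁻¹ * f x) ^ p) = ENNReal.ofReal (s⁻¹) * ENNReal.ofReal (f x ^ p) := by
      intro x
      rw [← ENNReal.ofReal_mul (by positivity), Real.mul_rpow (by positivity) (hf0 x),
        Real.inv_rpow hm0.le, hm, ← Real.rpow_mul hs0.le, one_div_mul_cancel hp0.ne', Real.rpow_one]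
    simp_rw [this]
    rw [lintegral_const_mul _ (by fun_prop), ← hS, hSs, ← ENNReal.ofReal_mul (by positivity),
      inv_mul_cancel₀ hs0.ne']
    simp)
  simp_rw [hscale, ENNReal.mul_rpow_of_nonneg _ _ hq0.le]
  rw [lintegral_const_mul _ ((rieszI_meas n _ (by fun_prop)).pow_const _)]
  rw [ENNReal.mul_rpow_of_nonneg _ _ (by positivity : 0 ≤ 1 / q), ← ENNReal.rpow_mul,
    mul_one_div_cancel hq0.ne', ENNReal.rpow_one, hSs,
    ENNReal.ofReal_rpow_of_nonneg hs0.le (by positivity), mul_comm]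
  gcongr
  rw [← ENNReal.ofReal_rpow_of_nonneg hC.le (by positivity)]
  gcongr


/-! ### Calculus of forms with constant basis forms -/

/-- Partial derivative of a scalar function. -/
def pd (i : Fin n) (g : En n → ℝ) (x : En n) : ℝ := fderiv ℝ g x (basisVec i)

lemma smoothGrad_sum {ι : Type*} [Fintype ι] (g : ι → En n → ℝ) (w : ι → Form n N k) (x : En n)
    (hg : ∀ a, DifferentiableAt ℝ (g a) x) (i : Fin n) :
    smoothGrad (fun x => ∑ a, g a x • w a) x i = ∑ a, pd i (g a) x • w a := by
  funext q
  simp only [smoothGrad, Finset.sum_apply, Pi.smul_apply, smul_eq_mul, pd]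
  rw [fderiv_fun_sum (fun a _ => (hg a).mul_const _)]
  simp only [_root_.sum_apply]
  refine Finset.sum_congr rfl fun a _ => ?_
  rw [fderiv_mul_const (hg a)]
  simp [mul_comm]

lemma extD_smoothGrad_sum {ι : Type*} [Fintype ι] (g : ι → En n → ℝ) (w : ι → Form n N k) (x : En n)
    (hg : ∀ a, DifferentiableAt ℝ (g a) x) :
    extD (smoothGrad (fun x => ∑ a, g a x • w a) x) = ∑ i, ∑ a, pd i (g a) x • Wl i (w a) := by
  rw [extD_eq']
  refine Finset.sum_congr rfl fun i _ => ?_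
  rw [smoothGrad_sum g w x hg, map_sum]
  simp

lemma codiff_smoothGrad_sum {ι : Type*} [Fintype ι] (g : ι → En n → ℝ) (w : ι → Form n N (k + 1))
    (x : En n) (hg : ∀ a, DifferentiableAt ℝ (g a) x) :
    codiff (smoothGrad (fun x => ∑ a, g a x • w a) x) = -∑ i, ∑ a, pd i (g a) x • Il i (w a) := by
  rw [codiff_eq']
  congr 1
  refine Finset.sum_congr rfl fun i _ => ?_
  rw [smoothGrad_sum g w x hg, map_sum]
  simp

lemma finner_add (v w₁ w₂ : Form n N k) : finner v (w₁ + w₂) = finner v w₁ + finner v w₂ := by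
  simp [finner, mul_add, Finset.sum_add_distrib]

lemma finner_sub (v w₁ w₂ : Form n N k) : finner v (w₁ - w₂) = finner v w₁ - finner v w₂ := by
  simp [finner, mul_sub, Finset.sum_sub_distrib]

lemma finner_neg (v w₁ : Form n N k) : finner v (-w₁) = -finner v w₁ := by
  simp [finner]

lemma finner_smul (v w₁ : Form n N k) (c : ℝ) : finner v (c • w₁) = c * finner v w₁ := by
  simp [finner, Finset.mul_sum, mul_left_comm]

lemma finner_sum {ι : Type*} (s : Finset ι) (v : Form n N k) (w : ι → Form n N k) :
    finner v (∑ a ∈ s, w a) = ∑ a ∈ s, finner v (w a) := by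
  simp only [finner, Finset.sum_apply, Finset.mul_sum]
  rw [Finset.sum_comm]

lemma abs_le_fnorm (v : Form n N k) (q) : |v q| ≤ fnorm v := by
  unfold fnorm
  rw [← Real.sqrt_sq_eq_abs]
  apply Real.sqrt_le_sqrt
  exact Finset.single_le_sum (f := fun q => v q ^ 2) (fun i _ => sq_nonneg _) (Finset.mem_univ q)

lemma fnorm_nonneg (v : Form n N k) : 0 ≤ fnorm v := Real.sqrt_nonneg _

lemma fnorm_le_sum (v : Form n N k) : fnorm v ≤ ∑ q, |v q| := by
  unfold fnorm
  rw [Real.sqrt_le_left (Finset.sum_nonneg fun _ _ => abs_nonneg _)]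
  calc ∑ q, v q ^ 2 = ∑ q, |v q| ^ 2 := by simp
    _ ≤ _ := Finset.sum_sq_le_sq_sum_of_nonneg fun _ _ => abs_nonneg _

/-- The number of components of a form. -/
def fcard (n N k : ℕ) : ℝ := Fintype.card (FormIdx n k × Fin N)

lemma abs_finner_le (v w : Form n N k) : |finner v w| ≤ fcard n N k * (fnorm v * ‖w‖) := by
  unfold finner fcard
  refine (Finset.abs_sum_le_sum_abs _ _).trans ?_
  calc _ ≤ ∑ q : FormIdx n k × Fin N, fnorm v * ‖w‖ := by
        refine Finset.sum_le_sum fun q _ => ?_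
        rw [abs_mul]
        exact mul_le_mul (abs_le_fnorm v q) (norm_le_pi_norm w q) (abs_nonneg _) (fnorm_nonneg v)
    _ = _ := by simp

lemma norm_Wl_le (i : Fin n) (v : Form n N k) : ‖Wl i v‖ ≤ ‖v‖ := by
  rw [pi_norm_le_iff_of_nonneg (norm_nonneg _)]
  intro q
  simp only [Wl, LinearMap.coe_mk, AddHom.coe_mk, Wop]
  split_ifs
  · rw [norm_mul, Real.norm_eq_abs, abs_fsgn, one_mul]
    exact norm_le_pi_norm v _
  · simp

lemma norm_Il_le (i : Fin n) (v : Form n N (k + 1)) : ‖Il i v‖ ≤ ‖v‖ := by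
  rw [pi_norm_le_iff_of_nonneg (norm_nonneg _)]
  intro q
  simp only [Il, LinearMap.coe_mk, AddHom.coe_mk, Iop]
  split_ifs
  · simp
  · rw [norm_mul, Real.norm_eq_abs, abs_fsgn, one_mul]
    exact norm_le_pi_norm v _

/-- The unit ball. -/
abbrev UB (n : ℕ) : Set (En n) := ball (0 : En n) 1

/-- Normalised data on the unit ball. -/
structure Core {n N j : ℕ} (u : En n → Form n N (j + 1)) (f : En n → Form n N (j + 1 + 1)) : Prop where
  hum : ∀ q, Measurable fun x => u x q
  hui : ∀ q, Integrable fun x => u x q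
  hfm : ∀ q, Measurable fun x => f x q
  hfi : ∀ q, Integrable fun x => f x q
  H1 : ∀ ψ : En n → Form n N (j + 1 + 1), (∀ q, ContDiff ℝ (⊤ : ℕ∞) fun x => ψ x q) →
    ∫ x in UB n, finner (f x) (ψ x) = ∫ x in UB n, finner (u x) (codiff (smoothGrad ψ x))
  H2 : ∀ α : En n → Form n N j, IsTestForm (UB n) α →
    ∫ x in UB n, finner (u x) (extD (smoothGrad α x)) = 0

lemma contDiff_pd (i : Fin n) (g : En n → ℝ) (hg : ContDiff ℝ (⊤ : ℕ∞) g) :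
    ContDiff ℝ (⊤ : ℕ∞) (pd i g) := by
  have := hg.fderiv_right (m := (⊤ : ℕ∞)) (by simp)
  exact this.clm_apply contDiff_const

lemma pd_comm (i l : Fin n) (g : En n → ℝ) (hg : ContDiff ℝ (⊤ : ℕ∞) g) (x : En n) :
    pd i (pd l g) x = pd l (pd i g) x := by
  have hs : IsSymmSndFDerivAt ℝ g x :=
    (hg.contDiffAt).isSymmSndFDerivAt (by
      rw [minSmoothness_of_isRCLikeNormedField]
      exact WithTop.coe_le_coe.mpr (le_top : (2 : ℕ∞) ≤ ⊤))
  have hd : DifferentiableAt ℝ (fderiv ℝ g) x :=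
    ((hg.fderiv_right (m := (⊤ : ℕ∞)) (by simp)).differentiable (by simp)) x
  have e : ∀ a b : Fin n, pd a (pd b g) x = fderiv ℝ (fderiv ℝ g) x (basisVec a) (basisVec b) := by
    intro a b
    unfold pd
    rw [fderiv_clm_apply hd (by fun_prop)]
    simp
  rw [e, e]
  exact hs.eq _ _

lemma integrable_finner {u : En n → Form n N k} (hui : ∀ q, Integrable fun x => u x q)
    {w : En n → Form n N k} (hw : ∀ q, Continuous fun x => w x q) :
    Integrable (fun x => finner (u x) (w x)) (volume.restrict (UB n)) := by
  unfold finner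
  refine integrable_finsetSum _ fun q _ => ?_
  obtain ⟨C, hC⟩ := (isCompact_closedBall (0 : En n) 1).exists_bound_of_continuousOn (hw q).continuousOn
  refine (hui q).integrableOn.integrable.mul_bdd (c := C) (hw q).aestronglyMeasurable ?_
  refine (ae_restrict_iff' measurableSet_ball).mpr (Eventually.of_forall fun x hx => ?_)
  exact hC x (ball_subset_closedBall hx)


/-! ### Boundary extension of the coclosedness -/

lemma sT_deriv_gt {t : ℝ} (ht : 1 < t) : deriv Real.smoothTransition t = 0 := by
  have : Real.smoothTransition =ᶠ[nhds t] fun _ => 1 := by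
    filter_upwards [lt_mem_nhds ht] with s hs
    exact Real.smoothTransition.one_of_one_le hs.le
  rw [this.deriv_eq]; simp

lemma sT_deriv_lt {t : ℝ} (ht : t < 0) : deriv Real.smoothTransition t = 0 := by
  have : Real.smoothTransition =ᶠ[nhds t] fun _ => 0 := by
    filter_upwards [gt_mem_nhds ht] with s hs
    exact Real.smoothTransition.zero_of_nonpos hs.le
  rw [this.deriv_eq]; simp

lemma sT_contDiff : ContDiff ℝ (⊤ : ℕ∞) Real.smoothTransition := Real.smoothTransition.contDiff

lemma sT_deriv_cont : Continuous (deriv Real.smoothTransition) :=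
  sT_contDiff.continuous_deriv (by simp)

lemma sT_deriv_bdd : ∃ M : ℝ, 0 ≤ M ∧ ∀ t, |deriv Real.smoothTransition t| ≤ M := by
  obtain ⟨C, hC⟩ := (isCompact_Icc (a := (0:ℝ)) (b := 1)).exists_bound_of_continuousOn
    sT_deriv_cont.continuousOn
  have hC0 : 0 ≤ C := (norm_nonneg _).trans (hC 0 (by simp))
  refine ⟨C, hC0, fun t => ?_⟩
  rcases lt_or_ge t 0 with h | h
  · rw [sT_deriv_lt h]; simpa
  rcases lt_or_ge 1 t with h' | h'
  · rw [sT_deriv_gt h']; simpa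
  · exact hC t ⟨h, h'⟩

/-- Radial cutoff. -/
def chi (n : ℕ) (K : ℝ) (x : En n) : ℝ := Real.smoothTransition (K * (1 - ‖x‖ ^ 2) - 1)

lemma chi_contDiff (K : ℝ) : ContDiff ℝ (⊤ : ℕ∞) (chi n K) := by
  unfold chi
  exact sT_contDiff.comp ((contDiff_const.mul (contDiff_const.sub (contDiff_norm_sq ℝ))).sub contDiff_const)

lemma hasFDerivAt_normsq (x : En n) :
    HasFDerivAt (fun x : En n => ‖x‖ ^ 2) (2 • innerSL ℝ x) x :=
  (hasStrictFDerivAt_norm_sq x).hasFDerivAt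

lemma inner_basisVec (x : En n) (i : Fin n) : inner ℝ x (basisVec i) = x i := by
  unfold basisVec
  rw [EuclideanSpace.inner_single_right]; simp

lemma pd_chi (K : ℝ) (x : En n) (i : Fin n) : pd i (chi n K) x =
    deriv Real.smoothTransition (K * (1 - ‖x‖ ^ 2) - 1) * (-2 * K * x i) := by
  have h1 : HasFDerivAt (fun x : En n => K * (1 - ‖x‖ ^ 2) - 1) (K • (-(2 • innerSL ℝ x) : En n →L[ℝ] ℝ)) x := by
    exact (((hasFDerivAt_normsq x).const_sub 1).const_mul K).sub_const 1
  have h2 : HasDerivAt Real.smoothTransition (deriv Real.smoothTransition (K * (1 - ‖x‖ ^ 2) - 1))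
      (K * (1 - ‖x‖ ^ 2) - 1) :=
    ((sT_contDiff.differentiable (by simp)) _).hasDerivAt
  have h3 := h2.comp_hasFDerivAt x h1
  unfold pd
  have : fderiv ℝ (chi n K) x = _ := h3.fderiv
  rw [this]
  simp [inner_basisVec]
  left
  ring

lemma extD_smul_cutoff (χ : En n → ℝ) (α : En n → Form n N k) (x : En n)
    (hχ : DifferentiableAt ℝ χ x) (hα : ∀ q, DifferentiableAt ℝ (fun x => α x q) x) :
    extD (smoothGrad (fun x => χ x • α x) x) =
      χ x • extD (smoothGrad α x) + ∑ i, pd i χ x • Wl i (α x) := by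
  rw [extD_eq', extD_eq', Finset.smul_sum, ← Finset.sum_add_distrib]
  refine Finset.sum_congr rfl fun i _ => ?_
  rw [← map_smul, ← map_smul, ← map_add]
  congr 1
  funext q
  simp only [smoothGrad, Pi.smul_apply, Pi.add_apply, smul_eq_mul, pd]
  rw [fderiv_fun_mul hχ (hα q)]
  simp
  ring

lemma continuous_extD_smoothGrad (α : En n → Form n N k)
    (hα : ∀ q, ContDiff ℝ (⊤ : ℕ∞) fun x => α x q) (q) :
    Continuous fun x => extD (smoothGrad α x) q := by
  unfold extD smoothGrad
  refine continuous_finsetSum _ fun i _ => ?_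
  split_ifs with h
  · exact continuous_const.mul (contDiff_pd i _ (hα _)).continuous
  · exact continuous_const

lemma continuous_codiff_smoothGrad (α : En n → Form n N (k + 1))
    (hα : ∀ q, ContDiff ℝ (⊤ : ℕ∞) fun x => α x q) (q) :
    Continuous fun x => codiff (smoothGrad α x) q := by
  unfold codiff smoothGrad
  refine (continuous_finsetSum _ fun i _ => ?_).neg
  split_ifs with h
  · exact continuous_const
  · exact continuous_const.mul (contDiff_pd i _ (hα _)).continuous

lemma H2ext {j : ℕ} {u : En n → Form n N (j + 1)} {f : En n → Form n N (j + 1 + 1)} (hc : Core u f)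
    (α : En n → Form n N j) (hα : ∀ q, ContDiff ℝ (⊤ : ℕ∞) fun x => α x q) (C : ℝ)
    (hw : ∀ x ∈ UB n, ∀ q, |(∑ m, x m • Wl m (α x)) q| ≤ C * (1 - ‖x‖ ^ 2)) :
    ∫ x in UB n, finner (u x) (extD (smoothGrad α x)) = 0 := by
  obtain ⟨M, hM0, hM⟩ := sT_deriv_bdd
  set w : En n → Form n N (j + 1) := fun x => ∑ m, x m • Wl m (α x) with hwdef
  -- the cutoff forms
  set F : ℕ → En n → Form n N (j + 1) := fun K x => extD (smoothGrad (fun x => chi n (K + 1) x • α x) x)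
    with hF
  have hFeq : ∀ K x, F K x = chi n (K + 1) x • extD (smoothGrad α x) +
      (deriv Real.smoothTransition (((K : ℝ) + 1) * (1 - ‖x‖ ^ 2) - 1) * (-2 * ((K : ℝ) + 1))) • w x := by
    intro K x
    simp only [hF]
    rw [extD_smul_cutoff _ _ _ ((chi_contDiff _).differentiable (by simp) x)
      (fun q => (hα q).differentiable (by simp) x)]
    congr 1
    rw [hwdef]
    simp only [Finset.smul_sum]
    refine Finset.sum_congr rfl fun i _ => ?_
    rw [pd_chi, smul_smul]
    congr 1; ring
  have hz : ∀ K, ∫ x in UB n, finner (u x) (F K x) = 0 := by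
    intro K
    apply hc.H2
    have hK : (0:ℝ) < K + 1 := by positivity
    have hsupp : tsupport (fun x => chi n (K + 1) x • α x) ⊆ {x | ‖x‖ ^ 2 ≤ 1 - 1 / ((K:ℝ) + 1)} := by
      apply closure_minimal _ (isClosed_le (by fun_prop) continuous_const)
      intro x hx
      by_contra hcon
      simp only [Set.mem_ofPred_eq, not_le] at hcon
      apply hx
      have : chi n (K + 1) x = 0 := by
        apply Real.smoothTransition.zero_of_nonpos
        have : ((K:ℝ) + 1) * (1 - ‖x‖ ^ 2) ≤ ((K:ℝ) + 1) * (1 / (K + 1)) := by gcongr; linarith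
        rw [mul_one_div_cancel hK.ne'] at this
        linarith
      simp [this]
    have hsub : {x : En n | ‖x‖ ^ 2 ≤ 1 - 1 / ((K:ℝ) + 1)} ⊆ UB n := by
      intro x hx
      simp only [Set.mem_ofPred_eq] at hx
      rw [mem_ball_zero_iff]
      have : 0 < 1 / ((K:ℝ) + 1) := by positivity
      nlinarith [norm_nonneg x]
    refine ⟨fun q => ?_, ?_, hsupp.trans hsub⟩
    · simp only [Pi.smul_apply, smul_eq_mul]
      exact (chi_contDiff _).mul (hα q)
    · exact (isCompact_closedBall (0 : En n) 1).of_isClosed_subset (isClosed_tsupport _)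
        ((hsupp.trans hsub).trans ball_subset_closedBall)
  have hwc : ∀ q, Continuous fun x => w x q := by
    intro q
    have : ∀ x, w x q = ∑ m : Fin n, x m * (Wl m (α x)) q := by intro x; simp [hwdef]
    simp_rw [this]
    refine continuous_finsetSum _ fun m _ => Continuous.mul (by fun_prop) ?_
    simp only [Wl, LinearMap.coe_mk, AddHom.coe_mk, Wop]
    split_ifs
    · exact continuous_const.mul (hα _).continuous
    · exact continuous_const
  have hEc := continuous_extD_smoothGrad α hα
  have hbd : ∀ q, ∃ D, ∀ x ∈ closedBall (0 : En n) 1, ‖extD (smoothGrad α x) q‖ ≤ D := fun q =>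
    (isCompact_closedBall (0 : En n) 1).exists_bound_of_continuousOn (hEc q).continuousOn
  choose D hD using hbd
  have hC : ∀ x ∈ UB n, ∀ q, |w x q| ≤ |C| * (1 - ‖x‖ ^ 2) := by
    intro x hx q
    refine (hw x hx q).trans ?_
    gcongr
    · rw [mem_ball_zero_iff] at hx; nlinarith [norm_nonneg x]
    · exact le_abs_self C
  have hT : Tendsto (fun K : ℕ => ∫ x in UB n, finner (u x) (F K x)) atTop
      (nhds (∫ x in UB n, finner (u x) (extD (smoothGrad α x)))) := by
    apply tendsto_integral_of_dominated_convergence (fun x => ∑ q, |u x q| * (D q + 4 * M * |C|))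
    · intro K
      refine (integrable_finner hc.hui fun q => ?_).aestronglyMeasurable
      simp_rw [hFeq]
      simp only [Pi.add_apply, Pi.smul_apply, smul_eq_mul]
      have h1 := (chi_contDiff (n := n) ((K:ℝ) + 1)).continuous
      have h2 := hwc q
      have h3 := hEc q
      have h4 := sT_deriv_cont
      fun_prop
    · refine integrable_finsetSum _ fun q _ => ?_
      exact ((hc.hui q).abs.mul_const _).integrableOn
    · intro K
      refine (ae_restrict_iff' measurableSet_ball).mpr (Eventually.of_forall fun x hx => ?_)
      unfold finner
      rw [Real.norm_eq_abs]
      refine (Finset.abs_sum_le_sum_abs _ _).trans (Finset.sum_le_sum fun q _ => ?_)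
      rw [abs_mul]
      gcongr
      rw [hFeq]
      simp only [Pi.add_apply, Pi.smul_apply, smul_eq_mul]
      refine (abs_add_le _ _).trans ?_
      have hK : (0:ℝ) < K + 1 := by positivity
      gcongr
      · rw [abs_mul]
        have h1 : |chi n (K + 1) x| ≤ 1 := by
          unfold chi
          rw [abs_of_nonneg (Real.smoothTransition.nonneg _)]
          exact Real.smoothTransition.le_one _
        calc _ ≤ 1 * |extD (smoothGrad α x) q| := by gcongr
          _ ≤ _ := by rw [one_mul]; exact hD q x (ball_subset_closedBall hx)
      · rcases lt_or_ge 1 (((K:ℝ) + 1) * (1 - ‖x‖ ^ 2) - 1) with h | h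
        · rw [sT_deriv_gt h]; simp; positivity
        · rw [abs_mul, abs_mul]
          have e1 : |(-2 * ((K:ℝ) + 1))| = 2 * (K + 1) := by
            rw [abs_mul, abs_of_pos hK]; norm_num
          rw [e1]
          calc _ ≤ M * (2 * ((K:ℝ) + 1)) * (|C| * (1 - ‖x‖ ^ 2)) := by
                have := hM (((K:ℝ) + 1) * (1 - ‖x‖ ^ 2) - 1)
                have := hC x hx q
                gcongr
            _ = 2 * M * |C| * (((K:ℝ) + 1) * (1 - ‖x‖ ^ 2)) := by ring
            _ ≤ 2 * M * |C| * 2 := by gcongr; linarith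
            _ = _ := by ring
    · refine (ae_restrict_iff' measurableSet_ball).mpr (Eventually.of_forall fun x hx => ?_)
      apply tendsto_const_nhds.congr'
      rw [mem_ball_zero_iff] at hx
      have hpos : 0 < 1 - ‖x‖ ^ 2 := by nlinarith [norm_nonneg x]
      obtain ⟨K0, hK0⟩ := exists_nat_gt (3 / (1 - ‖x‖ ^ 2))
      filter_upwards [eventually_ge_atTop K0] with K hK
      have h1 : 1 < ((K:ℝ) + 1) * (1 - ‖x‖ ^ 2) - 1 := by
        rw [div_lt_iff₀ hpos] at hK0
        have : (K0 : ℝ) ≤ K := by exact_mod_cast hK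
        nlinarith
      rw [hFeq, sT_deriv_gt h1]
      have : chi n (K + 1) x = 1 := Real.smoothTransition.one_of_one_le h1.le
      rw [this]; simp
  simp_rw [hz] at hT
  exact tendsto_nhds_unique hT tendsto_const_nhds |>.symm ▸ rfl


/-! ### The homotopy identity -/

lemma alg_id1 (j p0 : ℕ) (hp : n = j + 1 + p0 + 1) (c t : ℝ) (x : Fin n → ℝ) (β : Fin n → Fin n → ℝ)
    (γ : Fin n → Fin n → Fin n → ℝ) 
    (htr : ∀ i, ∑ r, γ r r i = 0) (v : Fin n → Form n N j) :
    ∑ r, ∑ m, ∑ l, ∑ i, (c * ((if r = m then 1 else 0) * β l i + x m * (t * γ r l i))) •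
        Il r (Wl m (Wl l (v i))) =
      (∑ l, ∑ i, (c * (p0 + 1) * β l i + c * t * ∑ r, x r * γ r l i) • Wl l (v i)) +
      ∑ m, ∑ r, ∑ l, ∑ i, (c * t * x m * γ r l i) • Wl m (Ml l r (v i)) := by
  have hsplit : ∀ r m l i, (c * ((if r = m then 1 else 0) * β l i + x m * (t * γ r l i))) •
        Il r (Wl m (Wl l (v i))) =
      ((if r = m then (c * β l i) • Il r (Wl r (Wl l (v i))) else 0) +
      (if r = m then (c * t * x r * γ r l i) • Wl l (v i) else 0)) +
      (c * t * x m * γ r l i) • (-(Wl m (if r = l then v i else 0)) + Wl m (Ml l r (v i))) := by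
    intro r m l i
    have e1 : -(Wl m (if r = l then v i else 0)) + Wl m (Ml l r (v i)) = - Wl m (Il r (Wl l (v i))) := by
      rw [Il_Wl' r l, map_sub]; abel
    rw [e1]
    by_cases h : r = m
    · subst h
      simp only [if_true, one_mul]
      have e2 : Il r (Wl r (Wl l (v i))) = Wl l (v i) - Wl r (Il r (Wl l (v i))) := by
        rw [Il_Wl]; simp
      have e3 : Wl r (Il r (Wl l (v i))) = Wl l (v i) - Il r (Wl r (Wl l (v i))) := by rw [e2]; abel
      rw [e3]
      module
    · simp only [h, if_false, zero_mul, zero_add]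
      rw [Il_Wl r m]
      simp only [h, if_false, zero_sub]
      congr 1; ring
  simp_rw [hsplit, Finset.sum_add_distrib]
  have hA : ∑ r, ∑ m, ∑ l, ∑ i, (if r = m then (c * β l i) • Il r (Wl r (Wl l (v i))) else 0) =
      ∑ l, ∑ i, (c * (p0 + 1) * β l i) • Wl l (v i) := by
    have : ∀ r : Fin n, ∑ m, ∑ l, ∑ i, (if r = m then (c * β l i) • Il r (Wl r (Wl l (v i))) else 0) =
        ∑ l, ∑ i, (c * β l i) • Il r (Wl r (Wl l (v i))) := by
      intro r
      rw [Finset.sum_eq_single r]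
      · simp
      · intro m _ hm
        simp [hm.symm]
      · simp
    simp_rw [this]
    rw [Finset.sum_comm]
    refine Finset.sum_congr rfl fun l _ => ?_
    rw [Finset.sum_comm]
    refine Finset.sum_congr rfl fun i _ => ?_
    rw [← Finset.smul_sum, sum_Il_Wl, smul_smul]
    congr 1
    have : (n : ℝ) = j + 1 + p0 + 1 := by rw [hp]; push_cast; ring
    rw [this]; push_cast; ring
  have hB : ∑ r, ∑ m, ∑ l, ∑ i, (if r = m then (c * t * x r * γ r l i) • Wl l (v i) else 0) =
      ∑ l, ∑ i, (c * t * ∑ r, x r * γ r l i) • Wl l (v i) := by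
    have : ∀ r : Fin n, ∑ m, ∑ l, ∑ i, (if r = m then (c * t * x r * γ r l i) • Wl l (v i) else 0) =
        ∑ l, ∑ i, (c * t * x r * γ r l i) • Wl l (v i) := by
      intro r
      rw [Finset.sum_eq_single r]
      · simp
      · intro m _ hm
        simp [hm.symm]
      · simp
    simp_rw [this]
    rw [Finset.sum_comm]
    refine Finset.sum_congr rfl fun l _ => ?_
    rw [Finset.sum_comm]
    refine Finset.sum_congr rfl fun i _ => ?_
    rw [← Finset.sum_smul, Finset.mul_sum]
    congr 1
    refine Finset.sum_congr rfl fun r _ => by ring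
  have hC : ∑ r, ∑ m, ∑ l, ∑ i, (c * t * x m * γ r l i) •
      (-(Wl m (if r = l then v i else 0)) + Wl m (Ml l r (v i))) =
      ∑ m, ∑ r, ∑ l, ∑ i, (c * t * x m * γ r l i) • Wl m (Ml l r (v i)) := by
    rw [Finset.sum_comm]
    refine Finset.sum_congr rfl fun m _ => ?_
    simp_rw [smul_add, Finset.sum_add_distrib]
    rw [add_eq_right]
    have : ∀ r : Fin n, ∑ l, ∑ i, (c * t * x m * γ r l i) • -(Wl m (if r = l then v i else 0)) =
        ∑ i, (γ r r i * -(c * t * x m)) • Wl m (v i) := by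
      intro r
      rw [Finset.sum_eq_single r]
      · refine Finset.sum_congr rfl fun i _ => ?_
        simp only [if_true]
        module
      · intro l _ hl
        simp [hl.symm]
      · simp
    simp_rw [this]
    rw [Finset.sum_comm]
    refine Finset.sum_eq_zero fun i _ => ?_
    rw [← Finset.sum_smul, ← Finset.sum_mul, htr]
    simp
  rw [hA, hB, hC]
  congr 1
  rw [← Finset.sum_add_distrib]
  refine Finset.sum_congr rfl fun l _ => ?_
  rw [← Finset.sum_add_distrib]
  refine Finset.sum_congr rfl fun i _ => ?_
  rw [← add_smul]

lemma Wl_Ml_self (m l : Fin n) (v : Form n N k) : Wl m (Ml m l v) = 0 := by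
  have := Wl_Ml_anti m m l v
  rwa [eq_neg_iff_add_eq_zero, ← two_smul ℝ, smul_eq_zero_iff_right two_ne_zero] at this

lemma alg_id2 (j : ℕ) (c t : ℝ) (x : Fin n → ℝ) (β : Fin n → Fin n → ℝ)
    (γ : Fin n → Fin n → Fin n → ℝ) (hsym : ∀ r l i, γ r l i = γ l r i)
    (v : Fin n → Form n N j) :
    ∑ r, ∑ m, ∑ l, ∑ i, (c * ((if r = m then 1 else 0) * β l i + x m * (t * γ r l i))) •
        Wl r (Ml m l (v i)) =
      -∑ m, ∑ r, ∑ l, ∑ i, (c * t * x m * γ r l i) • Wl m (Ml l r (v i)) := by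
  have h1 : ∀ r m l i, (c * ((if r = m then 1 else 0) * β l i + x m * (t * γ r l i))) •
        Wl r (Ml m l (v i)) = -((c * t * x m * γ l r i) • Wl m (Ml r l (v i))) := by
    intro r m l i
    by_cases h : r = m
    · subst h; simp [Wl_Ml_self]
    · rw [Wl_Ml_anti r m, hsym l r i]
      simp only [h, if_false]
      module
  simp_rw [h1, Finset.sum_neg_distrib]
  congr 1
  rw [Finset.sum_comm]
  refine Finset.sum_congr rfl fun m _ => ?_
  rw [Finset.sum_comm]

lemma wedge_T_zero (j : ℕ) (c : ℝ) (x : Fin n → ℝ) (β : Fin n → Fin n → ℝ)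
    (v : Fin n → Form n N j) :
    ∑ r, x r • Wl r (∑ m, ∑ l, ∑ i, (c * x m * β l i) • Ml m l (v i)) = 0 := by
  simp_rw [map_sum, map_smul, Finset.smul_sum, smul_smul]
  have h : ∑ r, ∑ m, ∑ l, ∑ i, (x r * (c * x m * β l i)) • Wl r (Ml m l (v i)) =
      -∑ r, ∑ m, ∑ l, ∑ i, (x r * (c * x m * β l i)) • Wl r (Ml m l (v i)) := by
    conv_lhs => rw [Finset.sum_comm]
    rw [← Finset.sum_neg_distrib]
    refine Finset.sum_congr rfl fun r _ => ?_
    rw [← Finset.sum_neg_distrib]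
    refine Finset.sum_congr rfl fun m _ => ?_
    rw [← Finset.sum_neg_distrib]
    refine Finset.sum_congr rfl fun l _ => ?_
    rw [← Finset.sum_neg_distrib]
    refine Finset.sum_congr rfl fun i _ => ?_
    rw [Wl_Ml_anti m r]
    module
  rwa [eq_neg_iff_add_eq_zero, ← two_smul ℝ, smul_eq_zero_iff_right two_ne_zero] at h

lemma pd_coord (r m : Fin n) (x : En n) : fderiv ℝ (fun x : En n => x m) x (basisVec r) =
    if r = m then 1 else 0 := by
  have : (fun x : En n => x m) = (EuclideanSpace.proj m : En n →L[ℝ] ℝ) := by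
    funext x; simp
  rw [this, ContinuousLinearMap.fderiv]
  show (EuclideanSpace.single r (1:ℝ) : En n) m = _
  simp [Pi.single_apply, eq_comm]

lemma pd_rad (r m : Fin n) (c t : ℝ) (b : En n → ℝ) (hb : ContDiff ℝ (⊤ : ℕ∞) b) (x : En n) :
    pd r (fun x => c * x m * b (t • x)) x =
      c * ((if r = m then 1 else 0) * b (t • x) + x m * (t * pd r b (t • x))) := by
  unfold pd
  have hd : DifferentiableAt ℝ b (t • x) := hb.differentiable (by simp) _
  have h1 : HasFDerivAt (fun x => b (t • x)) (t • fderiv ℝ b (t • x)) x := by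
    have h0 : HasFDerivAt (fun x : En n => t • x) (t • ContinuousLinearMap.id ℝ (En n)) x :=
      (hasFDerivAt_id x).const_smul t
    have := hd.hasFDerivAt.comp x h0
    exact this.congr_fderiv (by ext h; simp)
  have h2 : DifferentiableAt ℝ (fun x : En n => c * x m) x := by fun_prop
  rw [fderiv_fun_mul h2 h1.differentiableAt, h1.fderiv]
  have h3 : fderiv ℝ (fun x : En n => c * x m) x (basisVec r) = c * (if r = m then 1 else 0) := by
    rw [fderiv_const_mul (by fun_prop)]
    simp only [_root_.smul_apply, pd_coord, smul_eq_mul]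
  simp only [_root_.add_apply, _root_.smul_apply, h3, smul_eq_mul]
  ring

/-- The `t`-derivative of `t^{p0+1} b(t x)`. -/
def Dsc (p0 : ℕ) (b : En n → ℝ) (t : ℝ) (x : En n) : ℝ :=
  t ^ p0 * (p0 + 1) * b (t • x) + t ^ p0 * t * ∑ r, x r * pd r b (t • x)

/-- The homotopy form. -/
def Psi {j : ℕ} (p0 : ℕ) (a : Fin n → En n → ℝ) (v : Fin n → Form n N j) (t : ℝ) (x : En n) :
    Form n N (j + 1 + 1) :=
  ∑ z : Fin n × Fin n × Fin n, (t ^ p0 * x z.1 * pd z.2.1 (a z.2.2) (t • x)) • Wl z.1 (Wl z.2.1 (v z.2.2))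

lemma smooth_rad (c t : ℝ) (m : Fin n) (b : En n → ℝ) (hb : ContDiff ℝ (⊤ : ℕ∞) b) :
    ContDiff ℝ (⊤ : ℕ∞) (fun x : En n => c * x m * b (t • x)) := by
  have : ContDiff ℝ (⊤ : ℕ∞) (fun x : En n => b (t • x)) := hb.comp (by fun_prop)
  fun_prop

lemma smooth_sum {ι : Type*} [Fintype ι] (g : ι → En n → ℝ) (w : ι → Form n N k)
    (hg : ∀ a, ContDiff ℝ (⊤ : ℕ∞) (g a)) (q) :
    ContDiff ℝ (⊤ : ℕ∞) (fun x => (∑ a, g a x • w a) q) := by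
  simp only [Finset.sum_apply, Pi.smul_apply, smul_eq_mul]
  exact ContDiff.sum fun a _ => (hg a).mul contDiff_const

lemma homotopy_step {j p0 : ℕ} (hp : n = j + 1 + p0 + 1)
    {u : En n → Form n N (j + 1)} {f : En n → Form n N (j + 1 + 1)} (hc : Core u f)
    (a : Fin n → En n → ℝ) (ha : ∀ i, ContDiff ℝ (⊤ : ℕ∞) (a i))
    (htr : ∀ i, ∀ x ∈ UB n, ∑ r, pd r (pd r (a i)) x = 0) (v : Fin n → Form n N j)
    (t : ℝ) (ht0 : 0 ≤ t) (ht1 : t ≤ 1) :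
    ∫ x in UB n, finner (u x) (∑ l, ∑ i, Dsc p0 (pd l (a i)) t x • Wl l (v i)) =
      -∫ x in UB n, finner (f x) (Psi p0 a v t x) := by
  have hb : ∀ l i, ContDiff ℝ (⊤ : ℕ∞) (pd l (a i)) := fun l i => contDiff_pd l _ (ha i)
  set T : En n → Form n N j := fun x => ∑ z : Fin n × Fin n × Fin n,
    (t ^ p0 * x z.1 * pd z.2.1 (a z.2.2) (t • x)) • Ml z.1 z.2.1 (v z.2.2) with hT
  have hTs : ∀ q, ContDiff ℝ (⊤ : ℕ∞) fun x => T x q := 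
    smooth_sum (fun (z : Fin n × Fin n × Fin n) x => t ^ p0 * x z.1 * pd z.2.1 (a z.2.2) (t • x)) _ 
      fun z => smooth_rad _ _ _ _ (hb _ _)
  have hPs : ∀ q, ContDiff ℝ (⊤ : ℕ∞) fun x => Psi p0 a v t x q := 
    smooth_sum (fun (z : Fin n × Fin n × Fin n) x => t ^ p0 * x z.1 * pd z.2.1 (a z.2.2) (t • x)) _ 
      fun z => smooth_rad _ _ _ _ (hb _ _)
  have hT0 : ∫ x in UB n, finner (u x) (extD (smoothGrad T x)) = 0 := by
    apply H2ext hc T hTs 0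
    intro x _ q
    have : ∑ m, x m • Wl m (T x) = 0 := by
      rw [hT]
      simp only [Fintype.sum_prod_type]
      exact wedge_T_zero j (t ^ p0) x.ofLp (fun l i => pd l (a i) (t • x)) v
    rw [this]; simp
  have hid : ∀ x ∈ UB n, codiff (smoothGrad (Psi p0 a v t) x) = 
      -(∑ l, ∑ i, Dsc p0 (pd l (a i)) t x • Wl l (v i)) + extD (smoothGrad T x) := by
    intro x hx
    have htx : t • x ∈ UB n := by
      rw [mem_ball_zero_iff] at hx ⊢
      rw [norm_smul, Real.norm_of_nonneg ht0]
      nlinarith [norm_nonneg x]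
    have e1 := codiff_smoothGrad_sum (fun (z : Fin n × Fin n × Fin n) x => 
      t ^ p0 * x z.1 * pd z.2.1 (a z.2.2) (t • x)) (fun z => Wl z.1 (Wl z.2.1 (v z.2.2))) x
      (fun z => (smooth_rad _ _ _ _ (hb _ _)).differentiable (by simp) x)
    have e2 := extD_smoothGrad_sum (fun (z : Fin n × Fin n × Fin n) x => 
      t ^ p0 * x z.1 * pd z.2.1 (a z.2.2) (t • x)) (fun z => Ml z.1 z.2.1 (v z.2.2)) x
      (fun z => (smooth_rad _ _ _ _ (hb _ _)).differentiable (by simp) x)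
    unfold Psi
    rw [hT, e1, e2]
    simp only [Fintype.sum_prod_type, pd_rad _ _ _ _ _ (hb _ _)]
    rw [alg_id1 j p0 hp (t ^ p0) t x.ofLp (fun l i => pd l (a i) (t • x)) 
      (fun r l i => pd r (pd l (a i)) (t • x)) (fun i => htr i _ htx) v,
      alg_id2 j (t ^ p0) t x.ofLp (fun l i => pd l (a i) (t • x)) 
      (fun r l i => pd r (pd l (a i)) (t • x)) (fun r l i => pd_comm r l _ (ha i) _) v]
    unfold Dsc
    abel
  rw [hc.H1 _ hPs, ← integral_neg]
  have hcont : ∀ q, Continuous fun x => codiff (smoothGrad (Psi p0 a v t) x) q := 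
    continuous_codiff_smoothGrad _ hPs
  have hcont2 : ∀ q, Continuous fun x => extD (smoothGrad T x) q := 
    continuous_extD_smoothGrad _ hTs
  have hfin : ∫ x in UB n, finner (u x) (∑ l, ∑ i, Dsc p0 (pd l (a i)) t x • Wl l (v i)) = 
      ∫ x in UB n, (finner (u x) (extD (smoothGrad T x)) + 
        -finner (u x) (codiff (smoothGrad (Psi p0 a v t) x))) := by
    apply setIntegral_congr_fun measurableSet_ball
    intro x hx
    dsimp only
    rw [hid x hx, finner_add, finner_neg]; ring
  have hi2 : Integrable (fun x => -finner (u x) (codiff (smoothGrad (Psi p0 a v t) x)))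
    (volume.restrict (UB n)) := (integrable_finner hc.hui hcont).neg
  rw [hfin, integral_add (integrable_finner hc.hui hcont2) hi2, hT0, zero_add]


lemma sum_coord_pd (b : En n → ℝ) (y x : En n) : ∑ r, x r * pd r b y = fderiv ℝ b y x := by
  have hx : x = ∑ r, x r • basisVec r := by
    have := (EuclideanSpace.basisFun (Fin n) ℝ).sum_repr x
    simpa [basisVec] using this.symm
  conv_rhs => rw [hx, map_sum]
  simp [pd]

lemma hasDerivAt_rad (p0 : ℕ) (b : En n → ℝ) (hb : ContDiff ℝ (⊤ : ℕ∞) b) (x : En n) (t : ℝ) :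
    HasDerivAt (fun t : ℝ => t ^ (p0 + 1) * b (t • x)) (Dsc p0 b t x) t := by
  have h1 : HasDerivAt (fun t : ℝ => t • x) ((1:ℝ) • x) t := (hasDerivAt_id t).smul_const x
  have h2 : HasDerivAt (fun t : ℝ => b (t • x)) (fderiv ℝ b (t • x) x) t := by
    have := ((hb.differentiable (by simp)) (t • x)).hasFDerivAt.comp_hasDerivAt t h1
    rw [one_smul] at this
    exact this
  have h3 := (hasDerivAt_pow (p0 + 1) t).mul h2
  refine h3.congr_deriv ?_
  unfold Dsc
  rw [sum_coord_pd]
  push_cast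
  ring

lemma continuous_Dsc (p0 : ℕ) (b : En n → ℝ) (hb : ContDiff ℝ (⊤ : ℕ∞) b) :
    Continuous fun z : ℝ × En n => Dsc p0 b z.1 z.2 := by
  unfold Dsc
  have h1 : Continuous fun z : ℝ × En n => b (z.1 • z.2) := hb.continuous.comp (by fun_prop)
  have h2 : ∀ r, Continuous fun z : ℝ × En n => pd r b (z.1 • z.2) := 
    fun r => (contDiff_pd r b hb).continuous.comp (by fun_prop)
  refine Continuous.add (by fun_prop) (Continuous.mul (by fun_prop) ?_)
  exact continuous_finsetSum _ fun r _ => Continuous.mul (by fun_prop) (h2 r)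

lemma integral_Dsc (p0 : ℕ) (b : En n → ℝ) (hb : ContDiff ℝ (⊤ : ℕ∞) b) (x : En n) :
    ∫ t in Set.Ioo (0:ℝ) 1, Dsc p0 b t x = b x := by
  have hcont : Continuous fun t => Dsc p0 b t x := 
    (continuous_Dsc p0 b hb).comp (by fun_prop : Continuous fun t : ℝ => (t, x))
  rw [← integral_Ioc_eq_integral_Ioo, ← intervalIntegral.integral_of_le zero_le_one,
    intervalIntegral.integral_eq_sub_of_hasDerivAt (fun t _ => hasDerivAt_rad p0 b hb x t)
      (hcont.intervalIntegrable _ _)]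
  simp

lemma integrable_prod_finner {u : En n → Form n N k} (hui : ∀ q, Integrable fun x => u x q)
    (w : ℝ → En n → Form n N k) (hw : ∀ q, Continuous fun z : ℝ × En n => w z.1 z.2 q) :
    Integrable (fun z : En n × ℝ => finner (u z.1) (w z.2 z.1)) 
      ((volume.restrict (UB n)).prod (volume.restrict (Set.Ioo (0:ℝ) 1))) := by
  unfold finner
  refine integrable_finsetSum _ fun q _ => ?_
  have hc : Continuous fun z : En n × ℝ => w z.2 z.1 q := 
    (hw q).comp (by fun_prop : Continuous fun z : En n × ℝ => (z.2, z.1))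
  obtain ⟨C, hC⟩ := ((isCompact_closedBall (0 : En n) 1).prod 
    (isCompact_Icc (a := (0:ℝ)) (b := 1))).exists_bound_of_continuousOn hc.continuousOn
  have h1 : Integrable (fun x => u x q) (volume.restrict (UB n)) := (hui q).integrableOn
  have h2 : Integrable (fun z : En n × ℝ => u z.1 q) 
    ((volume.restrict (UB n)).prod (volume.restrict (Set.Ioo (0:ℝ) 1))) := h1.comp_fst _
  refine h2.mul_bdd (c := C) hc.aestronglyMeasurable ?_
  rw [Measure.prod_restrict]
  refine (ae_restrict_iff' (measurableSet_ball.prod measurableSet_Ioo)).mpr 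
    (Eventually.of_forall fun z hz => ?_)
  exact hC z ⟨ball_subset_closedBall hz.1, Set.Ioo_subset_Icc_self hz.2⟩

lemma homotopy_total {j p0 : ℕ} (hp : n = j + 1 + p0 + 1)
    {u : En n → Form n N (j + 1)} {f : En n → Form n N (j + 1 + 1)} (hc : Core u f)
    (a : Fin n → En n → ℝ) (ha : ∀ i, ContDiff ℝ (⊤ : ℕ∞) (a i))
    (htr : ∀ i, ∀ x ∈ UB n, ∑ r, pd r (pd r (a i)) x = 0) (v : Fin n → Form n N j) :
    ∫ x in UB n, finner (u x) (∑ l, ∑ i, pd l (a i) x • Wl l (v i)) =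
      -∫ t in Set.Ioo (0:ℝ) 1, ∫ x in UB n, finner (f x) (Psi p0 a v t x) := by
  have hb : ∀ l i, ContDiff ℝ (⊤ : ℕ∞) (pd l (a i)) := fun l i => contDiff_pd l _ (ha i)
  have h1 : ∀ x, finner (u x) (∑ l, ∑ i, pd l (a i) x • Wl l (v i)) =
      ∫ t in Set.Ioo (0:ℝ) 1, finner (u x) (∑ l, ∑ i, Dsc p0 (pd l (a i)) t x • Wl l (v i)) := by
    intro x
    simp only [finner_sum, finner_smul]
    have hi : ∀ l i, Integrable (fun t => Dsc p0 (pd l (a i)) t x * finner (u x) (Wl l (v i)))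
        (volume.restrict (Set.Ioo (0:ℝ) 1)) := by
      intro l i
      have hcont : Continuous fun t => Dsc p0 (pd l (a i)) t x := 
        (continuous_Dsc p0 _ (hb l i)).comp (by fun_prop : Continuous fun t : ℝ => (t, x))
      exact ((hcont.integrableOn_Icc (a := 0) (b := 1)).mono_set Set.Ioo_subset_Icc_self).mul_const _
    rw [integral_finsetSum _ fun l _ => integrable_finsetSum _ fun i _ => hi l i]
    refine Finset.sum_congr rfl fun l _ => ?_
    rw [integral_finsetSum _ fun i _ => hi l i]
    refine Finset.sum_congr rfl fun i _ => ?_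
    rw [integral_mul_const, integral_Dsc p0 _ (hb l i)]
  simp_rw [h1]
  rw [integral_integral_swap]
  · rw [← integral_neg]
    apply setIntegral_congr_fun measurableSet_Ioo
    intro t ht
    exact homotopy_step hp hc a ha htr v t ht.1.le ht.2.le
  · apply integrable_prod_finner hc.hui (fun t x => ∑ l, ∑ i, Dsc p0 (pd l (a i)) t x • Wl l (v i))
    intro q
    simp only [Finset.sum_apply, Pi.smul_apply, smul_eq_mul]
    exact continuous_finsetSum _ fun l _ => continuous_finsetSum _ fun i _ => 
      (continuous_Dsc p0 _ (hb l i)).mul continuous_const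

lemma lintegral_kernel (hn : 2 ≤ n) (d : ℝ) (hd : 0 < d) :
    ∫⁻ t in Set.Ioo (0:ℝ) 1, ENNReal.ofReal (((1 - t) + d) ^ (-(n : ℝ))) ≤
      ENNReal.ofReal (d ^ (1 - (n : ℝ))) := by
  have hn2 : (2:ℝ) ≤ n := by exact_mod_cast hn
  have hpos : ∀ t ∈ Set.uIcc (0:ℝ) 1, 0 < (1 - t) + d := by
    intro t ht
    rw [Set.uIcc_of_le zero_le_one] at ht
    linarith [ht.2]
  have hder : ∀ t ∈ Set.uIcc (0:ℝ) 1, HasDerivAt (fun t : ℝ => ((1 - t) + d) ^ (1 - (n:ℝ)) / (n - 1)) 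
      (((1 - t) + d) ^ (-(n : ℝ))) t := by
    intro t ht
    have h0 : HasDerivAt (fun t : ℝ => (1 - t) + d) (-1) t := by
      simpa using ((hasDerivAt_id t).const_sub 1).add_const d
    have h1 := (h0.rpow_const (p := 1 - (n:ℝ)) (Or.inl (hpos t ht).ne')).div_const ((n:ℝ) - 1)
    refine h1.congr_deriv ?_
    have : (1 - (n:ℝ)) - 1 = -n := by ring
    rw [this]
    have : (n:ℝ) - 1 ≠ 0 := by linarith
    field_simp
    ring
  have hcont : ContinuousOn (fun t : ℝ => ((1 - t) + d) ^ (-(n : ℝ))) (Set.uIcc 0 1) := 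
    ContinuousOn.rpow_const (by fun_prop) fun t ht => Or.inl (hpos t ht).ne'
  have hii := hcont.intervalIntegrable (μ := volume)
  have hFTC := intervalIntegral.integral_eq_sub_of_hasDerivAt hder hii
  rw [intervalIntegrable_iff_integrableOn_Ioo_of_le zero_le_one] at hii
  rw [← ofReal_integral_eq_lintegral_ofReal hii]
  · rw [intervalIntegral.integral_of_le zero_le_one, integral_Ioc_eq_integral_Ioo] at hFTC
    rw [hFTC]
    apply ENNReal.ofReal_le_ofReal
    have e1 : 0 ≤ ((1 - 0) + d) ^ (1 - (n:ℝ)) / (n - 1) := by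
      apply div_nonneg (Real.rpow_nonneg (by linarith) _) (by linarith)
    have e2 : ((1 - 1) + d) ^ (1 - (n:ℝ)) / (n - 1) ≤ d ^ (1 - (n:ℝ)) := by
      rw [sub_self, zero_add]
      apply div_le_self (by positivity) (by linarith)
    linarith
  · refine (ae_restrict_iff' measurableSet_Ioo).mpr (Eventually.of_forall fun t ht => ?_)
    exact Real.rpow_nonneg (by linarith [ht.2]) _

/-- The truncated Riesz potential of `|f|` over the unit ball. -/
def potB (f : En n → Form n N k) (y : En n) : ℝ≥0∞ :=
  ∫⁻ x in UB n, ENNReal.ofReal (fnorm (f x)) * rieszK n (x - y)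

lemma measurable_fnorm {f : En n → Form n N k} (hf : ∀ q, Measurable fun x => f x q) :
    Measurable fun x => fnorm (f x) := by
  unfold fnorm; fun_prop

lemma homotopy_bound {j p0 : ℕ} (hn : 2 ≤ n) (hp : n = j + 1 + p0 + 1)
    {u : En n → Form n N (j + 1)} {f : En n → Form n N (j + 1 + 1)} (hc : Core u f)
    (a : Fin n → En n → ℝ) (ha : ∀ i, ContDiff ℝ (⊤ : ℕ∞) (a i))
    (htr : ∀ i, ∀ x ∈ UB n, ∑ r, pd r (pd r (a i)) x = 0) (v : Fin n → Form n N j) (y : En n)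
    (C : ℝ) (hC : 0 ≤ C)
    (hb : ∀ t, 0 < t → t < 1 → ∀ x ∈ UB n, ‖Psi p0 a v t x‖ ≤ C * ((1 - t) + ‖x - y‖) ^ (-(n : ℝ))) :
    ‖∫ x in UB n, finner (u x) (∑ l, ∑ i, pd l (a i) x • Wl l (v i))‖ₑ ≤
      ENNReal.ofReal (fcard n N (j + 1 + 1) * C) * potB f y := by
  have hfc : 0 ≤ fcard n N (j + 1 + 1) := by unfold fcard; positivity
  have hfn := measurable_fnorm hc.hfm
  rw [homotopy_total hp hc a ha htr v, enorm_neg]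
  calc _ ≤ ∫⁻ t in Set.Ioo (0:ℝ) 1, ∫⁻ x in UB n, ENNReal.ofReal (fcard n N (j + 1 + 1) * C) * 
        (ENNReal.ofReal (fnorm (f x)) * ENNReal.ofReal (((1 - t) + ‖x - y‖) ^ (-(n : ℝ)))) := by
        refine (enorm_integral_le_lintegral_enorm _).trans ?_
        apply setLIntegral_mono' measurableSet_Ioo
        intro t ht
        refine (enorm_integral_le_lintegral_enorm _).trans ?_
        apply setLIntegral_mono' measurableSet_ball
        intro x hx
        have hpos : 0 < (1 - t) + ‖x - y‖ := by linarith [ht.2, norm_nonneg (x - y)]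
        rw [← ENNReal.ofReal_mul (fnorm_nonneg _), ← ENNReal.ofReal_mul (by positivity), 
          ← ofReal_norm, Real.norm_eq_abs]
        apply ENNReal.ofReal_le_ofReal
        calc _ ≤ fcard n N (j + 1 + 1) * (fnorm (f x) * ‖Psi p0 a v t x‖) := abs_finner_le _ _
          _ ≤ fcard n N (j + 1 + 1) * (fnorm (f x) * (C * ((1 - t) + ‖x - y‖) ^ (-(n : ℝ)))) := by
            have := fnorm_nonneg (f x)
            have := hb t ht.1 ht.2 x hx
            gcongr
          _ = _ := by ring
    _ = ∫⁻ x in UB n, ∫⁻ t in Set.Ioo (0:ℝ) 1, ENNReal.ofReal (fcard n N (j + 1 + 1) * C) * 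
        (ENNReal.ofReal (fnorm (f x)) * ENNReal.ofReal (((1 - t) + ‖x - y‖) ^ (-(n : ℝ)))) := by
        apply lintegral_lintegral_swap
        apply Measurable.aemeasurable
        unfold Function.uncurry
        have : Measurable fun z : ℝ × En n => fnorm (f z.2) := hfn.comp measurable_snd
        fun_prop
    _ ≤ ∫⁻ x in UB n, ENNReal.ofReal (fcard n N (j + 1 + 1) * C) * 
          (ENNReal.ofReal (fnorm (f x)) * rieszK n (x - y)) := by
        apply lintegral_mono_ae
        have : Nontrivial (En n) := Module.nontrivial_of_finrank_pos (R := ℝ) (by simp; omega)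
        have hne : ∀ᵐ x ∂(volume.restrict (UB n)), x ≠ y := by
          apply ae_restrict_of_ae
          rw [ae_iff]
          simp
        filter_upwards [hne] with x hx
        rw [lintegral_const_mul _ (by fun_prop), lintegral_const_mul _ (by fun_prop)]
        gcongr
        exact lintegral_kernel hn _ (norm_pos_iff.mpr (sub_ne_zero.mpr hx))
    _ = _ := by
        rw [lintegral_const_mul]
        · rfl
        · have := rieszK_meas n
          fun_prop


/-! ### The kernels -/

lemma pd_mul (l : Fin n) (g h : En n → ℝ) (x : En n) (hg : DifferentiableAt ℝ g x)
    (hh : DifferentiableAt ℝ h x) : 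
    pd l (fun x => g x * h x) x = pd l g x * h x + g x * pd l h x := by
  unfold pd
  rw [fderiv_fun_mul hg hh]
  simp; ring

lemma pd_add (l : Fin n) (g h : En n → ℝ) (x : En n) (hg : DifferentiableAt ℝ g x)
    (hh : DifferentiableAt ℝ h x) : 
    pd l (fun x => g x + h x) x = pd l g x + pd l h x := by
  unfold pd
  rw [fderiv_fun_add hg hh]
  simp

lemma pd_sub (l : Fin n) (g h : En n → ℝ) (x : En n) (hg : DifferentiableAt ℝ g x)
    (hh : DifferentiableAt ℝ h x) : 
    pd l (fun x => g x - h x) x = pd l g x - pd l h x := by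
  unfold pd
  rw [fderiv_fun_sub hg hh]
  simp

lemma pd_comp (l : Fin n) (Φ : ℝ → ℝ) (q : En n → ℝ) (x : En n) (hΦ : DifferentiableAt ℝ Φ (q x))
    (hq : DifferentiableAt ℝ q x) : 
    pd l (fun x => Φ (q x)) x = deriv Φ (q x) * pd l q x := by
  unfold pd
  have h := (hΦ.hasDerivAt.comp_hasFDerivAt x hq.hasFDerivAt).fderiv
  have e : (Φ ∘ q) = fun x => Φ (q x) := rfl
  rw [e] at h
  rw [h]; simp

lemma pd_const (l : Fin n) (c : ℝ) (x : En n) : pd l (fun _ => c) x = 0 := by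
  simp [pd]

lemma pd_coord' (l i : Fin n) (x : En n) : pd l (fun x : En n => x i) x = if l = i then 1 else 0 :=
  pd_coord l i x

lemma pd_normsq (l : Fin n) (x : En n) : pd l (fun x : En n => ‖x‖ ^ 2) x = 2 * x l := by
  unfold pd
  rw [(hasFDerivAt_normsq x).fderiv]
  simp [inner_basisVec]

lemma contDiff_coord (i : Fin n) : ContDiff ℝ (⊤ : ℕ∞) (fun x : En n => x i) := by fun_prop

lemma contDiff_normsq : ContDiff ℝ (⊤ : ℕ∞) (fun x : En n => ‖x‖ ^ 2) := contDiff_norm_sq ℝ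

lemma pd_inner (l : Fin n) (x y : En n) : pd l (fun x : En n => inner ℝ x y) x = y l := by
  unfold pd
  have : (fun x : En n => inner ℝ x y) = fun x => innerSL ℝ y x := by
    funext x; simp [real_inner_comm]
  rw [this, ContinuousLinearMap.fderiv]
  simp [inner_basisVec]

lemma normsq_eq_sum (x : En n) : ‖x‖ ^ 2 = ∑ i, x i * x i := by
  rw [EuclideanSpace.norm_sq_eq]; simp [sq]

lemma inner_eq_sum (x y : En n) : inner ℝ x y = ∑ i, x i * y i := by
  rw [PiLp.inner_apply]; simp [mul_comm]

lemma abs_coord_le (x : En n) (i : Fin n) : |x i| ≤ ‖x‖ := by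
  simpa using PiLp.norm_apply_le x i

/-- The singular kernel field. -/
def Ek (Φ : ℝ → ℝ) (y : En n) (i : Fin n) (x : En n) : ℝ := (x i - y i) * Φ (‖x - y‖ ^ 2)

/-- The quadratic function of the reflected kernel. -/
def qk (y x : En n) : ℝ := 1 - 2 * inner ℝ x y + ‖y‖ ^ 2 * ‖x‖ ^ 2

/-- The vector field of the reflected kernel. -/
def Fk (y : En n) (i : Fin n) (x : En n) : ℝ := x i - y i * ‖x‖ ^ 2

/-- The reflected kernel. -/
def Ak (Φ : ℝ → ℝ) (y : En n) (i : Fin n) (x : En n) : ℝ := Fk y i x * Φ (qk y x)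

lemma contDiff_qk (y : En n) : ContDiff ℝ (⊤ : ℕ∞) (qk y) := by
  unfold qk
  have := contDiff_normsq (n := n)
  have h1 : ContDiff ℝ (⊤ : ℕ∞) (fun x : En n => inner ℝ x y) := contDiff_id.inner ℝ contDiff_const
  exact (contDiff_const.sub (contDiff_const.mul h1)).add (contDiff_const.mul this)

lemma contDiff_Fk (y : En n) (i : Fin n) : ContDiff ℝ (⊤ : ℕ∞) (Fk y i) := by
  unfold Fk
  have := contDiff_normsq (n := n)
  fun_prop

lemma contDiff_Ak {Φ : ℝ → ℝ} (hΦ : ContDiff ℝ (⊤ : ℕ∞) Φ) (y : En n) (i : Fin n) :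
    ContDiff ℝ (⊤ : ℕ∞) (Ak Φ y i) :=
  (contDiff_Fk y i).mul (hΦ.comp (contDiff_qk y))

lemma contDiff_Ek {Φ : ℝ → ℝ} (hΦ : ContDiff ℝ (⊤ : ℕ∞) Φ) (y : En n) (i : Fin n) :
    ContDiff ℝ (⊤ : ℕ∞) (Ek Φ y i) := by
  have h : ContDiff ℝ (⊤ : ℕ∞) (fun x : En n => ‖x - y‖ ^ 2) := 
    contDiff_normsq.comp (contDiff_id.sub contDiff_const)
  exact (by fun_prop : ContDiff ℝ (⊤ : ℕ∞) (fun x : En n => x i - y i)).mul (hΦ.comp h)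

lemma diffAt {g : En n → ℝ} (hg : ContDiff ℝ (⊤ : ℕ∞) g) (x : En n) : DifferentiableAt ℝ g x :=
  hg.differentiable (by simp) x

lemma pd_qk (l : Fin n) (y x : En n) : pd l (qk y) x = -2 * y l + 2 * ‖y‖ ^ 2 * x l := by
  have h1 : ContDiff ℝ (⊤ : ℕ∞) (fun x : En n => inner ℝ x y) := contDiff_id.inner ℝ contDiff_const
  have h2 := contDiff_normsq (n := n)
  unfold qk
  rw [pd_add _ _ _ _ (diffAt (by fun_prop) x) (diffAt (by fun_prop) x),
    pd_sub _ _ _ _ (diffAt (by fun_prop) x) (diffAt (by fun_prop) x), pd_const,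
    pd_mul _ _ _ _ (diffAt (by fun_prop) x) (diffAt (by fun_prop) x),
    pd_mul _ _ _ _ (diffAt (by fun_prop) x) (diffAt h2 x), pd_const, pd_const, pd_inner, pd_normsq]
  ring

lemma pd_Fk (l i : Fin n) (y x : En n) : 
    pd l (Fk y i) x = (if l = i then 1 else 0) - 2 * y i * x l := by
  have h2 := contDiff_normsq (n := n)
  unfold Fk
  rw [pd_sub _ _ _ _ (diffAt (by fun_prop) x) (diffAt (by fun_prop) x), pd_coord',
    pd_mul _ _ _ _ (diffAt (by fun_prop) x) (diffAt h2 x), pd_const, pd_normsq]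
  ring

lemma contDiff_deriv' {Φ : ℝ → ℝ} (hΦ : ContDiff ℝ (⊤ : ℕ∞) Φ) : ContDiff ℝ (⊤ : ℕ∞) (deriv Φ) := by
  have := hΦ.iterate_deriv 1
  simpa using this

lemma pd_Ak {Φ : ℝ → ℝ} (hΦ : ContDiff ℝ (⊤ : ℕ∞) Φ) (l i : Fin n) (y x : En n) :
    pd l (Ak Φ y i) x = ((if l = i then 1 else 0) - 2 * y i * x l) * Φ (qk y x) +
      Fk y i x * (deriv Φ (qk y x) * (-2 * y l + 2 * ‖y‖ ^ 2 * x l)) := by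
  have h0 : ContDiff ℝ (⊤ : ℕ∞) (fun x : En n => Φ (qk y x)) := hΦ.comp (contDiff_qk y)
  unfold Ak
  rw [pd_mul _ _ _ _ (diffAt (contDiff_Fk y i) x) (diffAt h0 x),
    pd_comp _ _ _ _ (hΦ.differentiable (by simp) _) (diffAt (contDiff_qk y) x), pd_Fk, pd_qk]

lemma pd_pd_Ak {Φ : ℝ → ℝ} (hΦ : ContDiff ℝ (⊤ : ℕ∞) Φ) (l i : Fin n) (y x : En n) :
    pd l (pd l (Ak Φ y i)) x = -2 * y i * Φ (qk y x) + 
      2 * ((if l = i then 1 else 0) - 2 * y i * x l) * (deriv Φ (qk y x) * (-2 * y l + 2 * ‖y‖ ^ 2 * x l)) +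
      Fk y i x * (deriv (deriv Φ) (qk y x) * (-2 * y l + 2 * ‖y‖ ^ 2 * x l) ^ 2 + 
        2 * ‖y‖ ^ 2 * deriv Φ (qk y x)) := by
  have e : pd l (Ak Φ y i) = fun x => ((if l = i then 1 else 0) - (2 * y i) * x l) * Φ (qk y x) +
      Fk y i x * (deriv Φ (qk y x) * (-2 * y l + 2 * ‖y‖ ^ 2 * x l)) := by
    funext x; exact pd_Ak hΦ l i y x
  have hΦ' := contDiff_deriv' hΦ
  have h1 : ContDiff ℝ (⊤ : ℕ∞) (fun x : En n => Φ (qk y x)) := hΦ.comp (contDiff_qk y)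
  have h2 : ContDiff ℝ (⊤ : ℕ∞) (fun x : En n => deriv Φ (qk y x)) := hΦ'.comp (contDiff_qk y)
  have h3 := contDiff_Fk y i
  have h4 := contDiff_qk y
  rw [e, pd_add _ _ _ _ (diffAt (by fun_prop) x) (diffAt (by fun_prop) x),
    pd_mul _ _ _ _ (diffAt (by fun_prop) x) (diffAt h1 x),
    pd_sub _ _ _ _ (diffAt (by fun_prop) x) (diffAt (by fun_prop) x), pd_const,
    pd_mul _ _ _ _ (diffAt (by fun_prop) x) (diffAt (by fun_prop) x), pd_const, pd_coord',
    pd_mul _ (Fk y i) _ _ (diffAt h3 x) (diffAt (by fun_prop) x),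
    pd_mul _ _ _ _ (diffAt h2 x) (diffAt (by fun_prop) x),
    pd_add _ _ _ _ (diffAt (by fun_prop) x) (diffAt (by fun_prop) x), pd_const,
    pd_mul _ _ _ _ (diffAt (by fun_prop) x) (diffAt (by fun_prop) x), pd_const, pd_coord',
    pd_comp _ _ _ _ (hΦ.differentiable (by simp) _) (diffAt (contDiff_qk y) x), 
    pd_comp _ _ _ _ (hΦ'.differentiable (by simp) _) (diffAt (contDiff_qk y) x), pd_Fk, pd_qk]
  simp only [if_true]
  ring

lemma laplace_Ak {Φ : ℝ → ℝ} (hΦ : ContDiff ℝ (⊤ : ℕ∞) Φ) (i : Fin n) (y x : En n)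
    (h1 : (n : ℝ) * Φ (qk y x) = -2 * (qk y x * deriv Φ (qk y x)))
    (h2 : qk y x * deriv (deriv Φ) (qk y x) = (-(n : ℝ) / 2 - 1) * deriv Φ (qk y x)) :
    ∑ l, pd l (pd l (Ak Φ y i)) x = 0 := by
  simp_rw [pd_pd_Ak hΦ]
  set P := Φ (qk y x)
  set P1 := deriv Φ (qk y x)
  set P2 := deriv (deriv Φ) (qk y x)
  set F := Fk y i x with hF
  have hs : ∀ l : Fin n, -2 * y i * P + 
      2 * ((if l = i then 1 else 0) - 2 * y i * x l) * (P1 * (-2 * y l + 2 * ‖y‖ ^ 2 * x l)) +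
      F * (P2 * (-2 * y l + 2 * ‖y‖ ^ 2 * x l) ^ 2 + 2 * ‖y‖ ^ 2 * P1) =
      (-2 * y i * P + 2 * ‖y‖ ^ 2 * P1 * F) + (if l = i then 2 * P1 * (-2 * y l + 2 * ‖y‖ ^ 2 * x l) else 0)
      + (x l * y l) * (8 * y i * P1 - 8 * F * P2 * ‖y‖ ^ 2) 
      + (x l * x l) * (- 8 * y i * P1 * ‖y‖ ^ 2 + 4 * F * P2 * (‖y‖ ^ 2) ^ 2) 
      + (y l * y l) * (4 * F * P2) := by
    intro l
    split_ifs <;> ring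
  simp_rw [hs, Finset.sum_add_distrib, ← Finset.sum_mul]
  rw [← inner_eq_sum, ← normsq_eq_sum, ← normsq_eq_sum, Finset.sum_ite_eq' ]
  simp only [Finset.sum_const, Finset.card_univ, Fintype.card_fin, nsmul_eq_mul, Finset.mem_univ, if_true]
  unfold Fk at hF
  unfold qk at h1 h2
  generalize hS : (inner ℝ x y : ℝ) = S at *
  generalize hX : ‖x‖ ^ 2 = X at *
  generalize hY : ‖y‖ ^ 2 = Y at *
  rw [mul_comm] at h1
  linear_combination (-2 * y i) * h1 + 4 * F * Y * h2 - 4 * P1 * Y * hF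


lemma pd_Ek {Φ : ℝ → ℝ} (hΦ : ContDiff ℝ (⊤ : ℕ∞) Φ) (l i : Fin n) (y x : En n) :
    pd l (Ek Φ y i) x = (if l = i then 1 else 0) * Φ (‖x - y‖ ^ 2) +
      2 * (x i - y i) * (x l - y l) * deriv Φ (‖x - y‖ ^ 2) := by
  have h : ContDiff ℝ (⊤ : ℕ∞) (fun x : En n => ‖x - y‖ ^ 2) := 
    contDiff_normsq.comp (contDiff_id.sub contDiff_const)
  have h0 : ContDiff ℝ (⊤ : ℕ∞) (fun x : En n => Φ (‖x - y‖ ^ 2)) := hΦ.comp h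
  have h1 : pd l (fun x : En n => ‖x - y‖ ^ 2) x = 2 * (x l - y l) := by
    have e : fderiv ℝ (fun x : En n => ‖x - y‖ ^ 2) x = fderiv ℝ (fun x : En n => ‖x‖ ^ 2) (x - y) :=
      fderiv_comp_sub (f := fun x : En n => ‖x‖ ^ 2) y
    have := pd_normsq l (x - y)
    unfold pd at this ⊢
    rw [e, this]; simp
  unfold Ek
  rw [pd_mul _ _ _ _ (diffAt (by fun_prop) x) (diffAt h0 x),
    pd_comp _ Φ (fun x : En n => ‖x - y‖ ^ 2) _ (hΦ.differentiable (by simp) _) (diffAt h x), h1,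
    pd_sub _ _ _ _ (diffAt (by fun_prop) x) (diffAt (by fun_prop) x), pd_coord', pd_const]
  ring

/-- The profile function. -/
def Phi1 (n : ℕ) (t : ℝ) : ℝ := Real.smoothTransition (2 * t - 1) * t ^ (-((n : ℝ) / 2))

lemma Phi1_contDiff : ContDiff ℝ (⊤ : ℕ∞) (Phi1 n) := by
  rw [contDiff_iff_contDiffAt]
  intro t
  by_cases ht : t < 1 / 2
  · have : Phi1 n =ᶠ[nhds t] fun _ => 0 := by
      filter_upwards [gt_mem_nhds ht] with s hs
      unfold Phi1
      rw [Real.smoothTransition.zero_of_nonpos (by linarith), zero_mul]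
    exact contDiffAt_const.congr_of_eventuallyEq this
  · have h1 : ContDiffAt ℝ (⊤ : ℕ∞) (fun t : ℝ => Real.smoothTransition (2 * t - 1)) t := 
      (sT_contDiff.comp (by fun_prop : ContDiff ℝ (⊤ : ℕ∞) fun t : ℝ => 2 * t - 1)).contDiffAt
    exact h1.mul (Real.contDiffAt_rpow_const_of_ne (by linarith))

lemma Phi1_nonneg {t : ℝ} (ht : 0 ≤ t) : 0 ≤ Phi1 n t :=
  mul_nonneg (Real.smoothTransition.nonneg _) (Real.rpow_nonneg ht _)

lemma Phi1_le {t : ℝ} (ht : 0 ≤ t) : Phi1 n t ≤ t ^ (-((n : ℝ) / 2)) := 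
  mul_le_of_le_one_left (Real.rpow_nonneg ht _) (Real.smoothTransition.le_one _)

lemma Phi1_eq {t : ℝ} (ht : 1 ≤ t) : Phi1 n t = t ^ (-((n : ℝ) / 2)) := by
  unfold Phi1
  rw [Real.smoothTransition.one_of_one_le (by linarith), one_mul]

/-- The density of the mollifier in terms of the squared radius. -/
def eta1 (n : ℕ) (t : ℝ) : ℝ := n * Phi1 n t + 2 * t * deriv (Phi1 n) t

lemma eta1_cont : Continuous (eta1 n) := by
  unfold eta1
  have h1 := (Phi1_contDiff (n := n)).continuous
  have h2 := (contDiff_deriv' (Phi1_contDiff (n := n))).continuous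
  fun_prop

lemma eta1_pos_eq {t : ℝ} (ht : 0 < t) :
    eta1 n t = 4 * t * deriv Real.smoothTransition (2 * t - 1) * t ^ (-((n : ℝ) / 2)) := by
  have h1 : HasDerivAt (fun t : ℝ => 2 * t - 1) 2 t := by
    simpa using ((hasDerivAt_id t).const_mul 2).sub_const 1
  have h2 : HasDerivAt (fun t : ℝ => Real.smoothTransition (2 * t - 1)) 
      (deriv Real.smoothTransition (2 * t - 1) * 2) t := 
    HasDerivAt.comp t (h₂ := Real.smoothTransition) 
      ((sT_contDiff.differentiable (by simp)) _).hasDerivAt h1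
  have h3 := h2.mul (Real.hasDerivAt_rpow_const (x := t) (p := -((n : ℝ) / 2)) (Or.inl ht.ne'))
  have h4 : deriv (Phi1 n) t = _ := h3.deriv
  unfold eta1
  rw [h4]
  unfold Phi1
  rw [Real.rpow_sub_one ht.ne']
  field_simp
  ring

lemma sT_deriv_nonneg (t : ℝ) : 0 ≤ deriv Real.smoothTransition t :=
  Real.smoothTransition.monotone.deriv_nonneg

lemma eta1_nonneg {t : ℝ} (ht : 0 ≤ t) : 0 ≤ eta1 n t := by
  rcases ht.eq_or_lt with rfl | ht
  · unfold eta1 Phi1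
    rw [Real.smoothTransition.zero_of_nonpos (by norm_num)]; simp
  · rw [eta1_pos_eq ht]
    have := sT_deriv_nonneg (2 * t - 1)
    positivity

lemma eta1_zero {t : ℝ} (ht : 1 < t) : eta1 n t = 0 := by
  rw [eta1_pos_eq (by linarith), sT_deriv_gt (by linarith)]; simp

lemma eta1_exists : ∃ t, 0 < t ∧ 0 < eta1 n t := by
  obtain ⟨c, hc, h⟩ := exists_deriv_eq_slope Real.smoothTransition (zero_lt_one)
    Real.smoothTransition.continuous.continuousOn (sT_contDiff.differentiable (by simp)).differentiableOn
  rw [Real.smoothTransition.zero, Real.smoothTransition.one] at h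
  have hc0 : 0 < (c + 1) / 2 := by linarith [hc.1]
  refine ⟨(c + 1) / 2, hc0, ?_⟩
  rw [eta1_pos_eq hc0, show 2 * ((c + 1) / 2) - 1 = c by ring, h]
  norm_num
  have := Real.rpow_pos_of_pos hc0 (-((n : ℝ) / 2))
  have h2 := hc.1
  positivity

lemma eta1_bdd : ∃ M : ℝ, 0 ≤ M ∧ ∀ t, 0 ≤ t → eta1 n t ≤ M := by
  obtain ⟨C, hC⟩ := (isCompact_Icc (a := (0:ℝ)) (b := 1)).exists_bound_of_continuousOn
    (eta1_cont (n := n)).continuousOn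
  have hC0 : 0 ≤ C := (norm_nonneg _).trans (hC 0 (by simp))
  refine ⟨C, hC0, fun t ht => ?_⟩
  by_cases h : t ≤ 1
  · exact (le_abs_self _).trans (hC t ⟨ht, h⟩)
  · rw [eta1_zero (not_le.mp h)]; exact hC0

/-- The rescaled profile. -/
def PhiE (n : ℕ) (ε t : ℝ) : ℝ := (ε ^ n)⁻¹ * Phi1 n (t / ε ^ 2)

lemma PhiE_contDiff (ε : ℝ) : ContDiff ℝ (⊤ : ℕ∞) (PhiE n ε) := by
  unfold PhiE
  exact contDiff_const.mul (Phi1_contDiff.comp (contDiff_id.div_const _))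

lemma scale_rpow {ε t : ℝ} (hε : 0 < ε) (ht : 0 ≤ t) :
    (ε ^ n)⁻¹ * (t / ε ^ 2) ^ (-((n : ℝ) / 2)) = t ^ (-((n : ℝ) / 2)) := by
  rw [Real.div_rpow ht (by positivity)]
  have : (ε ^ 2) ^ (-((n : ℝ) / 2)) = (ε ^ n)⁻¹ := by
    rw [← Real.rpow_natCast ε 2, ← Real.rpow_mul hε.le, ← Real.rpow_natCast ε n, ← Real.rpow_neg hε.le]
    congr 1; push_cast; ring
  rw [this]
  have : (ε ^ n) ≠ 0 := by positivity
  field_simp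

lemma PhiE_nonneg {ε t : ℝ} (hε : 0 < ε) (ht : 0 ≤ t) : 0 ≤ PhiE n ε t := 
  mul_nonneg (by positivity) (Phi1_nonneg (by positivity))

lemma PhiE_le {ε t : ℝ} (hε : 0 < ε) (ht : 0 ≤ t) : PhiE n ε t ≤ t ^ (-((n : ℝ) / 2)) := by
  rw [← scale_rpow hε ht]
  exact mul_le_mul_of_nonneg_left (Phi1_le (by positivity)) (by positivity)

lemma PhiE_eq {ε t : ℝ} (hε : 0 < ε) (ht : ε ^ 2 ≤ t) : PhiE n ε t = t ^ (-((n : ℝ) / 2)) := by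
  have h0 : 0 ≤ t := (sq_nonneg ε).trans ht
  rw [← scale_rpow hε h0, PhiE, Phi1_eq]
  rwa [le_div_iff₀ (by positivity), one_mul]

lemma PhiE_deriv {ε t : ℝ} (hε : 0 < ε) (ht : ε ^ 2 < t) : 
    deriv (PhiE n ε) t = -((n : ℝ) / 2) * t ^ (-((n : ℝ) / 2) - 1) := by
  have h0 : 0 < t := (sq_nonneg ε).trans_lt ht
  have : PhiE n ε =ᶠ[nhds t] fun t => t ^ (-((n : ℝ) / 2)) := by
    filter_upwards [lt_mem_nhds ht] with s hs
    exact PhiE_eq hε hs.le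
  rw [this.deriv_eq]
  exact (Real.hasDerivAt_rpow_const (Or.inl h0.ne')).deriv

lemma PhiE_deriv2 {ε t : ℝ} (hε : 0 < ε) (ht : ε ^ 2 < t) : 
    deriv (deriv (PhiE n ε)) t = 
      -((n : ℝ) / 2) * ((-((n : ℝ) / 2) - 1) * t ^ (-((n : ℝ) / 2) - 1 - 1)) := by
  have h0 : 0 < t := (sq_nonneg ε).trans_lt ht
  have : deriv (PhiE n ε) =ᶠ[nhds t] fun t => -((n : ℝ) / 2) * t ^ (-((n : ℝ) / 2) - 1) := by
    filter_upwards [lt_mem_nhds ht] with s hs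
    exact PhiE_deriv hε hs
  rw [this.deriv_eq]
  exact ((Real.hasDerivAt_rpow_const (Or.inl h0.ne')).const_mul _).deriv

lemma PhiE_ode1 {ε t : ℝ} (hε : 0 < ε) (ht : ε ^ 2 < t) : 
    (n : ℝ) * PhiE n ε t = -2 * (t * deriv (PhiE n ε) t) := by
  have h0 : 0 < t := (sq_nonneg ε).trans_lt ht
  rw [PhiE_eq hε ht.le, PhiE_deriv hε ht, Real.rpow_sub_one h0.ne']
  field_simp

lemma PhiE_ode2 {ε t : ℝ} (hε : 0 < ε) (ht : ε ^ 2 < t) : 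
    t * deriv (deriv (PhiE n ε)) t = (-(n : ℝ) / 2 - 1) * deriv (PhiE n ε) t := by
  have h0 : 0 < t := (sq_nonneg ε).trans_lt ht
  rw [PhiE_deriv2 hε ht, PhiE_deriv hε ht, Real.rpow_sub_one h0.ne' (-((n : ℝ) / 2) - 1)]
  field_simp

lemma PhiE_eta {ε : ℝ} (t : ℝ) : 
    n * PhiE n ε t + 2 * t * deriv (PhiE n ε) t = (ε ^ n)⁻¹ * eta1 n (t / ε ^ 2) := by
  have h1 : HasDerivAt (fun t : ℝ => t / ε ^ 2) (1 / ε ^ 2) t := (hasDerivAt_id t).div_const _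
  have h2 : HasDerivAt (fun t : ℝ => Phi1 n (t / ε ^ 2)) (deriv (Phi1 n) (t / ε ^ 2) * (1 / ε ^ 2)) t :=
    HasDerivAt.comp t (h₂ := Phi1 n) ((Phi1_contDiff.differentiable (by simp)) _).hasDerivAt h1
  have h3 : deriv (PhiE n ε) t = _ := (h2.const_mul ((ε ^ n)⁻¹)).deriv
  rw [h3]
  unfold eta1 PhiE
  ring

/-- The divergence of the kernel field. -/
lemma div_Ek (ε : ℝ) (y x : En n) : ∑ i, pd i (Ek (PhiE n ε) y i) x =
    (ε ^ n)⁻¹ * eta1 n (‖x - y‖ ^ 2 / ε ^ 2) := by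
  simp_rw [pd_Ek (PhiE_contDiff ε)]
  rw [← PhiE_eta]
  simp only [if_true, Finset.sum_add_distrib, one_mul, Finset.sum_const, Finset.card_univ,
    Fintype.card_fin, nsmul_eq_mul, ← Finset.sum_mul]
  congr 2
  rw [normsq_eq_sum, Finset.mul_sum]
  refine Finset.sum_congr rfl fun i _ => ?_
  simp; ring

lemma Ek_le {ε : ℝ} (hε : 0 < ε) (hn : 2 ≤ n) (y x : En n) (i : Fin n) : 
    |Ek (PhiE n ε) y i x| ≤ ‖x - y‖ ^ (1 - (n : ℝ)) := by
  unfold Ek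
  by_cases h : x = y
  · subst h; simp; positivity
  have h0 : 0 < ‖x - y‖ := norm_pos_iff.mpr (sub_ne_zero.mpr h)
  rw [abs_mul, abs_of_nonneg (PhiE_nonneg hε (by positivity))]
  have h1 : |x i - y i| ≤ ‖x - y‖ := by simpa using abs_coord_le (x - y) i
  have h2 := PhiE_le (n := n) hε (sq_nonneg ‖x - y‖)
  have h3 : (‖x - y‖ ^ 2) ^ (-((n : ℝ) / 2)) = ‖x - y‖ ^ (-(n:ℝ)) := by
    rw [← Real.rpow_natCast _ 2, ← Real.rpow_mul h0.le]
    congr 1; push_cast; ring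
  rw [h3] at h2
  calc _ ≤ ‖x - y‖ * ‖x - y‖ ^ (-(n:ℝ)) := 
        mul_le_mul h1 h2 (PhiE_nonneg hε (by positivity)) h0.le
    _ = _ := by
        rw [sub_eq_add_neg (1:ℝ), Real.rpow_add h0, Real.rpow_one]


lemma qk_eq (y x : En n) : qk y x = ‖x - y‖ ^ 2 + (1 - ‖x‖ ^ 2) * (1 - ‖y‖ ^ 2) := by
  unfold qk
  rw [norm_sub_sq_real]; ring

lemma qk_ge (y x : En n) : (1 - ‖x‖ * ‖y‖) ^ 2 ≤ qk y x := by
  unfold qk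
  have := real_inner_le_norm x y
  nlinarith

lemma Fk_sq (y x : En n) : ∑ i, Fk y i x ^ 2 = ‖x‖ ^ 2 * qk y x := by
  have : ∀ i, Fk y i x ^ 2 = x i * x i - 2 * ‖x‖ ^ 2 * (x i * y i) + (‖x‖ ^ 2) ^ 2 * (y i * y i) := by
    intro i; unfold Fk; ring
  simp_rw [this, Finset.sum_add_distrib, Finset.sum_sub_distrib, ← Finset.mul_sum]
  rw [← normsq_eq_sum, ← normsq_eq_sum, ← inner_eq_sum]
  unfold qk; ring

lemma gq_sq (y x : En n) : ∑ l, (-2 * y l + 2 * ‖y‖ ^ 2 * x l) ^ 2 = 4 * ‖y‖ ^ 2 * qk y x := by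
  have : ∀ l, (-2 * y l + 2 * ‖y‖ ^ 2 * x l) ^ 2 = 
      4 * (y l * y l) - 8 * ‖y‖ ^ 2 * (x l * y l) + 4 * (‖y‖ ^ 2) ^ 2 * (x l * x l) := by
    intro i; ring
  simp_rw [this, Finset.sum_add_distrib, Finset.sum_sub_distrib, ← Finset.mul_sum]
  rw [← normsq_eq_sum, ← normsq_eq_sum, ← inner_eq_sum]
  unfold qk; ring

lemma qk_gt {ε : ℝ} (hε : 0 < ε) {y x : En n} (hy : ε < 1 - ‖y‖) (hx : ‖x‖ ≤ 1) : ε ^ 2 < qk y x := by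
  refine lt_of_lt_of_le ?_ (qk_ge y x)
  have : ‖x‖ * ‖y‖ ≤ ‖y‖ := mul_le_of_le_one_left (norm_nonneg _) hx
  have h : ε < 1 - ‖x‖ * ‖y‖ := by linarith
  gcongr

lemma abs_pd_Ak_le {ε : ℝ} (hε : 0 < ε) {y x : En n} (hy : ε < 1 - ‖y‖) (hx : ‖x‖ ≤ 1) (l i : Fin n) :
    |pd l (Ak (PhiE n ε) y i) x| ≤ (n + 3) * qk y x ^ (-((n : ℝ) / 2)) := by
  have hq := qk_gt hε hy hx
  have hq0 : 0 < qk y x := (sq_nonneg ε).trans_lt hq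
  have hy1 : ‖y‖ ≤ 1 := by linarith
  rw [pd_Ak (PhiE_contDiff ε), PhiE_eq hε hq.le, PhiE_deriv hε hq, Real.rpow_sub_one hq0.ne']
  have hF : |Fk y i x| ≤ √(qk y x) := by
    rw [← Real.sqrt_sq_eq_abs]
    apply Real.sqrt_le_sqrt
    have h1 := Finset.single_le_sum (f := fun i => Fk y i x ^ 2) (fun i _ => sq_nonneg _) (Finset.mem_univ i)
    rw [Fk_sq] at h1
    refine h1.trans (mul_le_of_le_one_left hq0.le ?_)
    exact pow_le_one₀ (norm_nonneg _) hx
  have hG : |-2 * y l + 2 * ‖y‖ ^ 2 * x l| ≤ 2 * √(qk y x) := by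
    rw [← Real.sqrt_sq_eq_abs]
    have : 2 * √(qk y x) = √(4 * qk y x) := by
      rw [Real.sqrt_mul (by norm_num), show (4:ℝ) = 2 ^ 2 by norm_num, Real.sqrt_sq (by norm_num)]
    rw [this]
    apply Real.sqrt_le_sqrt
    have h1 := Finset.single_le_sum (f := fun l => (-2 * y l + 2 * ‖y‖ ^ 2 * x l) ^ 2) 
      (fun i _ => sq_nonneg _) (Finset.mem_univ l)
    rw [gq_sq] at h1
    refine h1.trans ?_
    have := pow_le_one₀ (n := 2) (norm_nonneg _) hy1
    nlinarith
  set P := qk y x ^ (-((n : ℝ) / 2)) with hP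
  have hP0 : 0 < P := Real.rpow_pos_of_pos hq0 _
  have h1 : |(if l = i then (1:ℝ) else 0) - 2 * y i * x l| ≤ 3 := by
    have e1 : |2 * y i * x l| ≤ 2 := by
      rw [abs_mul, abs_mul, abs_two]
      have := (abs_coord_le y i).trans hy1
      have := (abs_coord_le x l).trans hx
      nlinarith [abs_nonneg (y i), abs_nonneg (x l)]
    have e2 : |(if l = i then (1:ℝ) else 0)| ≤ 1 := by split_ifs <;> simp
    exact (abs_sub _ _).trans (by linarith)
  have h2 : |Fk y i x * (-((n:ℝ) / 2) * (P / qk y x) * (-2 * y l + 2 * ‖y‖ ^ 2 * x l))| ≤ n * P := by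
    rw [abs_mul, abs_mul, abs_mul, abs_neg, abs_of_nonneg (by positivity : 0 ≤ (n:ℝ) / 2), 
      abs_of_pos (div_pos hP0 hq0)]
    calc _ ≤ √(qk y x) * ((n:ℝ) / 2 * (P / qk y x) * (2 * √(qk y x))) := by gcongr
      _ = n * P * (√(qk y x) * √(qk y x)) / qk y x := by ring
      _ = n * P := by rw [Real.mul_self_sqrt hq0.le]; field_simp
  calc _ ≤ _ := abs_add_le _ _
    _ ≤ 3 * P + n * P := by
        refine add_le_add ?_ h2
        rw [abs_mul, abs_of_pos hP0]
        exact mul_le_mul_of_nonneg_right h1 hP0.le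
    _ = _ := by ring

lemma qk_lower {y x : En n} {t : ℝ} (ht0 : 0 < t) (ht1 : t < 1) (hx : ‖x‖ ≤ 1) (hy : ‖y‖ ≤ 1) :
    ((1 - t) + ‖x - y‖) / 3 ≤ √(qk y (t • x)) := by
  have e : ‖t • x‖ = t * ‖x‖ := by rw [norm_smul, Real.norm_of_nonneg ht0.le]
  have h1 : 1 - t ≤ √(qk y (t • x)) := by
    apply Real.le_sqrt_of_sq_le
    refine le_trans ?_ (qk_ge y (t • x))
    rw [e]
    have : t * ‖x‖ * ‖y‖ ≤ t := by
      have : ‖x‖ * ‖y‖ ≤ 1 := mul_le_one₀ hx (norm_nonneg _) hy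
      nlinarith
    have : 1 - t ≤ 1 - t * ‖x‖ * ‖y‖ := by linarith
    gcongr
  have h2 : ‖t • x - y‖ ≤ √(qk y (t • x)) := by
    apply Real.le_sqrt_of_sq_le
    rw [qk_eq]
    have e1 : ‖t • x‖ ≤ 1 := by rw [e]; nlinarith
    have := pow_le_one₀ (n := 2) (norm_nonneg _) e1
    have := pow_le_one₀ (n := 2) (norm_nonneg _) hy
    nlinarith
  have h3 : ‖x - y‖ ≤ ‖t • x - y‖ + (1 - t) := by
    have : x - y = (t • x - y) + (1 - t) • x := by module
    rw [this]
    refine (norm_add_le _ _).trans ?_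
    rw [norm_smul, Real.norm_of_nonneg (by linarith)]
    have : (1 - t) * ‖x‖ ≤ (1 - t) := mul_le_of_le_one_right (by linarith) hx
    linarith
  linarith

lemma Psi_bound {j : ℕ} (p0 : ℕ) {ε : ℝ} (hε : 0 < ε) {y : En n} (hy : ε < 1 - ‖y‖) 
    (v : Fin n → Form n N j) (hv : ∀ i, ‖v i‖ ≤ 1) (t : ℝ) (ht0 : 0 < t) (ht1 : t < 1) (x : En n) 
    (hx : x ∈ UB n) :
    ‖Psi p0 (Ak (PhiE n ε) y) v t x‖ ≤ ((n:ℝ) ^ 3 * ((n + 3) * 3 ^ n)) * ((1 - t) + ‖x - y‖) ^ (-(n : ℝ)) := by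
  have hx1 : ‖x‖ ≤ 1 := by simpa using (mem_ball_zero_iff.mp hx).le
  have htx : ‖t • x‖ ≤ 1 := by
    rw [norm_smul, Real.norm_of_nonneg ht0.le]; nlinarith [norm_nonneg x]
  have hy1 : ‖y‖ ≤ 1 := by linarith
  have hd : 0 < (1 - t) + ‖x - y‖ := by linarith [norm_nonneg (x - y)]
  have hq := qk_gt hε hy htx
  have hq0 : 0 < qk y (t • x) := (sq_nonneg ε).trans_lt hq
  have hQ : qk y (t • x) ^ (-((n : ℝ) / 2)) ≤ 3 ^ n * ((1 - t) + ‖x - y‖) ^ (-(n : ℝ)) := by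
    have e1 : qk y (t • x) ^ (-((n : ℝ) / 2)) = √(qk y (t • x)) ^ (-(n:ℝ)) := by
      rw [Real.sqrt_eq_rpow, ← Real.rpow_mul hq0.le]; congr 1; ring
    rw [e1]
    refine (Real.rpow_le_rpow_of_nonpos (by positivity) (qk_lower ht0 ht1 hx1 hy1) (by simp)).trans ?_
    rw [Real.div_rpow hd.le (by norm_num), Real.rpow_neg (by norm_num : (0:ℝ) ≤ 3), Real.rpow_natCast]
    apply le_of_eq; field_simp
  unfold Psi
  refine (norm_sum_le _ _).trans ?_
  calc _ ≤ ∑ z : Fin n × Fin n × Fin n, (n + 3) * (3 ^ n * ((1 - t) + ‖x - y‖) ^ (-(n : ℝ))) := by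
        refine Finset.sum_le_sum fun z _ => ?_
        rw [norm_smul]
        have h1 : ‖Wl z.1 (Wl z.2.1 (v z.2.2))‖ ≤ 1 := 
          (norm_Wl_le _ _).trans ((norm_Wl_le _ _).trans (hv _))
        have h2 : ‖t ^ p0 * x z.1 * pd z.2.1 (Ak (PhiE n ε) y z.2.2) (t • x)‖ ≤ 
            (n + 3) * (3 ^ n * ((1 - t) + ‖x - y‖) ^ (-(n : ℝ))) := by
          rw [norm_mul, norm_mul, Real.norm_eq_abs, Real.norm_eq_abs, Real.norm_eq_abs]
          have a1 : |t ^ p0| ≤ 1 := by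
            rw [abs_of_nonneg (by positivity)]; exact pow_le_one₀ ht0.le ht1.le
          have a2 := (abs_coord_le x z.1).trans hx1
          have a3 : |t ^ p0| * |x z.1| ≤ 1 := mul_le_one₀ a1 (abs_nonneg _) a2
          refine (mul_le_of_le_one_left (abs_nonneg _) a3).trans ?_
          refine (abs_pd_Ak_le hε hy htx _ _).trans ?_
          gcongr
        refine (mul_le_of_le_one_right (norm_nonneg _) h1).trans h2
    _ = _ := by simp; ring

lemma sphere_vanish (g : En n → ℝ) (hg : ContDiff ℝ (⊤ : ℕ∞) g) (h0 : ∀ x : En n, ‖x‖ = 1 → g x = 0) :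
    ∃ C, 0 ≤ C ∧ ∀ x ∈ UB n, |g x| ≤ C * (1 - ‖x‖ ^ 2) := by
  obtain ⟨L, hL⟩ := (isCompact_closedBall (0 : En n) 1).exists_bound_of_continuousOn 
    (hg.continuous_fderiv (by simp)).continuousOn
  have hL0 : 0 ≤ L := (norm_nonneg _).trans (hL 0 (by simp))
  refine ⟨L + |g 0|, by positivity, fun x hx => ?_⟩
  have hx1 : ‖x‖ < 1 := by simpa using hx
  have hsq : ‖x‖ ^ 2 ≤ ‖x‖ := by nlinarith [norm_nonneg x]
  by_cases hx0 : x = 0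
  · subst hx0; simp; exact hL0
  have hn0 : 0 < ‖x‖ := norm_pos_iff.mpr hx0
  have hu : ‖(‖x‖⁻¹ • x)‖ = 1 := by
    rw [norm_smul, norm_inv, norm_norm, inv_mul_cancel₀ hn0.ne']
  have := (convex_closedBall (0 : En n) 1).norm_image_sub_le_of_norm_fderiv_le (𝕜 := ℝ) (f := g) 
    (fun z _ => diffAt hg z) hL (x := ‖x‖⁻¹ • x) (y := x) (by simp [hu]) (by simpa using hx1.le)
  rw [h0 _ hu, sub_zero] at this
  have e : ‖x - ‖x‖⁻¹ • x‖ = 1 - ‖x‖ := by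
    have : x - ‖x‖⁻¹ • x = (1 - ‖x‖⁻¹) • x := by module
    rw [this, norm_smul, Real.norm_eq_abs, abs_of_nonpos]
    · field_simp; ring
    · have := (one_le_inv₀ hn0).mpr hx1.le
      linarith
  rw [e] at this
  refine this.trans ?_
  have := abs_nonneg (g 0)
  nlinarith

lemma Ek_Ak_vanish {ε : ℝ} (y : En n) (i : Fin n) :
    ∃ C, 0 ≤ C ∧ ∀ x ∈ UB n, |Ek (PhiE n ε) y i x - Ak (PhiE n ε) y i x| ≤ C * (1 - ‖x‖ ^ 2) := by
  apply sphere_vanish (fun x => Ek (PhiE n ε) y i x - Ak (PhiE n ε) y i x)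
  · exact (contDiff_Ek (PhiE_contDiff ε) y i).sub (contDiff_Ak (PhiE_contDiff ε) y i)
  · intro x hx
    simp [Ek, Ak, qk_eq, hx, Fk]


/-! ### The representation estimate -/

lemma rep_bound {j p0 : ℕ} (hn : 2 ≤ n) (hp : n = j + 1 + p0 + 1)
    {u : En n → Form n N (j + 1)} {f : En n → Form n N (j + 1 + 1)} (hc : Core u f)
    {ε : ℝ} (hε : 0 < ε) {y : En n} (hy : ε < 1 - ‖y‖) (q : FormIdx n (j + 1) × Fin N) :
    ‖∫ x in UB n, (ε ^ n)⁻¹ * eta1 n (‖x - y‖ ^ 2 / ε ^ 2) * u x q‖ₑ ≤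
      ENNReal.ofReal (fcard n N (j + 1 + 1) * ((n:ℝ) ^ 3 * ((n + 3) * 3 ^ n)) + 
        fcard n N (j + 1 + 1) * n) * potB f y := by
  classical
  have hfc : 0 ≤ fcard n N (j + 1 + 1) := by unfold fcard; positivity
  set Φ := PhiE n ε with hΦd
  have hΦ : ContDiff ℝ (⊤ : ℕ∞) Φ := PhiE_contDiff ε
  set e : Form n N (j + 1) := Pi.single q 1 with he
  have he1 : ‖e‖ ≤ 1 := by
    rw [pi_norm_le_iff_of_nonneg zero_le_one]
    intro r
    by_cases h : r = q
    · subst h; simp [he]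
    · simp [he, h]
  set v : Fin n → Form n N j := fun i => Il i e with hv
  have hv1 : ∀ i, ‖v i‖ ≤ 1 := fun i => (norm_Il_le i e).trans he1
  have hE := fun i => contDiff_Ek hΦ y i
  have hA := fun i => contDiff_Ak hΦ y i
  -- the algebraic identity
  have hkey : ∀ x, ((ε ^ n)⁻¹ * eta1 n (‖x - y‖ ^ 2 / ε ^ 2)) • e = 
      (∑ l, ∑ i, pd l (Ek Φ y i) x • Wl l (v i)) - 
        codiff (smoothGrad (fun x => ∑ i, Ek Φ y i x • Wl i e) x) := by
    intro x
    rw [codiff_smoothGrad_sum _ _ _ (fun i => diffAt (hE i) x), ← div_Ek]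
    have e1 : ∀ l i, pd l (Ek Φ y i) x • Il l (Wl i e) = 
        (if l = i then pd l (Ek Φ y i) x • e else 0) - pd i (Ek Φ y l) x • Wl i (v l) := by
      intro l i
      have : pd l (Ek Φ y i) x = pd i (Ek Φ y l) x := by
        rw [pd_Ek hΦ, pd_Ek hΦ]
        by_cases h : l = i
        · subst h; ring
        · rw [if_neg h, if_neg (Ne.symm h)]; ring
      rw [Il_Wl, ← this, smul_sub]
      split_ifs <;> simp [hv]
    simp_rw [e1, Finset.sum_sub_distrib, Finset.sum_ite_eq, Finset.mem_univ, if_true, ← Finset.sum_smul]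
    rw [Finset.sum_comm (f := fun l i => pd i (Ek Φ y l) x • Wl i (v l))]
    abel
  have hi0 : ∀ x, (ε ^ n)⁻¹ * eta1 n (‖x - y‖ ^ 2 / ε ^ 2) * u x q = 
      finner (u x) (∑ l, ∑ i, pd l (Ek Φ y i) x • Wl l (v i)) -
      finner (u x) (codiff (smoothGrad (fun x => ∑ i, Ek Φ y i x • Wl i e) x)) := by
    intro x
    rw [← finner_sub, ← hkey, finner_smul]
    congr 1
    simp [finner, he, Pi.single_apply]
  have hsm1 : ∀ r, ContDiff ℝ (⊤ : ℕ∞) fun x => (∑ i, Ek Φ y i x • Wl i e) r := 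
    smooth_sum _ _ hE
  have hsm2 : ∀ r, ContDiff ℝ (⊤ : ℕ∞) fun x => (∑ i, (Ek Φ y i x - Ak Φ y i x) • v i) r := 
    smooth_sum (fun i x => Ek Φ y i x - Ak Φ y i x) _ (fun i => (hE i).sub (hA i))
  have hcE : ∀ r, Continuous fun x => (∑ l, ∑ i, pd l (Ek Φ y i) x • Wl l (v i)) r := by
    intro r
    simp only [Finset.sum_apply, Pi.smul_apply, smul_eq_mul]
    exact continuous_finsetSum _ fun l _ => continuous_finsetSum _ fun i _ => 
      (contDiff_pd l _ (hE i)).continuous.mul continuous_const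
  have hcA : ∀ r, Continuous fun x => (∑ l, ∑ i, pd l (Ak Φ y i) x • Wl l (v i)) r := by
    intro r
    simp only [Finset.sum_apply, Pi.smul_apply, smul_eq_mul]
    exact continuous_finsetSum _ fun l _ => continuous_finsetSum _ fun i _ => 
      (contDiff_pd l _ (hA i)).continuous.mul continuous_const
  -- replacing the kernel by the reflected one
  have hrep : ∫ x in UB n, finner (u x) (∑ l, ∑ i, pd l (Ek Φ y i) x • Wl l (v i)) =
      ∫ x in UB n, finner (u x) (∑ l, ∑ i, pd l (Ak Φ y i) x • Wl l (v i)) := by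
    choose C hC0 hC using fun i => Ek_Ak_vanish (ε := ε) y i
    have h := H2ext hc (fun x => ∑ i, (Ek Φ y i x - Ak Φ y i x) • v i) hsm2 (n * ∑ i, C i) ?_
    · have e2 : ∀ x, finner (u x) (extD (smoothGrad (fun x => ∑ i, (Ek Φ y i x - Ak Φ y i x) • v i) x)) =
          finner (u x) (∑ l, ∑ i, pd l (Ek Φ y i) x • Wl l (v i)) - 
          finner (u x) (∑ l, ∑ i, pd l (Ak Φ y i) x • Wl l (v i)) := by
        intro x
        rw [extD_smoothGrad_sum (fun i x => Ek Φ y i x - Ak Φ y i x) _ _ 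
          (fun i => diffAt ((hE i).sub (hA i)) x), ← finner_sub, ← Finset.sum_sub_distrib]
        congr 1
        refine Finset.sum_congr rfl fun l _ => ?_
        rw [← Finset.sum_sub_distrib]
        refine Finset.sum_congr rfl fun i _ => ?_
        rw [pd_sub _ _ _ _ (diffAt (hE i) x) (diffAt (hA i) x), sub_smul]
      simp_rw [e2] at h
      rw [integral_sub (integrable_finner hc.hui hcE) (integrable_finner hc.hui hcA)] at h
      linarith
    · intro x hx r
      have hx1 : ‖x‖ ≤ 1 := by simpa using (mem_ball_zero_iff.mp hx).le
      have hα : ‖∑ i, (Ek Φ y i x - Ak Φ y i x) • v i‖ ≤ (∑ i, C i) * (1 - ‖x‖ ^ 2) := by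
        refine (norm_sum_le _ _).trans ?_
        rw [Finset.sum_mul]
        refine Finset.sum_le_sum fun i _ => ?_
        rw [norm_smul]
        exact (mul_le_of_le_one_right (norm_nonneg _) (hv1 i)).trans (hC i x hx)
      refine (norm_le_pi_norm (∑ m, x m • Wl m (∑ i, (Ek Φ y i x - Ak Φ y i x) • v i)) r).trans ?_
      refine (norm_sum_le _ _).trans ?_
      calc _ ≤ ∑ m : Fin n, (∑ i, C i) * (1 - ‖x‖ ^ 2) := by
            refine Finset.sum_le_sum fun m _ => ?_
            rw [norm_smul]
            exact (mul_le_of_le_one_left (norm_nonneg _) ((abs_coord_le x m).trans hx1)).trans 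
              ((norm_Wl_le _ _).trans hα)
        _ = _ := by simp; ring
  have hb1 := homotopy_bound hn hp hc (Ak Φ y) hA (by
      intro i x hx
      have hq := qk_gt hε hy (x := x) (by simpa using (mem_ball_zero_iff.mp hx).le)
      exact laplace_Ak hΦ i y x (PhiE_ode1 hε hq) (PhiE_ode2 hε hq)) v y 
    ((n:ℝ) ^ 3 * ((n + 3) * 3 ^ n)) (by positivity)
    (fun t ht0 ht1 x hx => Psi_bound p0 hε hy v hv1 t ht0 ht1 x hx)
  have hb2 : ‖∫ x in UB n, finner (f x) (∑ i, Ek Φ y i x • Wl i e)‖ₑ ≤ 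
      ENNReal.ofReal (fcard n N (j + 1 + 1) * n) * potB f y := by
    refine (enorm_integral_le_lintegral_enorm _).trans ?_
    unfold potB
    rw [← lintegral_const_mul' _ _ ENNReal.ofReal_ne_top]
    refine lintegral_mono fun x => ?_
    unfold rieszK
    rw [← ofReal_norm, ← ENNReal.ofReal_mul (fnorm_nonneg _), ← ENNReal.ofReal_mul (by positivity)]
    apply ENNReal.ofReal_le_ofReal
    refine (abs_finner_le _ _).trans ?_
    have h3 : ‖∑ i, Ek Φ y i x • Wl i e‖ ≤ n * ‖x - y‖ ^ (1 - (n:ℝ)) := by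
      refine (norm_sum_le _ _).trans ?_
      calc _ ≤ ∑ i : Fin n, ‖x - y‖ ^ (1 - (n:ℝ)) := by
            refine Finset.sum_le_sum fun i _ => ?_
            rw [norm_smul]
            exact (mul_le_of_le_one_right (norm_nonneg _) ((norm_Wl_le _ _).trans he1)).trans 
              (Ek_le hε hn y x i)
        _ = _ := by simp
    calc _ ≤ fcard n N (j + 1 + 1) * (fnorm (f x) * (n * ‖x - y‖ ^ (1 - (n:ℝ)))) := by
          have := fnorm_nonneg (f x)
          gcongr
      _ = _ := by ring
  simp_rw [hi0]
  rw [integral_sub (integrable_finner hc.hui hcE) 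
    (integrable_finner hc.hui (continuous_codiff_smoothGrad _ hsm1)), hrep, ← hc.H1 _ hsm1,
    ENNReal.ofReal_add (by positivity) (by positivity), add_mul]
  exact enorm_sub_le.trans (add_le_add hb1 hb2)


/-! ### Lebesgue differentiation -/

/-- The mollifier. -/
def rhoE (n : ℕ) (ε : ℝ) (z : En n) : ℝ := (ε ^ n)⁻¹ * eta1 n (‖z‖ ^ 2 / ε ^ 2)

lemma rhoE_cont (ε : ℝ) : Continuous (rhoE n ε) := by
  unfold rhoE
  have := eta1_cont (n := n)
  fun_prop

lemma rhoE_zero {ε : ℝ} (hε : 0 < ε) {z : En n} (hz : ε < ‖z‖) : rhoE n ε z = 0 := by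
  unfold rhoE
  rw [eta1_zero, mul_zero]
  rw [lt_div_iff₀ (by positivity), one_mul]
  gcongr

lemma rhoE_nonneg {ε : ℝ} (hε : 0 < ε) (z : En n) : 0 ≤ rhoE n ε z := 
  mul_nonneg (by positivity) (eta1_nonneg (by positivity))

lemma rhoE_compact {ε : ℝ} (hε : 0 < ε) : HasCompactSupport (rhoE n ε) := by
  apply HasCompactSupport.of_support_subset_isCompact (isCompact_closedBall (0 : En n) ε)
  intro z hz
  by_contra h
  exact hz (rhoE_zero hε (by simpa using h))

lemma rhoE_int {ε : ℝ} (hε : 0 < ε) : Integrable (rhoE n ε) := 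
  (rhoE_cont ε).integrable_of_hasCompactSupport (rhoE_compact hε)

/-- The mass of the mollifier. -/
def rhoM (n : ℕ) : ℝ := ∫ z : En n, rhoE n 1 z

lemma rhoM_pos (hn : 2 ≤ n) : 0 < rhoM n := by
  obtain ⟨t, ht, h⟩ := eta1_exists (n := n)
  unfold rhoM
  refine (rhoE_cont 1).integral_pos_of_hasCompactSupport_nonneg_nonzero (rhoE_compact one_pos)
    (rhoE_nonneg one_pos) (x := √t • basisVec ⟨0, by omega⟩) ?_
  unfold rhoE
  have : ‖√t • basisVec (n := n) ⟨0, by omega⟩‖ ^ 2 = t := by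
    rw [norm_smul, basisVec]
    simp [ht.le]
  rw [this]
  simp [h.ne']

lemma rhoE_integral {ε : ℝ} (hε : 0 < ε) (y : En n) : ∫ x, rhoE n ε (x - y) = rhoM n := by
  rw [integral_sub_right_eq_self (rhoE n ε) y]
  have h := Measure.integral_comp_smul (volume : Measure (En n)) (rhoE n 1) ε⁻¹
  have e : ∀ x : En n, rhoE n ε x = (ε ^ n)⁻¹ * rhoE n 1 (ε⁻¹ • x) := by
    intro x
    unfold rhoE
    rw [norm_smul, norm_inv, Real.norm_of_nonneg hε.le]
    congr 2
    · rw [one_pow, inv_one, one_mul]; congr 1; field_simp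
  simp_rw [e]
  rw [integral_const_mul, h]
  unfold rhoM
  simp only [finrank_euclideanSpace, Fintype.card_fin, smul_eq_mul]
  rw [abs_of_pos (by positivity), inv_pow, inv_inv, ← mul_assoc, inv_mul_cancel₀ (by positivity), one_mul]

lemma lebesgue_conv (hn : 2 ≤ n) (g : En n → ℝ) (hg : Integrable g) : 
    ∀ᵐ y, Tendsto (fun ε => ∫ x, rhoE n ε (x - y) * g x) (nhdsWithin 0 (Set.Ioi 0)) (nhds (rhoM n * g y)) := by
  obtain ⟨M, hM0, hM⟩ := eta1_bdd (n := n)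
  filter_upwards [IsUnifLocDoublingMeasure.ae_tendsto_average_norm_sub (μ := (volume : Measure (En n))) 
    hg.locallyIntegrable 1] with y hy
  have h1 := hy (l := nhdsWithin (0:ℝ) (Set.Ioi 0)) (fun _ => y) (fun ε => ε) tendsto_id (by
    filter_upwards [self_mem_nhdsWithin] with ε hε
    simpa using (le_of_lt hε))
  rw [tendsto_iff_norm_sub_tendsto_zero]
  set V := volume.real (closedBall (0 : En n) 1) with hV
  have h2 : Tendsto (fun ε => M * V * ⨍ x in closedBall y ε, ‖g x - g y‖) 
    (nhdsWithin (0:ℝ) (Set.Ioi 0)) (nhds 0) := by simpa using h1.const_mul (M * V)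
  refine tendsto_of_tendsto_of_tendsto_of_le_of_le' tendsto_const_nhds h2 
    (Eventually.of_forall fun _ => norm_nonneg _) ?_
  filter_upwards [self_mem_nhdsWithin] with ε (hε : 0 < ε)
  have hr : Integrable (fun x => rhoE n ε (x - y)) := (rhoE_int hε).comp_sub_right y
  have hbd : ∀ z : En n, rhoE n ε z ≤ (ε ^ n)⁻¹ * M := fun z => 
    mul_le_mul_of_nonneg_left (hM _ (by positivity)) (by positivity)
  have hrg : Integrable (fun x => rhoE n ε (x - y) * g x) := by
    refine hg.bdd_mul (c := (ε ^ n)⁻¹ * M) hr.aestronglyMeasurable (Eventually.of_forall fun x => ?_)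
    rw [Real.norm_of_nonneg (rhoE_nonneg hε _)]
    exact hbd _
  have e1 : (∫ x, rhoE n ε (x - y) * g x) - rhoM n * g y = ∫ x, rhoE n ε (x - y) * (g x - g y) := by
    simp_rw [mul_sub]
    rw [integral_sub hrg (hr.mul_const _), integral_mul_const, rhoE_integral hε]
  rw [e1]
  have hvol : volume.real (closedBall y ε) = ε ^ n * V := by
    rw [hV, measureReal_def, measureReal_def, Measure.addHaar_closedBall _ _ hε.le, 
      Measure.addHaar_closedBall _ _ zero_le_one]
    simp only [finrank_euclideanSpace, Fintype.card_fin, one_pow, ENNReal.ofReal_one, one_mul,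
      ENNReal.toReal_mul]
    rw [ENNReal.toReal_ofReal (by positivity)]
  have hV0 : 0 < V := by
    rw [hV, measureReal_def]
    exact ENNReal.toReal_pos (measure_closedBall_pos volume 0 one_pos).ne' measure_closedBall_lt_top.ne
  have hgi : IntegrableOn (fun x => ‖g x - g y‖) (closedBall y ε) := 
    (hg.integrableOn.sub (integrableOn_const (by exact measure_closedBall_lt_top.ne))).norm
  calc _ ≤ ∫ x, ‖rhoE n ε (x - y) * (g x - g y)‖ := norm_integral_le_integral_norm _
    _ = ∫ x in closedBall y ε, ‖rhoE n ε (x - y) * (g x - g y)‖ := by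
        rw [setIntegral_eq_integral_of_forall_compl_eq_zero]
        intro x hx
        rw [rhoE_zero hε (by simpa [dist_eq_norm] using hx)]; simp
    _ ≤ ∫ x in closedBall y ε, ((ε ^ n)⁻¹ * M) * ‖g x - g y‖ := by
        apply integral_mono_of_nonneg (Eventually.of_forall fun _ => norm_nonneg _) 
          (hgi.const_mul _) (Eventually.of_forall fun x => ?_)
        simp only []
        rw [norm_mul, Real.norm_of_nonneg (rhoE_nonneg hε _)]
        exact mul_le_mul_of_nonneg_right (hbd _) (norm_nonneg _)
    _ = _ := by
        rw [integral_const_mul, setAverage_eq, hvol, smul_eq_mul]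
        field_simp

lemma pointwise_bound (n N j p0 : ℕ) (hn : 2 ≤ n) (hp : n = j + 1 + p0 + 1) : ∃ K : ℝ, 0 < K ∧
    ∀ {u : En n → Form n N (j + 1)} {f : En n → Form n N (j + 1 + 1)}, Core u f →
    ∀ᵐ y, y ∈ UB n → ENNReal.ofReal (fnorm (u y)) ≤ ENNReal.ofReal K * potB f y := by
  set K0 := fcard n N (j + 1 + 1) * ((n:ℝ) ^ 3 * ((n + 3) * 3 ^ n)) + fcard n N (j + 1 + 1) * n with hK0
  have hfc : 0 ≤ fcard n N (j + 1 + 1) := by unfold fcard; positivity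
  have hfc' : 0 ≤ fcard n N (j + 1) := by unfold fcard; positivity
  have hK : 0 ≤ K0 := by positivity
  have hM := rhoM_pos hn
  refine ⟨fcard n N (j + 1) * (K0 / rhoM n) + 1, by positivity, ?_⟩
  intro u f hc
  have hall := ae_all_iff.mpr fun q => lebesgue_conv hn (fun x => u x q) (hc.hui q)
  filter_upwards [hall] with y hy hyU
  have hy1 : ‖y‖ < 1 := by simpa using hyU
  have hq : ∀ q, ENNReal.ofReal |u y q| ≤ ENNReal.ofReal (K0 / rhoM n) * potB f y := by
    intro q
    have h1 : Tendsto (fun ε => ‖∫ x, rhoE n ε (x - y) * u x q‖ₑ) (nhdsWithin 0 (Set.Ioi 0)) 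
      (nhds ‖rhoM n * u y q‖ₑ) := (hy q).enorm
    have h2 : ‖rhoM n * u y q‖ₑ ≤ ENNReal.ofReal K0 * potB f y := by
      refine le_of_tendsto h1 ?_
      filter_upwards [Ioo_mem_nhdsGT (by linarith : (0:ℝ) < 1 - ‖y‖)] with ε hε
      have := rep_bound hn hp hc hε.1 hε.2 q
      rw [← hK0] at this
      refine le_trans (le_of_eq ?_) this
      congr 1
      rw [setIntegral_eq_integral_of_forall_compl_eq_zero]
      · rfl
      · intro x hx
        have hx1 : 1 ≤ ‖x‖ := by simpa using hx
        have : rhoE n ε (x - y) = 0 := by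
          apply rhoE_zero hε.1
          have := norm_sub_norm_le x y
          linarith [hε.2]
        unfold rhoE at this
        rw [this, zero_mul]
    rw [enorm_mul, Real.enorm_eq_ofReal hM.le, Real.enorm_eq_ofReal_abs] at h2
    rw [ENNReal.ofReal_div_of_pos hM, div_eq_mul_inv, mul_right_comm, ← div_eq_mul_inv]
    rw [ENNReal.le_div_iff_mul_le (by simp [hM]) (by simp), mul_comm]
    exact h2
  calc ENNReal.ofReal (fnorm (u y)) ≤ ENNReal.ofReal (∑ q, |u y q|) := 
        ENNReal.ofReal_le_ofReal (fnorm_le_sum _)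
    _ = ∑ q, ENNReal.ofReal |u y q| := ENNReal.ofReal_sum_of_nonneg fun _ _ => abs_nonneg _
    _ ≤ ∑ q : FormIdx n (j + 1) × Fin N, ENNReal.ofReal (K0 / rhoM n) * potB f y := 
        Finset.sum_le_sum fun q _ => hq q
    _ = ENNReal.ofReal (fcard n N (j + 1) * (K0 / rhoM n)) * potB f y := by
        rw [ENNReal.ofReal_mul hfc', Finset.sum_const, nsmul_eq_mul, Finset.card_univ, ← mul_assoc]
        unfold fcard
        rw [ENNReal.ofReal_natCast]
    _ ≤ _ := by
        gcongr
        linarith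


/-! ### Normalised estimate and scaling -/

lemma norm_est (n N j p0 : ℕ) (hn : 2 ≤ n) (hp : n = j + 1 + p0 + 1) (s : ℝ) (hs1 : 1 < s) (hsn : s < n) : 
    ∃ C : ℝ, 0 < C ∧
    ∀ {u : En n → Form n N (j + 1)} {f : En n → Form n N (j + 1 + 1)}, Core u f →
    (∫⁻ y in UB n, ENNReal.ofReal (fnorm (u y) ^ ((n : ℝ) * s / ((n : ℝ) - s)))) ^ (((n : ℝ) - s) / ((n : ℝ) * s))
     ≤ ENNReal.ofReal C * (∫⁻ x, ENNReal.ofReal (fnorm (f x) ^ s)) ^ (1 / s) := by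
  obtain ⟨K, hK, hpt⟩ := pointwise_bound n N j p0 hn hp
  obtain ⟨C, hC, hh⟩ := hls n hn s hs1 hsn
  refine ⟨K * C, by positivity, ?_⟩
  intro u f hc
  have hn0 : (0:ℝ) < n := by linarith
  set qs := (n : ℝ) * s / ((n : ℝ) - s) with hqs
  have hqs0 : 0 < qs := div_pos (by positivity) (by linarith)
  have hinv : ((n : ℝ) - s) / ((n : ℝ) * s) = qs⁻¹ := by rw [hqs, inv_div]
  have h1 := hh (fun x => fnorm (f x)) (measurable_fnorm hc.hfm) (fun x => fnorm_nonneg _)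
  have h2 : ∫⁻ y in UB n, ENNReal.ofReal (fnorm (u y) ^ qs) ≤ 
      ENNReal.ofReal K ^ qs * ∫⁻ y, rieszI n (fun x => fnorm (f x)) y ^ qs := by
    rw [← lintegral_const_mul' _ _ (ENNReal.rpow_ne_top_of_nonneg hqs0.le ENNReal.ofReal_ne_top)]
    refine le_trans ?_ (setLIntegral_le_lintegral (UB n) _)
    apply lintegral_mono_ae
    refine (ae_restrict_iff' measurableSet_ball).mpr ?_
    filter_upwards [hpt hc] with y hy hyU
    rw [← ENNReal.ofReal_rpow_of_nonneg (fnorm_nonneg _) hqs0.le, ← ENNReal.mul_rpow_of_nonneg _ _ hqs0.le]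
    refine ENNReal.rpow_le_rpow ((hy hyU).trans ?_) hqs0.le
    gcongr
    exact setLIntegral_le_lintegral _ _
  calc _ ≤ (ENNReal.ofReal K ^ qs * ∫⁻ y, rieszI n (fun x => fnorm (f x)) y ^ qs) ^ (((n : ℝ) - s) / ((n : ℝ) * s)) := 
        ENNReal.rpow_le_rpow h2 (by rw [hinv]; positivity)
    _ = ENNReal.ofReal K * (∫⁻ y, rieszI n (fun x => fnorm (f x)) y ^ qs) ^ (((n : ℝ) - s) / ((n : ℝ) * s)) := by
        rw [ENNReal.mul_rpow_of_nonneg _ _ (by rw [hinv]; positivity), ← ENNReal.rpow_mul, hinv, 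
          mul_inv_cancel₀ hqs0.ne', ENNReal.rpow_one]
    _ ≤ _ := by
        rw [ENNReal.ofReal_mul hK.le, mul_assoc]
        gcongr

/-- The affine map carrying the unit ball to the ball. -/
def Tm (x₀ : En n) (R : ℝ) (x : En n) : En n := x₀ + R • x

/-- Inverse of the affine map. -/
def Ti (x₀ : En n) (R : ℝ) (z : En n) : En n := R⁻¹ • (z - x₀)

lemma Ti_Tm (x₀ : En n) {R : ℝ} (hR : 0 < R) (x : En n) : Ti x₀ R (Tm x₀ R x) = x := by
  simp [Ti, Tm, smul_smul, hR.ne']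

lemma Tm_Ti (x₀ : En n) {R : ℝ} (hR : 0 < R) (x : En n) : Tm x₀ R (Ti x₀ R x) = x := by
  simp [Ti, Tm, smul_smul, hR.ne']

lemma Tm_meas (x₀ : En n) (R : ℝ) : Measurable (Tm x₀ R) := by
  unfold Tm; fun_prop

lemma Ti_meas (x₀ : En n) (R : ℝ) : Measurable (Ti x₀ R) := by
  unfold Ti; fun_prop

/-- The affine map as a measurable equivalence. -/
def Teq (x₀ : En n) {R : ℝ} (hR : 0 < R) : En n ≃ᵐ En n where
  toFun := Tm x₀ R
  invFun := Ti x₀ R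
  left_inv := Ti_Tm x₀ hR
  right_inv := Tm_Ti x₀ hR
  measurable_toFun := Tm_meas x₀ R
  measurable_invFun := Ti_meas x₀ R

lemma Tm_preimage (x₀ : En n) {R : ℝ} (hR : 0 < R) : Tm x₀ R ⁻¹' ball x₀ R = UB n := by
  ext x
  simp only [Set.mem_preimage, mem_ball, Tm, dist_eq_norm, add_sub_cancel_left, sub_zero]
  rw [norm_smul, Real.norm_of_nonneg hR.le]
  exact mul_lt_iff_lt_one_right hR

lemma map_T (x₀ : En n) {R : ℝ} (hR : 0 < R) : (volume.restrict (UB n)).map (Teq x₀ hR) = 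
    ENNReal.ofReal ((R ^ n)⁻¹) • volume.restrict (ball x₀ R) := by
  have h1 : (volume : Measure (En n)).map (Teq x₀ hR) = ENNReal.ofReal ((R ^ n)⁻¹) • volume := by
    have e : (Teq x₀ hR : En n → En n) = (fun x => x₀ + x) ∘ (fun x => R • x) := rfl
    rw [e, ← Measure.map_map (by fun_prop) (by fun_prop), Measure.map_addHaar_smul _ hR.ne', 
      Measure.map_smul, map_add_left_eq_self]
    simp only [finrank_euclideanSpace, Fintype.card_fin]
    rw [abs_of_pos (by positivity)]
  have h2 := (Teq x₀ hR).restrict_map (volume : Measure (En n)) (ball x₀ R)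
  have h3 : (Teq x₀ hR : En n → En n) ⁻¹' ball x₀ R = UB n := Tm_preimage x₀ hR
  rw [h3, h1] at h2
  rw [← h2, Measure.restrict_smul]

lemma cv_int (x₀ : En n) {R : ℝ} (hR : 0 < R) (g : En n → ℝ) : 
    ∫ x in UB n, g (Tm x₀ R x) = (R ^ n)⁻¹ * ∫ z in ball x₀ R, g z := by
  have := integral_map_equiv (μ := volume.restrict (UB n)) (Teq x₀ hR) g
  rw [map_T, integral_smul_measure, ENNReal.toReal_ofReal (by positivity)] at this
  exact this.symm

lemma cv_lint (x₀ : En n) {R : ℝ} (hR : 0 < R) (g : En n → ℝ≥0∞) : 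
    ∫⁻ x in UB n, g (Tm x₀ R x) = ENNReal.ofReal ((R ^ n)⁻¹) * ∫⁻ z in ball x₀ R, g z := by
  have := lintegral_map_equiv (μ := volume.restrict (UB n)) g (Teq x₀ hR)
  rw [map_T, lintegral_smul_measure] at this
  exact this.symm

lemma cv_integrable (x₀ : En n) {R : ℝ} (hR : 0 < R) {g : En n → ℝ} (hg : IntegrableOn g (ball x₀ R)) :
    IntegrableOn (fun x => g (Tm x₀ R x)) (UB n) := by
  have h1 : Integrable g ((volume.restrict (UB n)).map (Teq x₀ hR)) := by
    rw [map_T]; exact Integrable.smul_measure hg ENNReal.ofReal_ne_top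
  exact (integrable_map_equiv (Teq x₀ hR) g).mp h1

lemma cv_ae (x₀ : En n) {R : ℝ} (hR : 0 < R) {p : En n → Prop} 
    (h : ∀ᵐ z ∂(volume.restrict (ball x₀ R)), p z) : 
    ∀ᵐ x ∂(volume.restrict (UB n)), p (Tm x₀ R x) := by
  have h1 : ∀ᵐ z ∂((volume.restrict (UB n)).map (Teq x₀ hR)), p z := by
    rw [map_T]; exact Measure.ae_smul_measure h _
  exact ae_of_ae_map (Teq x₀ hR).measurable.aemeasurable h1

lemma contDiff_Ti (x₀ : En n) (R : ℝ) : ContDiff ℝ (⊤ : ℕ∞) (Ti x₀ R) := by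
  unfold Ti; fun_prop

lemma smoothGrad_Ti (x₀ : En n) (R : ℝ) (ψ : En n → Form n N k) 
    (hψ : ∀ q, ContDiff ℝ (⊤ : ℕ∞) fun x => ψ x q) (z : En n) :
    smoothGrad (fun z => ψ (Ti x₀ R z)) z = R⁻¹ • smoothGrad ψ (Ti x₀ R z) := by
  funext i q
  simp only [smoothGrad, Pi.smul_apply, smul_eq_mul]
  have h1 : HasFDerivAt (Ti x₀ R) (R⁻¹ • ContinuousLinearMap.id ℝ (En n)) z := by
    unfold Ti
    exact ((hasFDerivAt_id z).sub_const x₀).const_smul R⁻¹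
  have h2 := (((hψ q).differentiable (by simp)) (Ti x₀ R z)).hasFDerivAt.comp z h1
  have h3 : fderiv ℝ (fun z => ψ (Ti x₀ R z) q) z = _ := h2.fderiv
  rw [h3]
  simp

lemma codiff_smul (c : ℝ) (G : Fin n → Form n N (k + 1)) : codiff (c • G) = c • codiff G := by
  rw [codiff_eq', codiff_eq', smul_neg, Finset.smul_sum]
  simp

lemma extD_smul (c : ℝ) (G : Fin n → Form n N k) : extD (c • G) = c • extD G := by
  rw [extD_eq', extD_eq', Finset.smul_sum]
  simp


lemma finner_smul_left (v w : Form n N k) (c : ℝ) : finner (c • v) w = c * finner v w := by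
  simp [finner, Finset.mul_sum, mul_assoc]

lemma gnorm_nonneg (G : Fin n → Form n N k) : 0 ≤ gnorm G := Real.sqrt_nonneg _

lemma abs_extD_le (G : Fin n → Form n N k) (q) : |extD G q| ≤ n * gnorm G := by
  refine (norm_le_pi_norm (extD G) q).trans ?_
  rw [extD_eq']
  refine (norm_sum_le _ _).trans ?_
  calc _ ≤ ∑ i : Fin n, gnorm G := by
        refine Finset.sum_le_sum fun i _ => (norm_Wl_le _ _).trans ?_
        rw [pi_norm_le_iff_of_nonneg (gnorm_nonneg G)]
        intro r
        rw [Real.norm_eq_abs, ← Real.sqrt_sq_eq_abs]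
        apply Real.sqrt_le_sqrt
        exact (Finset.single_le_sum (f := fun r => G i r ^ 2) (fun _ _ => sq_nonneg _) 
          (Finset.mem_univ r)).trans (Finset.single_le_sum (f := fun i => ∑ r, G i r ^ 2) 
            (fun _ _ => Finset.sum_nonneg fun _ _ => sq_nonneg _) (Finset.mem_univ i))
    _ = _ := by simp

lemma le_one_add_rpow {a s : ℝ} (ha : 0 ≤ a) (hs : 1 ≤ s) : a ≤ 1 + a ^ s := by
  by_cases h : a ≤ 1
  · linarith [Real.rpow_nonneg ha s]
  · have := Real.rpow_le_rpow_of_exponent_le (not_le.mp h).le hs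
    rw [Real.rpow_one] at this
    linarith

lemma fnorm_smul (c : ℝ) (v : Form n N k) : fnorm (c • v) = |c| * fnorm v := by
  unfold fnorm
  simp only [Pi.smul_apply, smul_eq_mul, mul_pow, ← Finset.mul_sum]
  rw [Real.sqrt_mul (sq_nonneg c), Real.sqrt_sq_eq_abs]

lemma aesm_extD {μ : Measure (En n)} {G : En n → Fin n → Form n N k} 
    (hG : ∀ i q, AEStronglyMeasurable (fun x => G x i q) μ) (q) : 
    AEStronglyMeasurable (fun x => extD (G x) q) μ := by
  unfold extD
  refine Finset.aestronglyMeasurable_fun_sum _ fun i _ => ?_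
  by_cases h : i ∈ q.1.1
  · simp only [h, dif_pos]
    exact (hG i _).const_mul _
  · simp only [h, dif_neg, not_false_eq_true]
    exact aestronglyMeasurable_const

lemma exists_core {j : ℕ} {s R : ℝ} (hs1 : 1 < s) (hR : 0 < R) (x₀ : En n) (u : En n → Form n N (j + 1)) 
    (G : En n → Fin n → Form n N (j + 1)) (h : MemWdeltaT (ball x₀ R) s u G) :
    ∃ (U : En n → Form n N (j + 1)) (F : En n → Form n N (j + 1 + 1)), Core U F ∧
      (∀ᵐ x ∂(volume.restrict (UB n)), U x = u (Tm x₀ R x)) ∧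
      (∀ᵐ x ∂(volume.restrict (UB n)), F x = R • extD (G (Tm x₀ R x))) ∧ 
      (∀ x, x ∉ UB n → F x = 0) := by
  obtain ⟨⟨-, hum, hGm, hui, hGi⟩, hco, hta⟩ := h
  have hfm := aesm_extD hGm
  set B := ball x₀ R with hB
  have hfin : volume B ≠ ⊤ := measure_ball_lt_top.ne
  have hone : Integrable (fun _ => (1:ℝ)) (volume.restrict B) := integrableOn_const hfin
  have hu1 : ∀ q, IntegrableOn (fun x => u x q) B := by
    intro q
    refine Integrable.mono' (hone.add hui) (hum q) (Eventually.of_forall fun x => ?_)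
    exact (abs_le_fnorm _ q).trans (le_one_add_rpow (fnorm_nonneg _) hs1.le)
  have hf1 : ∀ q, IntegrableOn (fun x => extD (G x) q) B := by
    intro q
    refine Integrable.mono' ((hone.add hGi).const_mul (n:ℝ)) (hfm q) (Eventually.of_forall fun x => ?_)
    refine (abs_extD_le _ q).trans ?_
    exact mul_le_mul_of_nonneg_left (le_one_add_rpow (Real.sqrt_nonneg _) hs1.le) (Nat.cast_nonneg n)
  set U : En n → Form n N (j + 1) := fun x q => 
    (UB n).indicator (fun x => (hum q).mk _ (Tm x₀ R x)) x with hU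
  set F : En n → Form n N (j + 1 + 1) := fun x q => 
    (UB n).indicator (fun x => R * (hfm q).mk _ (Tm x₀ R x)) x with hF
  have hUe : ∀ᵐ x ∂(volume.restrict (UB n)), U x = u (Tm x₀ R x) := by
    have h1 : ∀ᵐ x ∂(volume.restrict (UB n)), ∀ q, u (Tm x₀ R x) q = (hum q).mk _ (Tm x₀ R x) := 
      ae_all_iff.mpr fun q => cv_ae x₀ hR (hum q).ae_eq_mk
    filter_upwards [h1, ae_restrict_mem measurableSet_ball] with x hx hxU
    funext q
    rw [hU]
    simp only [Set.indicator_of_mem hxU]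
    exact (hx q).symm
  have hFe : ∀ᵐ x ∂(volume.restrict (UB n)), F x = R • extD (G (Tm x₀ R x)) := by
    have h1 : ∀ᵐ x ∂(volume.restrict (UB n)), ∀ q, extD (G (Tm x₀ R x)) q = (hfm q).mk _ (Tm x₀ R x) := 
      ae_all_iff.mpr fun q => cv_ae x₀ hR (hfm q).ae_eq_mk
    filter_upwards [h1, ae_restrict_mem measurableSet_ball] with x hx hxU
    funext q
    rw [hF]
    simp only [Set.indicator_of_mem hxU, Pi.smul_apply, smul_eq_mul]
    rw [hx q]
  have hRn : R ≠ 0 := hR.ne'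
  refine ⟨U, F, ⟨?_, ?_, ?_, ?_, ?_, ?_⟩, hUe, hFe, ?_⟩
  · intro q
    exact (((hum q).stronglyMeasurable_mk.measurable).comp (Tm_meas x₀ R)).indicator measurableSet_ball
  · intro q
    rw [hU]
    simp only []
    rw [integrable_indicator_iff measurableSet_ball]
    exact cv_integrable x₀ hR ((hu1 q).congr (hum q).ae_eq_mk)
  · intro q
    exact ((((hfm q).stronglyMeasurable_mk.measurable).comp (Tm_meas x₀ R)).const_mul R).indicator 
      measurableSet_ball
  · intro q
    rw [hF]
    simp only []
    rw [integrable_indicator_iff measurableSet_ball]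
    exact (cv_integrable x₀ hR ((hf1 q).congr (hfm q).ae_eq_mk)).const_mul R
  · intro ψ hψ
    have hψ' : ∀ q, ContDiff ℝ (⊤ : ℕ∞) fun z => ψ (Ti x₀ R z) q := 
      fun q => (hψ q).comp (contDiff_Ti x₀ R)
    have e := hta (fun z => ψ (Ti x₀ R z)) hψ'
    have e1 : ∫ x in UB n, finner (F x) (ψ x) = 
        ∫ x in UB n, R * finner (extD (G (Tm x₀ R x))) (ψ (Ti x₀ R (Tm x₀ R x))) := by
      apply integral_congr_ae
      filter_upwards [hFe] with x hx
      rw [hx, finner_smul_left, Ti_Tm x₀ hR]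
    have e2 : ∫ x in UB n, finner (U x) (codiff (smoothGrad ψ x)) = 
        ∫ x in UB n, R * finner (u (Tm x₀ R x)) 
          (codiff (smoothGrad (fun z => ψ (Ti x₀ R z)) (Tm x₀ R x))) := by
      apply integral_congr_ae
      filter_upwards [hUe] with x hx
      rw [hx, smoothGrad_Ti _ _ _ hψ, codiff_smul, finner_smul, Ti_Tm x₀ hR, ← mul_assoc, 
        mul_inv_cancel₀ hRn, one_mul]
    rw [e1, e2, integral_const_mul, integral_const_mul,
      cv_int x₀ hR (fun z => finner (extD (G z)) (ψ (Ti x₀ R z))), 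
      cv_int x₀ hR (fun z => finner (u z) (codiff (smoothGrad (fun z => ψ (Ti x₀ R z)) z))), e]
  · intro α hα
    obtain ⟨hα1, hα2, hα3⟩ := hα
    have hcont : Continuous (Ti x₀ R) := (contDiff_Ti x₀ R).continuous
    have hts : tsupport (fun z => α (Ti x₀ R z)) ⊆ Tm x₀ R '' tsupport α := by
      apply closure_minimal
      · intro z hz
        exact ⟨Ti x₀ R z, subset_tsupport _ hz, Tm_Ti x₀ hR z⟩
      · have : Continuous (Tm x₀ R) := by unfold Tm; fun_prop
        exact (hα2.isCompact.image this).isClosed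
    have htest : IsTestForm B (fun z => α (Ti x₀ R z)) := by
      refine ⟨fun q => (hα1 q).comp (contDiff_Ti x₀ R), ?_, ?_⟩
      · have : Continuous (Tm x₀ R) := by unfold Tm; fun_prop
        exact (hα2.isCompact.image this).of_isClosed_subset (isClosed_tsupport _) hts
      · refine hts.trans ?_
        rintro _ ⟨x, hx, rfl⟩
        have := hα3 hx
        rwa [← Tm_preimage x₀ hR] at this
    have e := hco j rfl (fun z => α (Ti x₀ R z)) htest
    simp only [cast_eq] at e
    have e2 : ∫ x in UB n, finner (U x) (extD (smoothGrad α x)) = 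
        ∫ x in UB n, R * finner (u (Tm x₀ R x)) 
          (extD (smoothGrad (fun z => α (Ti x₀ R z)) (Tm x₀ R x))) := by
      apply integral_congr_ae
      filter_upwards [hUe] with x hx
      rw [hx, smoothGrad_Ti _ _ _ hα1, extD_smul, finner_smul, Ti_Tm x₀ hR, ← mul_assoc, 
        mul_inv_cancel₀ hRn, one_mul]
    rw [e2, integral_const_mul, 
      cv_int x₀ hR (fun z => finner (u z) (extD (smoothGrad (fun z => α (Ti x₀ R z)) z))), e]
    simp
  · intro x hx
    funext q
    rw [hF]
    simp [Set.indicator_of_notMem hx]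

lemma aesm_fnorm {μ : Measure (En n)} {u : En n → Form n N k} 
    (hu : ∀ q, AEStronglyMeasurable (fun x => u x q) μ) : 
    AEStronglyMeasurable (fun x => fnorm (u x)) μ := by
  unfold fnorm
  refine Real.continuous_sqrt.comp_aestronglyMeasurable ?_
  exact Finset.aestronglyMeasurable_fun_sum _ fun q _ => (hu q).pow 2

lemma main_succ (n N j : ℕ) (hn : 2 ≤ n) (hj : j + 1 ≤ n - 1)
    (s : ℝ) (hs1 : 1 < s) (hsn : s < n) :
    ∃ c : ℝ, 0 < c ∧
      ∀ (R : ℝ), 0 < R →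
        ∀ (x₀ : En n) (u : En n → Form n N (j + 1)) (G : En n → Fin n → Form n N (j + 1)),
          MemWdeltaT (ball x₀ R) s u G →
          (⨍ x in ball x₀ R, fnorm (u x) ^ ((n : ℝ) * s / ((n : ℝ) - s))) ^
              (((n : ℝ) - s) / ((n : ℝ) * s)) ≤
            c * R * (⨍ x in ball x₀ R, fnorm (extD (G x)) ^ s) ^ (1 / s) := by
  obtain ⟨C, hC, hest⟩ := norm_est n N j (n - (j + 1) - 1) hn (by omega) s hs1 hsn
  set w := volume.real (UB n) with hw
  have hw0 : 0 < w := by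
    rw [hw, measureReal_def]
    exact ENNReal.toReal_pos (measure_ball_pos volume 0 one_pos).ne' measure_ball_lt_top.ne
  have hn0 : (0:ℝ) < n := by linarith
  have hs0 : 0 < s := by linarith
  set qs := (n : ℝ) * s / ((n : ℝ) - s) with hqs
  set r := ((n : ℝ) - s) / ((n : ℝ) * s) with hr
  have hr0 : 0 < r := div_pos (by linarith) (by positivity)
  refine ⟨C * (w⁻¹ ^ r / w⁻¹ ^ (1 / s)), by positivity, ?_⟩
  intro R hR x₀ u G h
  obtain ⟨U, F, hc, hU, hF, hF0⟩ := exists_core hs1 hR x₀ u G h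
  have hE := hest hc
  obtain ⟨⟨-, hum, hGm, hui, hGi⟩, hco, hta⟩ := h
  have hfm := aesm_extD hGm
  set A := ∫ x in ball x₀ R, fnorm (u x) ^ qs with hA
  set D := ∫ x in ball x₀ R, fnorm (extD (G x)) ^ s with hD
  have hA0 : 0 ≤ A := integral_nonneg fun x => Real.rpow_nonneg (fnorm_nonneg _) _
  have hD0 : 0 ≤ D := integral_nonneg fun x => Real.rpow_nonneg (fnorm_nonneg _) _
  have hDi : IntegrableOn (fun x => fnorm (extD (G x)) ^ s) (ball x₀ R) := by
    have hb : 0 ≤ fcard n N (j + 1 + 1) * n := by unfold fcard; positivity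
    refine Integrable.mono' (hGi.const_mul ((fcard n N (j + 1 + 1) * n) ^ s)) 
      ((aesm_fnorm hfm).aemeasurable.pow_const s).aestronglyMeasurable (Eventually.of_forall fun x => ?_)
    rw [Real.norm_of_nonneg (Real.rpow_nonneg (fnorm_nonneg _) _), 
      ← Real.mul_rpow hb (gnorm_nonneg _)]
    refine Real.rpow_le_rpow (fnorm_nonneg _) ?_ hs0.le
    refine (fnorm_le_sum _).trans ?_
    refine (Finset.sum_le_sum fun q _ => abs_extD_le (G x) q).trans (le_of_eq ?_)
    simp [fcard, mul_assoc]
  have hL1 : (∫⁻ y in UB n, ENNReal.ofReal (fnorm (U y) ^ qs)).toReal = (R ^ n)⁻¹ * A := by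
    have : ∫⁻ y in UB n, ENNReal.ofReal (fnorm (U y) ^ qs) = 
        ∫⁻ y in UB n, ENNReal.ofReal (fnorm (u (Tm x₀ R y)) ^ qs) := by
      apply lintegral_congr_ae
      filter_upwards [hU] with x hx
      rw [hx]
    rw [this, cv_lint x₀ hR (fun z => ENNReal.ofReal (fnorm (u z) ^ qs)), ENNReal.toReal_mul,
      ENNReal.toReal_ofReal (by positivity), hA, integral_eq_lintegral_of_nonneg_ae]
    · exact Eventually.of_forall fun x => Real.rpow_nonneg (fnorm_nonneg _) _
    · exact ((aesm_fnorm hum).aemeasurable.pow_const qs).aestronglyMeasurable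
  have hL2 : ∫⁻ x, ENNReal.ofReal (fnorm (F x) ^ s) = ENNReal.ofReal (R ^ s * ((R ^ n)⁻¹ * D)) := by
    have e1 : ∫⁻ x, ENNReal.ofReal (fnorm (F x) ^ s) = ∫⁻ x in UB n, ENNReal.ofReal (fnorm (F x) ^ s) := by
      rw [← lintegral_indicator measurableSet_ball]
      congr 1
      funext x
      by_cases hx : x ∈ UB n
      · rw [Set.indicator_of_mem hx]
      · rw [Set.indicator_of_notMem hx, hF0 x hx]
        simp [fnorm, Real.zero_rpow hs0.ne']
    have e2 : ∫⁻ x in UB n, ENNReal.ofReal (fnorm (F x) ^ s) = 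
        ∫⁻ x in UB n, ENNReal.ofReal (R ^ s) * ENNReal.ofReal (fnorm (extD (G (Tm x₀ R x))) ^ s) := by
      apply lintegral_congr_ae
      filter_upwards [hF] with x hx
      rw [hx, fnorm_smul, abs_of_pos hR, Real.mul_rpow hR.le (fnorm_nonneg _), 
        ENNReal.ofReal_mul (by positivity)]
    rw [e1, e2, lintegral_const_mul' _ _ ENNReal.ofReal_ne_top, 
      cv_lint x₀ hR (fun z => ENNReal.ofReal (fnorm (extD (G z)) ^ s)),
      ← ofReal_integral_eq_lintegral_ofReal hDi 
        (Eventually.of_forall fun x => Real.rpow_nonneg (fnorm_nonneg _) _), 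
      ENNReal.ofReal_mul (by positivity), ENNReal.ofReal_mul (by positivity)]
  rw [hL2] at hE
  have hE2 := ENNReal.toReal_mono (ENNReal.mul_ne_top ENNReal.ofReal_ne_top 
    (ENNReal.rpow_ne_top_of_nonneg (by positivity) ENNReal.ofReal_ne_top)) hE
  rw [← ENNReal.toReal_rpow, hL1, ENNReal.toReal_mul, ENNReal.toReal_ofReal hC.le, ← ENNReal.toReal_rpow,
    ENNReal.toReal_ofReal (by positivity),
    Real.mul_rpow (x := R ^ s) (y := (R ^ n)⁻¹ * D) (by positivity) (by positivity),
    ← Real.rpow_mul hR.le, mul_one_div_cancel hs0.ne', Real.rpow_one] at hE2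
  have hvol : volume.real (ball x₀ R) = R ^ n * w := by
    have : Nonempty (Fin n) := ⟨⟨0, by omega⟩⟩
    rw [hw, measureReal_def, measureReal_def, Measure.addHaar_ball _ _ hR.le, 
      Measure.addHaar_ball _ (0 : En n) zero_le_one]
    simp only [finrank_euclideanSpace, Fintype.card_fin, one_pow, ENNReal.ofReal_one, one_mul,
      ENNReal.toReal_mul]
    rw [ENNReal.toReal_ofReal (by positivity)]
  rw [setAverage_eq, setAverage_eq, hvol, smul_eq_mul, smul_eq_mul, ← hA, ← hD, mul_inv_rev, mul_assoc,
    mul_assoc (w⁻¹), Real.mul_rpow (by positivity) (by positivity), 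
    Real.mul_rpow (x := w⁻¹) (y := (R ^ n)⁻¹ * D) (by positivity) (by positivity)]
  have hwp : (0:ℝ) < w⁻¹ ^ (1 / s) := by positivity
  calc _ ≤ w⁻¹ ^ r * (C * (R * ((R ^ n)⁻¹ * D) ^ (1 / s))) := 
        mul_le_mul_of_nonneg_left hE2 (by positivity)
    _ = _ := by field_simp

/-- **Poincaré–Sobolev inequality for `W^{1,s}_{δ,T}` forms.** For `n ≥ 2`, `N ≥ 1`,
`1 ≤ k ≤ n-1` and `1 < s < ∞` (with `s < n` so that the Sobolev exponent
`s* = ns/(n-s)` is defined), there is a constant `c = c(k,n,N,s) > 0` such that for any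
`R > 0` and any `u ∈ W^{1,s}_{δ,T}(B_R; Λ^k ℝ^n ⊗ ℝ^N)`,
`(⨍_{B_R} |u|^{s*})^{1/s*} ≤ c R (⨍_{B_R} |du|^s)^{1/s}`. -/
theorem poincare_sobolev_inequality
    (n N k : ℕ) (hn : 2 ≤ n) (hN : 1 ≤ N) (hk1 : 1 ≤ k) (hk2 : k ≤ n - 1)
    (s : ℝ) (hs1 : 1 < s) (hsn : s < n) :
    ∃ c : ℝ, 0 < c ∧
      ∀ (R : ℝ), 0 < R →
        ∀ (x₀ : En n) (u : En n → Form n N k) (G : En n → Fin n → Form n N k),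
          MemWdeltaT (ball x₀ R) s u G →
          (⨍ x in ball x₀ R, fnorm (u x) ^ ((n : ℝ) * s / ((n : ℝ) - s))) ^
              (((n : ℝ) - s) / ((n : ℝ) * s)) ≤
            c * R * (⨍ x in ball x₀ R, fnorm (extD (G x)) ^ s) ^ (1 / s) := by
  obtain ⟨j, rfl⟩ : ∃ j, k = j + 1 := ⟨k - 1, by omega⟩
  exact main_succ n N j hn hk2 s hs1 hsn
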